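/- arXiv:1609.05981 — 6 statements merged into one kernel-verified Lean document; each statement's English description precedes it below -/
import Mathlib

section
/- Let n be a positive integer and let B be an n×n integer matrix that is sign-skew-symmetric and acyclic. Then B admits an unfolding: there exist a type V, a group Γ acting on V, a skew-symmetric, Γ-equivariant, locally finite function b : V → V → ℤ, and a surjection p : V → Fin n whose fibers are exactly the Γ-orbits, such that (V, b, Γ) is a covering of B via p, and for every finite sequence of vertices i₁, …, i_s the iterated orbit mutation μ̃_{[i_s]}(⋯μ̃_{[i_1]}(b)⋯) is skew-symmetric, Γ-equivariant, locally finite, and has no Γ-loops and no Γ-2-cycles. -/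
/-- An `n × n` integer matrix is sign-skew-symmetric. -/
def SignSkewSymm {n : ℕ} (B : Matrix (Fin n) (Fin n) ℤ) : Prop :=
  ∀ i j, (B i j = 0 ∧ B j i = 0) ∨ B i j * B j i < 0

/-- `B` is acyclic: the directed graph with an arrow `i → j` whenever `B i j > 0`
has no directed cycles. -/
def MatAcyclic {n : ℕ} (B : Matrix (Fin n) (Fin n) ℤ) : Prop :=
  ∀ i, ¬ Relation.TransGen (fun i j => 0 < B i j) i i

/-- A quiver encoded by `b : V → V → ℤ` is skew-symmetric. -/
def SkewSymm {V : Type} (b : V → V → ℤ) : Prop := ∀ v w, b v w = - b w v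

/-- Local finiteness of the quiver `b`. -/
def LocFin {V : Type} (b : V → V → ℤ) : Prop := ∀ v, {w | b v w ≠ 0}.Finite

/-- `b` is `Γ`-equivariant. -/
def Equivariant {V : Type} (Γ : Type) [Group Γ] [MulAction Γ V] (b : V → V → ℤ) : Prop :=
  ∀ (g : Γ) (v w : V), b (g • v) (g • w) = b v w

/-- The quiver `b` has no `Γ`-loops. -/
def NoGammaLoops {V : Type} (Γ : Type) [Group Γ] [MulAction Γ V] (b : V → V → ℤ) : Prop :=
  ∀ (v : V) (g : Γ), b v (g • v) = 0

/-- The quiver `b` has no `Γ`-2-cycles. -/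
def NoGamma2Cycles {V : Type} (Γ : Type) [Group Γ] [MulAction Γ V] (b : V → V → ℤ) : Prop :=
  ¬ ∃ (v w : V) (g : Γ), w ∉ MulAction.orbit Γ v ∧ 0 < b v w ∧ 0 < b w (g • v)

open Classical in
/-- Orbit mutation of the quiver `b` at the orbit of the vertex `i`. -/
noncomputable def orbMut {V : Type} (Γ : Type) [Group Γ] [MulAction Γ V]
    (i : V) (b : V → V → ℤ) : V → V → ℤ :=
  fun v w =>
    if v ∈ MulAction.orbit Γ i ∨ w ∈ MulAction.orbit Γ i then - b v w
    else b v w + ∑ᶠ i' ∈ MulAction.orbit Γ i, (|b v i'| * b i' w + b v i' * |b i' w|) / 2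

/-- `(V, b)` is a covering of `B` via `p`: the sum of `b v w` over each fiber of `p`
equals the corresponding matrix entry. -/
def IsCovering {n : ℕ} {V : Type} (b : V → V → ℤ) (p : V → Fin n)
    (B : Matrix (Fin n) (Fin n) ℤ) : Prop :=
  ∀ (i : Fin n) (w : V), ∑ᶠ v ∈ p ⁻¹' {i}, b v w = B i (p w)

/-- The data of an unfolding of the matrix `B`: a quiver `b` on a vertex set `V` with a group
`Γ` acting on it and a surjection `p : V → Fin n` whose fibers are the `Γ`-orbits, such that
`(V, b, Γ)` covers `B` via `p` and every iterated orbit mutation of `b` is skew-symmetric,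
`Γ`-equivariant, locally finite, and has no `Γ`-loops and no `Γ`-2-cycles. -/
structure UnfoldingData (n : ℕ) (B : Matrix (Fin n) (Fin n) ℤ) where
  V : Type
  Γ : Type
  [grp : Group Γ]
  [act : MulAction Γ V]
  b : V → V → ℤ
  p : V → Fin n
  surj : Function.Surjective p
  fibers_eq_orbits : ∀ v w : V, p v = p w ↔ w ∈ MulAction.orbit Γ v
  skew : SkewSymm b
  equivariant : Equivariant Γ b
  locfin : LocFin b
  covering : IsCovering b p B
  mut_skew : ∀ is : List V, SkewSymm (is.foldl (fun c i => orbMut Γ i c) b)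
  mut_equivariant : ∀ is : List V, Equivariant Γ (is.foldl (fun c i => orbMut Γ i c) b)
  mut_locfin : ∀ is : List V, LocFin (is.foldl (fun c i => orbMut Γ i c) b)
  mut_noLoops : ∀ is : List V, NoGammaLoops Γ (is.foldl (fun c i => orbMut Γ i c) b)
  mut_no2Cycles : ∀ is : List V, NoGamma2Cycles Γ (is.foldl (fun c i => orbMut Γ i c) b)

open Module

namespace Unf

/-- Finite-dimensional representations (structure maps between all pairs of vertices; only those
along arrows matter). -/
structure QRep (V : Type) where
  M : V → Type
  [acg : ∀ v, AddCommGroup (M v)]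
  [mod : ∀ v, Module ℚ (M v)]
  [fin : ∀ v, Module.Finite ℚ (M v)]
  supp : {v | finrank ℚ (M v) ≠ 0}.Finite
  map : ∀ v w, M v →ₗ[ℚ] M w

attribute [instance] QRep.acg QRep.mod QRep.fin

variable {V : Type} (r : V → V → Prop)

/-- Vertexwise linear maps. -/
abbrev C0 (X Y : QRep V) := ∀ v, X.M v →ₗ[ℚ] Y.M v

def IsHom (X Y : QRep V) (f : C0 X Y) : Prop :=
  ∀ v w, r v w → ∀ x, Y.map v w (f v x) = f w (X.map v w x)

def Hom0 (X Y : QRep V) : Prop := ∀ f : C0 X Y, IsHom r X Y f → f = 0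

def Ext0 (X Y : QRep V) : Prop :=
  ∀ z : ∀ v w, X.M v →ₗ[ℚ] Y.M w, ∃ f : C0 X Y, ∀ v w, r v w → ∀ x,
    z v w x = Y.map v w (f v x) - f w (X.map v w x)

def Brick (X : QRep V) : Prop :=
  ∀ f : C0 X X, IsHom r X X f → ∃ c : ℚ, ∀ v x, f v x = c • x

/-- Dimension vector. -/
noncomputable def dm (X : QRep V) : V →₀ ℤ :=
  Finsupp.ofSupportFinite (fun v => (finrank ℚ (X.M v) : ℤ)) (by
    refine X.supp.subset ?_
    intro v hv
    simpa using hv)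

@[simp] lemma dm_apply (X : QRep V) (v : V) : dm X v = (finrank ℚ (X.M v) : ℤ) := rfl

open Classical in
/-- Euler form. -/
noncomputable def E : (V →₀ ℤ) →ₗ[ℤ] (V →₀ ℤ) →ₗ[ℤ] ℤ :=
  Finsupp.linearCombination ℤ (fun v => Finsupp.linearCombination ℤ
    (fun w => (if v = w then 1 else 0) - (if r v w then 1 else 0 : ℤ)))

section pi
variable {ι : Type} (W : ι → Type) [∀ i, AddCommGroup (W i)] [∀ i, Module ℚ (W i)]

noncomputable def piEquiv (S : Finset ι) (h : ∀ i, i ∉ S → Subsingleton (W i)) :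
    (∀ i, W i) ≃ₗ[ℚ] (∀ i : S, W i) :=
  LinearEquiv.ofBijective (LinearMap.pi fun i : S => LinearMap.proj i.1) (by
    classical
    constructor
    · intro f g hfg
      funext i
      by_cases hi : i ∈ S
      · exact congrFun hfg ⟨i, hi⟩
      · have := h i hi
        exact Subsingleton.elim _ _
    · intro g
      refine ⟨fun i => if hi : i ∈ S then g ⟨i, hi⟩ else 0, ?_⟩
      funext i
      simp)

lemma pi_finite [∀ i, Module.Finite ℚ (W i)] (S : Finset ι)
    (h : ∀ i, i ∉ S → Subsingleton (W i)) : Module.Finite ℚ (∀ i, W i) :=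
  Module.Finite.equiv (piEquiv W S h).symm

lemma pi_finrank [∀ i, Module.Finite ℚ (W i)] (S : Finset ι)
    (h : ∀ i, i ∉ S → Subsingleton (W i)) :
    finrank ℚ (∀ i, W i) = ∑ i ∈ S, finrank ℚ (W i) := by
  rw [(piEquiv W S h).finrank_eq, Module.finrank_pi_fintype]
  exact Finset.sum_coe_sort S (fun i => finrank ℚ (W i))
end pi

abbrev C1 (X Y : QRep V) := ∀ a : {a : V × V // r a.1 a.2}, X.M a.1.1 →ₗ[ℚ] Y.M a.1.2

/-- The differential computing Hom and Ext. -/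
noncomputable def del (X Y : QRep V) : C0 X Y →ₗ[ℚ] C1 r X Y where
  toFun f := fun a => Y.map a.1.1 a.1.2 ∘ₗ f a.1.1 - f a.1.2 ∘ₗ X.map a.1.1 a.1.2
  map_add' f g := by
    funext a; ext x; simp; abel
  map_smul' c f := by
    funext a; ext x; simp [smul_sub]

lemma mem_ker_del {X Y : QRep V} (f : C0 X Y) :
    f ∈ LinearMap.ker (del r X Y) ↔ IsHom r X Y f := by
  rw [LinearMap.mem_ker]
  constructor
  · intro h v w hr x
    have := congrFun h ⟨(v, w), hr⟩
    have := LinearMap.congr_fun this x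
    simpa [del, sub_eq_zero] using this
  · intro h
    funext a
    ext x
    simpa [del, sub_eq_zero] using h a.1.1 a.1.2 a.2 x

lemma sub_of_not_mem (X : QRep V) (v : V) (h : v ∉ (dm X).support) : Subsingleton (X.M v) := by
  have : finrank ℚ (X.M v) = 0 := by simpa using h
  exact Module.finrank_zero_iff.mp this

lemma c0_sub (X Y : QRep V) (v : V) (h : v ∉ (dm X).support) :
    Subsingleton (X.M v →ₗ[ℚ] Y.M v) := by
  have := sub_of_not_mem X v h
  infer_instance

open Classical in
lemma c1_sub (X Y : QRep V) (a : {a : V × V // r a.1 a.2})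
    (h : a ∉ Finset.subtype (fun a : V × V => r a.1 a.2) ((dm X).support ×ˢ (dm Y).support)) :
    Subsingleton (X.M a.1.1 →ₗ[ℚ] Y.M a.1.2) := by
  rw [Finset.mem_subtype, Finset.mem_product, not_and_or] at h
  rcases h with h | h
  · have := sub_of_not_mem X _ h
    infer_instance
  · have := sub_of_not_mem Y _ h
    infer_instance

instance c0_fin (X Y : QRep V) : Module.Finite ℚ (C0 X Y) :=
  pi_finite _ _ (c0_sub X Y)

instance c1_fin (X Y : QRep V) : Module.Finite ℚ (C1 r X Y) := by
  classical
  exact pi_finite _ _ (c1_sub r X Y)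

noncomputable def hdim (X Y : QRep V) : ℕ := finrank ℚ (LinearMap.ker (del r X Y))
noncomputable def edim (X Y : QRep V) : ℕ := finrank ℚ (C1 r X Y ⧸ LinearMap.range (del r X Y))

lemma E_eq (X Y : QRep V) :
    E r (dm X) (dm Y) = (finrank ℚ (C0 X Y) : ℤ) - finrank ℚ (C1 r X Y) := by
  classical
  rw [pi_finrank _ _ (c0_sub X Y), pi_finrank _ _ (c1_sub r X Y)]
  have h1 : E r (dm X) (dm Y) = ∑ v ∈ (dm X).support, ∑ w ∈ (dm Y).support,
      (dm X v * dm Y w * ((if v = w then 1 else 0) - (if r v w then 1 else 0 : ℤ))) := by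
    unfold E
    rw [Finsupp.linearCombination_apply, Finsupp.sum]
    rw [LinearMap.sum_apply]
    refine Finset.sum_congr rfl fun v _ => ?_
    rw [LinearMap.smul_apply, Finsupp.linearCombination_apply, Finsupp.sum, Finset.smul_sum]
    refine Finset.sum_congr rfl fun w _ => ?_
    simp only [smul_eq_mul]
    ring
  rw [h1]
  simp only [mul_sub, Finset.sum_sub_distrib]
  congr 1
  · push_cast
    refine Finset.sum_congr rfl fun v _ => ?_
    rw [Module.finrank_linearMap]
    simp only [mul_ite, mul_one, mul_zero, Finset.sum_ite_eq]
    split_ifs with h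
    · simp
    · have : finrank ℚ (Y.M v) = 0 := by simpa using h
      simp [this]
  · rw [Finset.sum_subtype_eq_sum_filter (s := (dm X).support ×ˢ (dm Y).support)
      (f := fun a : V × V => finrank ℚ (X.M a.1 →ₗ[ℚ] Y.M a.2))
      (p := fun a : V × V => r a.1 a.2)]
    rw [Finset.sum_filter, Finset.sum_product]
    push_cast
    refine Finset.sum_congr rfl fun v _ => Finset.sum_congr rfl fun w _ => ?_
    rw [Module.finrank_linearMap]
    simp

lemma euler (X Y : QRep V) : E r (dm X) (dm Y) = (hdim r X Y : ℤ) - edim r X Y := by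
  rw [E_eq]
  have h1 := LinearMap.finrank_range_add_finrank_ker (del r X Y)
  have h2 := Submodule.finrank_quotient_add_finrank (LinearMap.range (del r X Y))
  unfold hdim edim
  omega

lemma hdim_eq_zero {X Y : QRep V} : hdim r X Y = 0 ↔ Hom0 r X Y := by
  unfold hdim
  rw [Submodule.finrank_eq_zero, LinearMap.ker_eq_bot']
  constructor
  · intro h f hf
    exact h f (LinearMap.mem_ker.mp ((mem_ker_del r f).mpr hf))
  · intro h f hf
    exact h f ((mem_ker_del r f).mp (LinearMap.mem_ker.mpr hf))

lemma edim_eq_zero {X Y : QRep V} : edim r X Y = 0 ↔ Ext0 r X Y := by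
  classical
  unfold edim
  rw [Module.finrank_zero_iff, Submodule.Quotient.subsingleton_iff, LinearMap.range_eq_top]
  constructor
  · intro h z
    obtain ⟨f, hf⟩ := h (fun a => z a.1.1 a.1.2)
    refine ⟨f, fun v w hr x => ?_⟩
    have := LinearMap.congr_fun (congrFun hf ⟨(v, w), hr⟩) x
    simpa [del] using this.symm
  · intro h z
    obtain ⟨f, hf⟩ := h (fun v w => if hr : r v w then z ⟨(v, w), hr⟩ else 0)
    refine ⟨f, ?_⟩
    funext a
    ext x
    have := hf a.1.1 a.1.2 a.2 x
    rw [dif_pos a.2] at this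
    simpa [del] using this.symm

variable {r}
lemma ext0_of {X Y : QRep V} (h : Hom0 r X Y) (hE : E r (dm X) (dm Y) = 0) : Ext0 r X Y := by
  rw [← edim_eq_zero]
  rw [← hdim_eq_zero] at h
  have := euler r X Y
  omega

lemma E_zero_of {X Y : QRep V} (h : Hom0 r X Y) (h' : Ext0 r X Y) : E r (dm X) (dm Y) = 0 := by
  rw [← edim_eq_zero] at h'
  rw [← hdim_eq_zero] at h
  have := euler r X Y
  omega

lemma E_pos_of {X Y : QRep V} (h : ¬ Hom0 r X Y) (h' : Ext0 r X Y) : 0 < E r (dm X) (dm Y) := by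
  rw [← edim_eq_zero] at h'
  rw [← hdim_eq_zero] at h
  have := euler r X Y
  omega

lemma E_nonneg_of {X Y : QRep V} (h' : Ext0 r X Y) : 0 ≤ E r (dm X) (dm Y) := by
  rw [← edim_eq_zero] at h'
  have := euler r X Y
  omega

lemma E_nonpos_of {X Y : QRep V} (h : Hom0 r X Y) : E r (dm X) (dm Y) ≤ 0 := by
  rw [← hdim_eq_zero] at h
  have := euler r X Y
  omega

lemma edim_of {X Y : QRep V} (h : Hom0 r X Y) : (edim r X Y : ℤ) = - E r (dm X) (dm Y) := by
  rw [← hdim_eq_zero] at h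
  have := euler r X Y
  omega

lemma hdim_of {X Y : QRep V} (h : Ext0 r X Y) : (hdim r X Y : ℤ) = E r (dm X) (dm Y) := by
  rw [← edim_eq_zero] at h
  have := euler r X Y
  omega

lemma isHom_id (X : QRep V) : IsHom r X X (fun _ => LinearMap.id) := fun _ _ _ _ => rfl

lemma ext0_self {X : QRep V} (h : Brick r X) (hE : E r (dm X) (dm X) = 1) : Ext0 r X X := by
  rw [← edim_eq_zero]
  have := euler r X X
  have h1 : hdim r X X ≤ 1 := by
    unfold hdim
    refine finrank_le_one (⟨fun _ => LinearMap.id, (mem_ker_del r _).mpr (isHom_id X)⟩) ?_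
    rintro ⟨f, hf⟩
    obtain ⟨c, hc⟩ := h f ((mem_ker_del r _).mp hf)
    refine ⟨c, Subtype.ext ?_⟩
    funext v
    ext x
    simp [hc v x]
  omega

end Unf

open Module

namespace Unf
variable {V : Type} {r : V → V → Prop}

/-- Short exact sequences of representations. -/
structure SES (r : V → V → Prop) {A B C : QRep V} (i : C0 A B) (q : C0 B C) : Prop where
  hi : IsHom r A B i
  hq : IsHom r B C q
  inj : ∀ v, Function.Injective (i v)
  surj : ∀ v, Function.Surjective (q v)
  exact : ∀ v x, q v x = 0 ↔ ∃ a, i v a = x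

lemma exists_retr {A B : QRep V} (i : C0 A B) (h : ∀ v, Function.Injective (i v)) :
    ∃ t : C0 B A, ∀ v a, t v (i v a) = a := by
  have : ∀ v, ∃ t : B.M v →ₗ[ℚ] A.M v, t ∘ₗ i v = LinearMap.id := fun v =>
    (i v).exists_leftInverse_of_injective (LinearMap.ker_eq_bot.mpr (h v))
  choose t ht using this
  exact ⟨t, fun v a => LinearMap.congr_fun (ht v) a⟩

lemma exists_sect {B C : QRep V} (q : C0 B C) (h : ∀ v, Function.Surjective (q v)) :
    ∃ s : C0 C B, ∀ v c, q v (s v c) = c := by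
  have : ∀ v, ∃ s : C.M v →ₗ[ℚ] B.M v, q v ∘ₗ s = LinearMap.id := fun v =>
    (q v).exists_rightInverse_of_surjective (LinearMap.range_eq_top.mpr (h v))
  choose s hs using this
  exact ⟨s, fun v a => LinearMap.congr_fun (hs v) a⟩

def comp0 {X Y Z : QRep V} (g : C0 Y Z) (f : C0 X Y) : C0 X Z := fun v => g v ∘ₗ f v

@[simp] lemma comp0_apply {X Y Z : QRep V} (g : C0 Y Z) (f : C0 X Y) (v : V) (x : X.M v) :
    comp0 g f v x = g v (f v x) := rfl

lemma IsHom.comp {X Y Z : QRep V} {g : C0 Y Z} {f : C0 X Y} (hg : IsHom r Y Z g)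
    (hf : IsHom r X Y f) : IsHom r X Z (comp0 g f) := by
  intro v w h x
  simp [hg v w h, hf v w h]

lemma IsHom.add {X Y : QRep V} {g f : C0 X Y} (hg : IsHom r X Y g)
    (hf : IsHom r X Y f) : IsHom r X Y (g + f) := by
  intro v w h x
  simp [hg v w h, hf v w h]

lemma IsHom.sub {X Y : QRep V} {g f : C0 X Y} (hg : IsHom r X Y g)
    (hf : IsHom r X Y f) : IsHom r X Y (g - f) := by
  intro v w h x
  simp [hg v w h, hf v w h]

lemma IsHom.smul {X Y : QRep V} {g : C0 X Y} (c : ℚ) (hg : IsHom r X Y g) :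
    IsHom r X Y (c • g) := by
  intro v w h x
  simp [hg v w h]

lemma C0.ext {X Y : QRep V} {f g : C0 X Y} (h : ∀ v x, f v x = g v x) : f = g := by
  funext v
  exact LinearMap.ext (h v)

lemma desc {B C Y : QRep V} {q : C0 B C} (hq : IsHom r B C q) (hs : ∀ v, Function.Surjective (q v))
    {f : C0 B Y} (hf : IsHom r B Y f) (hk : ∀ v x, q v x = 0 → f v x = 0) :
    ∃ f' : C0 C Y, IsHom r C Y f' ∧ ∀ v x, f' v (q v x) = f v x := by
  obtain ⟨s, hs'⟩ := exists_sect q hs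
  have key : ∀ v x, f v (s v (q v x)) = f v x := by
    intro v x
    have := hk v (s v (q v x) - x) (by simp [hs'])
    rwa [map_sub, sub_eq_zero] at this
  refine ⟨comp0 f s, ?_, key⟩
  intro v w h c
  obtain ⟨b, rfl⟩ := hs v c
  rw [comp0_apply, comp0_apply, key, hf v w h, hq v w h, key]

lemma lift {A B Y : QRep V} {i : C0 A B} (hi : IsHom r A B i) (hin : ∀ v, Function.Injective (i v))
    {f : C0 Y B} (hf : IsHom r Y B f) (hk : ∀ v y, ∃ a, i v a = f v y) :
    ∃ f' : C0 Y A, IsHom r Y A f' ∧ ∀ v y, i v (f' v y) = f v y := by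
  obtain ⟨t, ht⟩ := exists_retr i hin
  have key : ∀ v y, i v (t v (f v y)) = f v y := by
    intro v y
    obtain ⟨a, ha⟩ := hk v y
    rw [← ha, ht]
  refine ⟨comp0 t f, ?_, key⟩
  intro v w h y
  apply hin w
  rw [← hi v w h]
  simp only [comp0_apply]
  rw [key, key, hf v w h]

lemma Hom0.of_inj {A B Y : QRep V} {i : C0 A B} (hi : IsHom r A B i)
    (hin : ∀ v, Function.Injective (i v)) (h : Hom0 r Y B) : Hom0 r Y A := by
  intro f hf
  have := h _ (hi.comp hf)
  refine C0.ext fun v y => hin v ?_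
  have := LinearMap.congr_fun (congrFun this v) y
  simpa using this

lemma Hom0.of_surj {B C Y : QRep V} {q : C0 B C} (hq : IsHom r B C q)
    (hs : ∀ v, Function.Surjective (q v)) (h : Hom0 r B Y) : Hom0 r C Y := by
  intro f hf
  have := h _ (hf.comp hq)
  refine C0.ext fun v y => ?_
  obtain ⟨b, rfl⟩ := hs v y
  have := LinearMap.congr_fun (congrFun this v) b
  simpa using this

lemma SES.dm_eq {A B C : QRep V} {i : C0 A B} {q : C0 B C} (S : SES r i q) :
    dm B = dm A + dm C := by
  ext v
  have h1 := LinearMap.finrank_range_add_finrank_ker (q v)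
  have h2 : finrank ℚ (LinearMap.range (q v)) = finrank ℚ (C.M v) := by
    rw [LinearMap.range_eq_top.mpr (S.surj v), finrank_top]
  have h3 : LinearMap.ker (q v) = LinearMap.range (i v) := by
    ext x
    rw [LinearMap.mem_ker, S.exact, LinearMap.mem_range]
  have h4 := LinearMap.finrank_range_of_inj (S.inj v)
  simp only [dm_apply, Finsupp.add_apply]
  rw [h3] at h1
  omega

lemma SES.hom0_left {A B C Y : QRep V} {i : C0 A B} {q : C0 B C} (S : SES r i q)
    (h1 : Hom0 r A Y) (h2 : Hom0 r C Y) : Hom0 r B Y := by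
  intro f hf
  have h3 := h1 _ (hf.comp S.hi)
  obtain ⟨f', hf', hh⟩ := desc S.hq S.surj hf (by
    intro v x hx
    obtain ⟨a, rfl⟩ := (S.exact v x).mp hx
    exact LinearMap.congr_fun (congrFun h3 v) a)
  refine C0.ext fun v x => ?_
  rw [← hh, h2 _ hf']
  rfl

lemma SES.hom0_right {A B C Y : QRep V} {i : C0 A B} {q : C0 B C} (S : SES r i q)
    (h1 : Hom0 r Y A) (h2 : Hom0 r Y C) : Hom0 r Y B := by
  intro f hf
  have h3 := h2 _ (S.hq.comp hf)
  obtain ⟨f', hf', hh⟩ := lift S.hi S.inj hf (by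
    intro v x
    exact (S.exact v _).mp (LinearMap.congr_fun (congrFun h3 v) x))
  refine C0.ext fun v x => ?_
  rw [← hh, h1 _ hf']
  simp

lemma Ext0.of_inj {A B Y : QRep V} {i : C0 A B} (hi : IsHom r A B i)
    (hin : ∀ v, Function.Injective (i v)) (h : Ext0 r B Y) : Ext0 r A Y := by
  intro z
  obtain ⟨t, ht⟩ := exists_retr i hin
  obtain ⟨f, hf⟩ := h (fun v w => z v w ∘ₗ t v)
  refine ⟨comp0 f i, fun v w hr a => ?_⟩
  have := hf v w hr (i v a)
  simp only [LinearMap.comp_apply, ht] at this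
  rw [this, hi v w hr]
  rfl

lemma Ext0.of_surj {B C Y : QRep V} {q : C0 B C} (hq : IsHom r B C q)
    (hs : ∀ v, Function.Surjective (q v)) (h : Ext0 r Y B) : Ext0 r Y C := by
  intro z
  obtain ⟨s, hs'⟩ := exists_sect q hs
  obtain ⟨f, hf⟩ := h (fun v w => s w ∘ₗ z v w)
  refine ⟨comp0 q f, fun v w hr y => ?_⟩
  have := congrArg (q w) (hf v w hr y)
  simp only [LinearMap.comp_apply, hs', map_sub] at this
  rw [this, ← hq v w hr]
  rfl

lemma SES.lift_ext {A B C Y : QRep V} {i : C0 A B} {q : C0 B C} (S : SES r i q)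
    (h : Ext0 r Y A) {g : C0 Y C} (hg : IsHom r Y C g) :
    ∃ g' : C0 Y B, IsHom r Y B g' ∧ ∀ v y, q v (g' v y) = g v y := by
  obtain ⟨s, hs⟩ := exists_sect q S.surj
  obtain ⟨t, ht⟩ := exists_retr i S.inj
  obtain ⟨f, hf⟩ := h (fun v w => t w ∘ₗ (B.map v w ∘ₗ s v ∘ₗ g v - s w ∘ₗ g w ∘ₗ Y.map v w))
  have key : ∀ v w, r v w → ∀ y, B.map v w (s v (g v y)) - s w (g w (Y.map v w y)) =
      i w (A.map v w (f v y) - f w (Y.map v w y)) := by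
    intro v w hr y
    rw [← hf v w hr]
    have : q w (B.map v w (s v (g v y)) - s w (g w (Y.map v w y))) = 0 := by
      rw [map_sub, hs, ← S.hq v w hr, hs, hg v w hr, sub_self]
    obtain ⟨a, ha⟩ := (S.exact w _).mp this
    simp only [LinearMap.comp_apply, LinearMap.sub_apply]
    rw [← ha, ht]
  refine ⟨fun v => s v ∘ₗ g v - i v ∘ₗ f v, fun v w hr y => ?_, fun v y => ?_⟩
  · have := key v w hr y
    simp only [LinearMap.comp_apply, LinearMap.sub_apply, map_sub] at this ⊢
    rw [S.hi v w hr, sub_eq_sub_iff_add_eq_add]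
    rw [sub_eq_sub_iff_add_eq_add] at this
    rw [this]; abel
  · simp only [LinearMap.comp_apply, LinearMap.sub_apply, map_sub, hs]
    rw [(S.exact v _).mpr ⟨_, rfl⟩, sub_zero]

lemma SES.extend_ext {A B C Y : QRep V} {i : C0 A B} {q : C0 B C} (S : SES r i q)
    (h : Ext0 r C Y) {g : C0 A Y} (hg : IsHom r A Y g) :
    ∃ g' : C0 B Y, IsHom r B Y g' ∧ ∀ v a, g' v (i v a) = g v a := by
  obtain ⟨s, hs⟩ := exists_sect q S.surj
  obtain ⟨t, ht⟩ := exists_retr i S.inj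
  obtain ⟨f, hf⟩ := h (fun v w => (Y.map v w ∘ₗ g v ∘ₗ t v - g w ∘ₗ t w ∘ₗ B.map v w) ∘ₗ s v)
  have key : ∀ v w, r v w → ∀ x, Y.map v w (g v (t v x)) - g w (t w (B.map v w x)) =
      Y.map v w (f v (q v x)) - f w (C.map v w (q v x)) := by
    intro v w hr x
    rw [← hf v w hr]
    have : q v (x - s v (q v x)) = 0 := by
      rw [map_sub, hs, sub_self]
    obtain ⟨a, ha⟩ := (S.exact v _).mp this
    have hx : x = s v (q v x) + i v a := by rw [ha]; abel
    have h1 : Y.map v w (g v (t v (i v a))) - g w (t w (B.map v w (i v a))) = 0 := by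
      rw [ht, S.hi v w hr, ht, hg v w hr, sub_self]
    simp only [LinearMap.comp_apply, LinearMap.sub_apply]
    conv_lhs => rw [hx]
    simp only [map_add]
    rw [add_sub_add_comm, h1, add_zero]
  refine ⟨fun v => g v ∘ₗ t v - f v ∘ₗ q v, fun v w hr y => ?_, fun v y => ?_⟩
  · have := key v w hr y
    simp only [LinearMap.comp_apply, LinearMap.sub_apply, map_sub] at this ⊢
    rw [← S.hq v w hr, sub_eq_sub_iff_add_eq_add]
    rw [sub_eq_sub_iff_add_eq_add] at this
    rw [this]; abel
  · simp only [LinearMap.comp_apply, LinearMap.sub_apply, ht]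
    rw [(S.exact v _).mpr ⟨_, rfl⟩, map_zero, sub_zero]

lemma SES.ext0_coker {A B C Y : QRep V} {i : C0 A B} {q : C0 B C} (S : SES r i q)
    (h : Ext0 r B Y) (h1 : Hom0 r A Y) : Ext0 r C Y := by
  intro z
  obtain ⟨f, hf⟩ := h (fun v w => z v w ∘ₗ q v)
  have h2 : ∀ v a, f v (i v a) = 0 := by
    have : IsHom r A Y (comp0 f i) := by
      intro v w hr a
      have := hf v w hr (i v a)
      simp only [LinearMap.comp_apply, (S.exact v _).mpr ⟨a, rfl⟩, map_zero] at this
      rw [S.hi v w hr] at this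
      exact (sub_eq_zero.mp this.symm)
    intro v a
    exact LinearMap.congr_fun (congrFun (h1 _ this) v) a
  obtain ⟨s, hs⟩ := exists_sect q S.surj
  have key : ∀ v x, f v (s v (q v x)) = f v x := by
    intro v x
    obtain ⟨a, ha⟩ := (S.exact v (s v (q v x) - x)).mp (by simp [hs])
    have := h2 v a
    rwa [ha, map_sub, sub_eq_zero] at this
  refine ⟨comp0 f s, fun v w hr c => ?_⟩
  obtain ⟨b, rfl⟩ := S.surj v c
  have := hf v w hr b
  simp only [LinearMap.comp_apply] at this
  simp only [comp0_apply]
  rw [this, key, S.hq v w hr, key]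

/-- The key homological lemma (Happel--Ringel style). -/
lemma hr_core {M R : QRep V} (hM : Brick r M) (hE : Ext0 r R M) {f : C0 M R} (hf : IsHom r M R f)
    (hn : ¬ ∀ v, Function.Injective (f v)) :
    ∃ e : C0 R R, IsHom r R R e ∧ (∀ v x, e v (f v x) = f v x) ∧ ∀ v y, ∃ x, e v y = f v x := by
  have hg : ∀ v, ∃ g : R.M v →ₗ[ℚ] M.M v, ∀ x, f v (g (f v x)) = f v x := by
    intro v
    obtain ⟨g1, hg1⟩ := (f v).rangeRestrict.exists_rightInverse_of_surjective
      (LinearMap.range_rangeRestrict _)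
    obtain ⟨g2, hg2⟩ := (LinearMap.range (f v)).subtype.exists_leftInverse_of_injective (by simp)
    refine ⟨g1 ∘ₗ g2, fun x => ?_⟩
    have h2 : g2 (f v x) = (f v).rangeRestrict x := LinearMap.congr_fun hg2 ((f v).rangeRestrict x)
    have h1 := LinearMap.congr_fun hg1 ((f v).rangeRestrict x)
    have := congrArg Subtype.val h1
    simp only [LinearMap.comp_apply]
    rw [h2]
    exact this
  choose g hg using hg
  obtain ⟨h, hh⟩ := hE (fun v w => g w ∘ₗ (R.map v w ∘ₗ f v ∘ₗ g v - f w ∘ₗ g w ∘ₗ R.map v w))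
  simp only [LinearMap.comp_apply, LinearMap.sub_apply] at hh
  have hend : IsHom r M M (comp0 h f) := by
    intro v w hr x
    have := hh v w hr (f v x)
    rw [hg, hf v w hr, hg, sub_self, map_zero] at this
    exact sub_eq_zero.mp this.symm
  obtain ⟨c, hc⟩ := hM _ hend
  have hc0 : c = 0 := by
    by_contra hne
    apply hn
    intro v x y hxy
    have h1 := hc v x
    have h2 := hc v y
    simp only [comp0_apply] at h1 h2
    rw [hxy, h2] at h1
    exact (smul_right_injective _ hne h1).symm
  have hz : ∀ v x, h v (f v x) = 0 := fun v x => by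
    have := hc v x
    rw [hc0, zero_smul] at this
    exact this
  refine ⟨fun v => f v ∘ₗ g v - f v ∘ₗ h v, ?_, ?_, ?_⟩
  · intro v w hr y
    have := congrArg (f w) (hh v w hr y)
    have h3 : f w (g w (R.map v w (f v (g v y)) - f w (g w (R.map v w y)))) =
      R.map v w (f v (g v y)) - f w (g w (R.map v w y)) := by
      rw [hf v w hr, ← map_sub, hg]
    rw [h3, map_sub, ← hf v w hr] at this
    simp only [LinearMap.comp_apply, LinearMap.sub_apply, map_sub]
    rw [sub_eq_sub_iff_add_eq_add] at this ⊢
    rw [this]; abel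
  · intro v x
    simp [hg, hz]
  · intro v y
    exact ⟨g v y - h v y, by simp⟩

lemma le_of_surj {M P : QRep V} {f : C0 M P} (h : ∀ v, Function.Surjective (f v)) :
    dm P ≤ dm M := by
  intro v
  simp only [dm_apply]
  exact_mod_cast (f v).finrank_le_finrank_of_surjective (h v)

lemma surj_of_inj {M P : QRep V} {f : C0 M P} (h : ∀ v, Function.Injective (f v))
    (hd : dm P ≤ dm M) : ∀ v, Function.Surjective (f v) := by
  intro v
  have h1 := (f v).finrank_le_finrank_of_injective (h v)
  have h2 := hd v
  simp only [dm_apply] at h2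
  have h3 : finrank ℚ (M.M v) = finrank ℚ (P.M v) := by omega
  exact (LinearMap.injective_iff_surjective_of_finrank_eq_finrank h3).mp (h v)

lemma hr_single {M P : QRep V} (hM : Brick r M) (hP : Brick r P) (hE : Ext0 r P M)
    {f : C0 M P} (hf : IsHom r M P f) (hne : f ≠ 0) :
    (dm P ≤ dm M → ∀ v, Function.Surjective (f v)) ∧
    (¬ dm P ≤ dm M → ∀ v, Function.Injective (f v)) := by
  by_cases hi : ∀ v, Function.Injective (f v)
  · exact ⟨fun h => surj_of_inj hi h, fun _ => hi⟩
  · obtain ⟨e, he, he1, he2⟩ := hr_core hM hE hf hi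
    obtain ⟨c, hc⟩ := hP e he
    have hc1 : c ≠ 0 := by
      rintro rfl
      apply hne
      refine C0.ext fun v x => ?_
      rw [← he1, hc]
      simp
    have hs : ∀ v, Function.Surjective (f v) := by
      intro v y
      obtain ⟨x, hx⟩ := he2 v (c⁻¹ • y)
      refine ⟨x, ?_⟩
      rw [← hx, hc, smul_smul, mul_inv_cancel₀ hc1, one_smul]
    exact ⟨fun _ => hs, fun h => absurd (le_of_surj hs) h⟩

end Unf

open Module

namespace Unf
variable {V : Type} {r : V → V → Prop}

lemma exists_ker {N R : QRep V} {f : C0 N R} (hf : IsHom r N R f)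
    (hs : ∀ v, Function.Surjective (f v)) : ∃ (K : QRep V) (i : C0 K N), SES r i f := by
  have ht : ∀ v, ∃ t : N.M v →ₗ[ℚ] LinearMap.ker (f v),
      t ∘ₗ (LinearMap.ker (f v)).subtype = LinearMap.id := fun v =>
    (LinearMap.ker (f v)).subtype.exists_leftInverse_of_injective (by simp)
  choose t ht using ht
  refine ⟨{ M := fun v => LinearMap.ker (f v)
            supp := ?_
            map := fun v w => t w ∘ₗ N.map v w ∘ₗ (LinearMap.ker (f v)).subtype },
          fun v => (LinearMap.ker (f v)).subtype, ?_⟩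
  · refine N.supp.subset fun v hv => ?_
    simp only [Set.mem_ofPred_eq] at hv ⊢
    have := Submodule.finrank_le (LinearMap.ker (f v))
    omega
  · refine ⟨?_, hf, fun v => Subtype.val_injective, hs, fun v x => ?_⟩
    · intro v w hr x
      have h1 : f w (N.map v w x.1) = 0 := by
        rw [← hf v w hr, LinearMap.mem_ker.mp x.2, map_zero]
      have h2 := LinearMap.congr_fun (ht w) ⟨N.map v w x.1, h1⟩
      exact (congrArg Subtype.val h2).symm
    · constructor
      · intro h
        exact ⟨⟨x, h⟩, rfl⟩
      · rintro ⟨a, rfl⟩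
        exact a.2

lemma exists_coker {N R : QRep V} {f : C0 N R} (hf : IsHom r N R f)
    (hi : ∀ v, Function.Injective (f v)) : ∃ (C : QRep V) (q : C0 R C), SES r f q := by
  have hs : ∀ v, ∃ s : (R.M v ⧸ LinearMap.range (f v)) →ₗ[ℚ] R.M v,
      (LinearMap.range (f v)).mkQ ∘ₗ s = LinearMap.id := fun v =>
    (LinearMap.range (f v)).mkQ.exists_rightInverse_of_surjective (by simp)
  choose s hs using hs
  refine ⟨{ M := fun v => R.M v ⧸ LinearMap.range (f v)
            supp := ?_
            map := fun v w => (LinearMap.range (f w)).mkQ ∘ₗ R.map v w ∘ₗ s v },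
          fun v => (LinearMap.range (f v)).mkQ, ?_⟩
  · refine R.supp.subset fun v hv => ?_
    simp only [Set.mem_ofPred_eq] at hv ⊢
    have := Submodule.finrank_quotient_add_finrank (LinearMap.range (f v))
    omega
  · refine ⟨hf, ?_, hi, fun v => Submodule.mkQ_surjective _, fun v x => ?_⟩
    · intro v w hr x
      change (LinearMap.range (f w)).mkQ (R.map v w (s v _)) = _
      rw [← sub_eq_zero, ← map_sub, ← map_sub, Submodule.mkQ_apply, Submodule.Quotient.mk_eq_zero]
      have : s v ((LinearMap.range (f v)).mkQ x) - x ∈ LinearMap.range (f v) := by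
        rw [← Submodule.Quotient.mk_eq_zero, ← Submodule.mkQ_apply, map_sub]
        have := LinearMap.congr_fun (hs v) ((LinearMap.range (f v)).mkQ x)
        simp only [LinearMap.comp_apply, LinearMap.id_apply] at this
        rw [this, sub_self]
      obtain ⟨a, ha⟩ := this
      rw [← ha, hf v w hr]
      exact ⟨_, rfl⟩
    · rw [Submodule.mkQ_apply, Submodule.Quotient.mk_eq_zero, LinearMap.mem_range]

section sum
variable {ι : Type} [Fintype ι] (P : ι → QRep V)

/-- Finite direct sums. -/
def sumRep : QRep V where
  M v := ∀ i, (P i).M v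
  supp := by
    refine (Set.finite_iUnion fun i => (P i).supp).subset fun v hv => ?_
    simp only [Set.mem_ofPred_eq] at hv
    rw [Module.finrank_pi_fintype] at hv
    obtain ⟨i, _, hi⟩ := Finset.exists_ne_zero_of_sum_ne_zero hv
    exact Set.mem_iUnion.mpr ⟨i, hi⟩
  map v w := LinearMap.pi fun i => (P i).map v w ∘ₗ LinearMap.proj i

lemma dm_sumRep : dm (sumRep P) = ∑ i, dm (P i) := by
  ext v
  rw [Finsupp.finsetSum_apply]
  simp only [dm_apply]
  change ((finrank ℚ (∀ i, (P i).M v) : ℕ) : ℤ) = _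
  rw [Module.finrank_pi_fintype]
  push_cast
  rfl

def sproj (i : ι) : C0 (sumRep P) (P i) := fun v => LinearMap.proj (φ := fun i => (P i).M v) i

lemma sproj_hom (i : ι) : IsHom r (sumRep P) (P i) (sproj P i) := fun _ _ _ _ => rfl

lemma hom0_sum_right {Y : QRep V} (h : ∀ i, Hom0 r Y (P i)) : Hom0 r Y (sumRep P) := by
  intro f hf
  refine C0.ext fun v y => ?_
  funext i
  exact LinearMap.congr_fun (congrFun (h i _ ((sproj_hom P i).comp hf)) v) y

variable [DecidableEq ι]
def sinc (i : ι) : C0 (P i) (sumRep P) := fun v => LinearMap.single ℚ (fun i => (P i).M v) i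

lemma sinc_hom (i : ι) : IsHom r (P i) (sumRep P) (sinc P i) := by
  intro v w hr x
  funext j
  change (P j).map v w (Pi.single (M := fun i => (P i).M v) i x j) =
    Pi.single (M := fun i => (P i).M w) i _ j
  by_cases h : j = i
  · subst h
    simp
  · simp [h]

lemma sum_sinc (v : V) (x : (sumRep P).M v) : ∑ i, sinc P i v (sproj P i v x) = x := by
  exact Finset.univ_sum_single (f := x)

lemma sinc_inj (i : ι) (v : V) : Function.Injective (sinc P i v) :=
  Pi.single_injective (M := fun i => (P i).M v) i

lemma sum_eq_zero {Y : QRep V} {f : C0 (sumRep P) Y} (h : ∀ i, comp0 f (sinc P i) = 0) : f = 0 := by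
  refine C0.ext fun v x => ?_
  rw [← sum_sinc P v x, map_sum]
  refine Finset.sum_eq_zero fun i _ => ?_
  exact LinearMap.congr_fun (congrFun (h i) v) _

lemma hom0_sum_left {Y : QRep V} (h : ∀ i, Hom0 r (P i) Y) : Hom0 r (sumRep P) Y := by
  intro f hf
  exact sum_eq_zero P fun i => h i _ (hf.comp (sinc_hom P i))

lemma ext0_sum_left {Y : QRep V} (h : ∀ i, Ext0 r (P i) Y) : Ext0 r (sumRep P) Y := by
  intro z
  choose f hf using fun i => h i (fun v w => z v w ∘ₗ sinc P i v)
  refine ⟨fun v => ∑ i, f i v ∘ₗ sproj P i v, fun v w hr x => ?_⟩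
  simp only [LinearMap.sum_apply, LinearMap.comp_apply, map_sum]
  rw [← Finset.sum_sub_distrib]
  conv_lhs => rw [← sum_sinc P v x, map_sum]
  refine Finset.sum_congr rfl fun i _ => ?_
  exact hf i v w hr _

end sum

/-- Extension attached to a cocycle. -/
def extRep (R X : QRep V) (z : ∀ v w, X.M v →ₗ[ℚ] R.M w) : QRep V where
  M v := R.M v × X.M v
  supp := by
    refine (R.supp.union X.supp).subset fun v hv => ?_
    simp only [Set.mem_ofPred_eq, Module.finrank_prod, Set.mem_union] at hv ⊢
    omega
  map v w := LinearMap.prod (R.map v w ∘ₗ LinearMap.fst ℚ _ _ + z v w ∘ₗ LinearMap.snd ℚ _ _)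
    (X.map v w ∘ₗ LinearMap.snd ℚ _ _)

lemma extRep_ses (R X : QRep V) (z : ∀ v w, X.M v →ₗ[ℚ] R.M w) :
    SES r (A := R) (B := extRep R X z) (C := X) (fun v => LinearMap.inl ℚ (R.M v) (X.M v))
      (fun v => LinearMap.snd ℚ (R.M v) (X.M v)) where
  hi v w hr x := by
    change ((R.map v w x + z v w 0, X.map v w 0) : R.M w × X.M w) = (R.map v w x, 0)
    simp
  hq v w hr x := rfl
  inj v := LinearMap.inl_injective
  surj v := LinearMap.snd_surjective
  exact v x := by
    constructor
    · intro h
      exact ⟨x.1, Prod.ext rfl h.symm⟩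
    · rintro ⟨a, rfl⟩
      rfl

end Unf

open Module

namespace Unf
variable {V : Type} {r : V → V → Prop}

lemma sum_C0_apply {X Y : QRep V} {α : Type} (s : Finset α) (g : α → C0 X Y) (v : V) (x : X.M v) :
    (∑ a ∈ s, g a) v x = ∑ a ∈ s, g a v x := by
  rw [Finset.sum_apply, LinearMap.sum_apply]

lemma ext_basis (r : V → V → Prop) (X Y : QRep V) :
    ∃ ζ : Fin (edim r X Y) → ∀ v w, X.M v →ₗ[ℚ] Y.M w,
    ∀ l : Fin (edim r X Y) → ℚ, (∃ h : C0 X Y, ∀ v w, r v w → ∀ x,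
      ∑ a, l a • ζ a v w x = Y.map v w (h v x) - h w (X.map v w x)) → ∀ a, l a = 0 := by
  classical
  let bs := Module.finBasis ℚ (C1 r X Y ⧸ LinearMap.range (del r X Y))
  choose z hz using fun a => Submodule.mkQ_surjective (LinearMap.range (del r X Y)) (bs a)
  refine ⟨fun a v w => if hr : r v w then z a ⟨(v, w), hr⟩ else 0, ?_⟩
  rintro l ⟨h, hh⟩
  refine Fintype.linearIndependent_iff.mp bs.linearIndependent l ?_
  have : ∑ a, l a • z a = del r X Y h := by
    funext e
    obtain ⟨⟨v, w⟩, hr⟩ := e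
    ext x
    have := hh v w hr x
    simp only [dif_pos hr] at this
    rw [Finset.sum_apply, LinearMap.sum_apply]
    exact this
  simp_rw [← hz]
  have h2 : (LinearMap.range (del r X Y)).mkQ (∑ a, l a • z a) = 0 := by
    rw [this, Submodule.mkQ_apply, Submodule.Quotient.mk_eq_zero]
    exact ⟨h, rfl⟩
  rw [← h2, map_sum]
  simp only [map_smul]
  rfl

lemma hom_basis (r : V → V → Prop) (X Y : QRep V) :
    ∃ β : Fin (hdim r X Y) → C0 X Y, (∀ a, IsHom r X Y (β a)) ∧
    (∀ l : Fin (hdim r X Y) → ℚ, ∑ a, l a • β a = 0 → ∀ a, l a = 0) ∧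
    ∀ g, IsHom r X Y g → ∃ l : Fin (hdim r X Y) → ℚ, g = ∑ a, l a • β a := by
  let bs := Module.finBasis ℚ (LinearMap.ker (del r X Y))
  refine ⟨fun a => (bs a).1, fun a => (mem_ker_del r _).mp (bs a).2, fun l hl => ?_, fun g hg => ?_⟩
  · refine Fintype.linearIndependent_iff.mp bs.linearIndependent l ?_
    apply Subtype.ext
    change (LinearMap.ker (del r X Y)).subtype _ = _
    rw [map_sum]
    exact hl
  · let g' : LinearMap.ker (del r X Y) := ⟨g, (mem_ker_del r _).mpr hg⟩
    refine ⟨bs.repr g', ?_⟩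
    have := bs.sum_repr g'
    have := congrArg (LinearMap.ker (del r X Y)).subtype this
    rw [map_sum] at this
    exact this.symm

/-- Universal extension. -/
lemma univ_ext {I : Type} (P : I → QRep V) (hB : ∀ u, Brick r (P u))
    (hH : ∀ u u', u ≠ u' → Hom0 r (P u) (P u'))
    (X : QRep V) (hX : Brick r X) (h1 : ∀ u, Hom0 r X (P u)) (h2 : ∀ u, Hom0 r (P u) X)
    (S : Finset I) (hS : ∀ u, E r (dm X) (dm (P u)) ≠ 0 → u ∈ S) :
    ∃ X' : QRep V, dm X' = dm X - ∑ u ∈ S, E r (dm X) (dm (P u)) • dm (P u) ∧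
      Brick r X' ∧ (∀ u, Hom0 r X' (P u)) ∧
      (∀ Y, Hom0 r X Y → (∀ u, Hom0 r (P u) Y) → Hom0 r X' Y) ∧
      (∀ Y, Hom0 r Y X → (∀ u, Hom0 r Y (P u)) → Hom0 r Y X') ∧
      (∀ Y, Hom0 r X' Y → Hom0 r X Y) ∧
      (∀ u, E r (dm X) (dm (P u)) ≠ 0 → ∀ Y, Ext0 r X' Y → Ext0 r (P u) Y) := by
  classical
  choose ζ hζ using fun u => ext_basis r X (P u)
  let ι := Σ u : S, Fin (edim r X (P u))
  let Q : ι → QRep V := fun i => P i.1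
  let z : ∀ v w, X.M v →ₗ[ℚ] (sumRep Q).M w := fun v w => LinearMap.pi fun i : ι => ζ i.1 i.2 v w
  let X' := extRep (sumRep Q) X z
  let inc : C0 (sumRep Q) X' := fun v => LinearMap.inl ℚ ((sumRep Q).M v) (X.M v)
  let prj : C0 X' X := fun v => LinearMap.snd ℚ ((sumRep Q).M v) (X.M v)
  have ses : SES r inc prj := extRep_ses (sumRep Q) X z
  have u3 : ∀ u, Hom0 r X' (P u) := by
    intro u φ hφ
    have hρ := hφ.comp ses.hi
    have hz : comp0 φ inc = 0 := by
      refine sum_eq_zero Q fun i => ?_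
      obtain ⟨⟨u0, hu0⟩, a0⟩ := i
      by_cases hu : u0 = u
      swap
      · exact hH u0 u hu _ (hρ.comp (sinc_hom Q ⟨⟨u0, hu0⟩, a0⟩))
      subst hu
      have : ∀ a : Fin (edim r X (P u0)), ∃ l : ℚ, ∀ v x,
          φ v (inc v (sinc Q ⟨⟨u0, hu0⟩, a⟩ v x)) = l • x :=
        fun a => hB u0 _ (hρ.comp (sinc_hom Q ⟨⟨u0, hu0⟩, a⟩))
      choose l hl using this
      have hl0 := hζ u0 l ⟨fun v => φ v ∘ₗ LinearMap.inr ℚ _ _, ?_⟩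
      · refine C0.ext fun v x => ?_
        have := hl a0 v x
        rw [hl0, zero_smul] at this
        exact this
      · intro v w hr x
        have e1 := hφ v w hr ((0, x) : (sumRep Q).M v × X.M v)
        have e2 : X'.map v w ((0, x) : (sumRep Q).M v × X.M v) =
            inc w (z v w x) + (show X'.M w from ((0, X.map v w x) : (sumRep Q).M w × X.M w)) := by
          change (((sumRep Q).map v w 0 + z v w x, X.map v w x) : (sumRep Q).M w × X.M w) =
            (z v w x + 0, 0 + X.map v w x)
          simp
        rw [e2, map_add] at e1
        have e3 : φ w (inc w (z v w x)) = ∑ a, l a • ζ u0 a v w x := by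
          rw [← sum_sinc Q w (z v w x), map_sum, map_sum, Fintype.sum_sigma,
            Finset.sum_eq_single (⟨u0, hu0⟩ : S)]
          · refine Finset.sum_congr rfl fun a _ => ?_
            rw [hl]
            rfl
          · rintro ⟨u1, hu1⟩ _ hne
            refine Finset.sum_eq_zero fun a _ => ?_
            have hne' : u1 ≠ u0 := fun h => hne (Subtype.ext h)
            have := hH u1 u0 hne' _ (hρ.comp (sinc_hom Q ⟨⟨u1, hu1⟩, a⟩))
            exact LinearMap.congr_fun (congrFun this w) _
          · intro h
            exact absurd (Finset.mem_univ _) h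
        rw [← e3]
        exact (sub_eq_of_eq_add e1).symm
    obtain ⟨f', hf', hh⟩ := desc ses.hq ses.surj hφ (by
      intro v x hx
      obtain ⟨a, rfl⟩ := (ses.exact v x).mp hx
      exact LinearMap.congr_fun (congrFun hz v) a)
    refine C0.ext fun v x => ?_
    rw [← hh, h1 u _ hf']
    rfl
  refine ⟨X', ?_, ?_, u3, ?_, ?_, ?_, ?_⟩
  · rw [ses.dm_eq, dm_sumRep, Fintype.sum_sigma, add_comm, sub_eq_add_neg, ← Finset.sum_neg_distrib]
    congr 1
    rw [← Finset.sum_coe_sort S]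
    refine Finset.sum_congr rfl fun u _ => ?_
    rw [← neg_smul, ← edim_of (h1 u)]
    simp [Q]
  · intro φ hφ
    have hR : Hom0 r (sumRep Q) X := hom0_sum_left Q fun i => h2 _
    have hR' : Hom0 r X' (sumRep Q) := hom0_sum_right Q fun i => u3 _
    have hqφ := ses.hq.comp hφ
    have h3 := hR _ (hqφ.comp ses.hi)
    obtain ⟨f', hf', hh⟩ := desc ses.hq ses.surj hqφ (by
      intro v x hx
      obtain ⟨a, rfl⟩ := (ses.exact v x).mp hx
      exact LinearMap.congr_fun (congrFun h3 v) a)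
    obtain ⟨c, hc⟩ := hX f' hf'
    refine ⟨c, ?_⟩
    have hψ := hφ.sub ((isHom_id X').smul c)
    obtain ⟨g, hg, hgg⟩ := lift ses.hi ses.inj hψ (by
      intro v y
      apply (ses.exact v _).mp
      have := hh v y
      rw [hc] at this
      simp only [comp0_apply] at this
      simp [this])
    intro v x
    have := hgg v x
    rw [hR' g hg] at this
    simp only [Pi.zero_apply, LinearMap.zero_apply, map_zero, Pi.sub_apply, LinearMap.sub_apply,
      Pi.smul_apply, LinearMap.smul_apply, LinearMap.id_apply] at this
    exact sub_eq_zero.mp this.symm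
  · intro Y hY hP
    exact ses.hom0_left (hom0_sum_left Q fun i => hP _) hY
  · intro Y hY hP
    exact ses.hom0_right (hom0_sum_right Q fun i => hP _) hY
  · intro Y hY
    exact hY.of_surj ses.hq ses.surj
  · intro u hu Y hY
    have hpos : 0 < edim r X (P u) := by
      have := edim_of (h1 u)
      omega
    let i0 : ι := ⟨⟨u, hS u hu⟩, ⟨0, hpos⟩⟩
    have hs : ∀ v, Function.Injective (comp0 inc (sinc Q i0) v) := fun v =>
      (ses.inj v).comp (sinc_inj Q i0 v)
    exact hY.of_inj (ses.hi.comp (sinc_hom Q i0)) hs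

/-- Universal map to a family. -/
lemma univ_map {I : Type} (P : I → QRep V) (hB : ∀ u, Brick r (P u))
    (hH : ∀ u u', u ≠ u' → Hom0 r (P u) (P u')) (hE : ∀ u u', Ext0 r (P u) (P u'))
    (N : QRep V) (hN : Brick r N) (h1 : ∀ u, Ext0 r (P u) N)
    (S : Finset I) (hS : ∀ u, ¬ Hom0 r N (P u) → u ∈ S) (D : V →₀ ℤ)
    (hD : D = ∑ u ∈ S, (hdim r N (P u) : ℤ) • dm (P u)) :
    (D ≤ dm N → ∃ K : QRep V, dm K = dm N - D ∧ Brick r K ∧ (∀ u, Hom0 r K (P u)) ∧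
      (∀ Y, Hom0 r Y N → Hom0 r Y K) ∧
      (∀ Y, (∀ u, Ext0 r (P u) Y) → Hom0 r N Y → Hom0 r K Y)) ∧
    (¬ D ≤ dm N → ∃ C : QRep V, dm C = D - dm N ∧ Brick r C ∧ (∀ u, Hom0 r C (P u)) ∧
      (∀ Y, (∀ u, Hom0 r (P u) Y) → Hom0 r C Y) ∧
      (∀ Y, Ext0 r Y N → (∀ u, Hom0 r Y (P u)) → Hom0 r Y C) ∧
      (∀ Y, (∀ u, Ext0 r (P u) Y) → Hom0 r N Y → Ext0 r C Y) ∧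
      (∀ Y, (∀ u, Ext0 r (P u) Y) → Ext0 r N Y)) := by
  classical
  choose β hβ hli hsp using fun u => hom_basis r N (P u)
  let ι := Σ u : S, Fin (hdim r N (P u))
  let Q : ι → QRep V := fun i => P i.1
  let f : C0 N (sumRep Q) := fun v => LinearMap.pi fun i : ι => β i.1 i.2 v
  have hf : IsHom r N (sumRep Q) f := by
    intro v w hr x
    funext i
    exact hβ i.1 i.2 v w hr x
  -- uniqueness
  have huniq : ∀ u (g : C0 (sumRep Q) (P u)), IsHom r _ _ g → comp0 g f = 0 → g = 0 := by
    intro u g hg hgf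
    refine sum_eq_zero Q fun i => ?_
    obtain ⟨⟨u0, hu0⟩, a0⟩ := i
    by_cases hu : u0 = u
    swap
    · exact hH u0 u hu _ (hg.comp (sinc_hom Q ⟨⟨u0, hu0⟩, a0⟩))
    subst hu
    have : ∀ a : Fin (hdim r N (P u0)), ∃ l : ℚ, ∀ v x,
        g v (sinc Q ⟨⟨u0, hu0⟩, a⟩ v x) = l • x :=
      fun a => hB u0 _ (hg.comp (sinc_hom Q ⟨⟨u0, hu0⟩, a⟩))
    choose l hl using this
    have hl0 := hli u0 l ?_
    · refine C0.ext fun v x => ?_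
      have := hl a0 v x
      rw [hl0, zero_smul] at this
      exact this
    · refine C0.ext fun v x => ?_
      have e0 : g v (f v x) = 0 := LinearMap.congr_fun (congrFun hgf v) x
      rw [← sum_sinc Q v (f v x), map_sum, Fintype.sum_sigma,
            Finset.sum_eq_single (⟨u0, hu0⟩ : S)] at e0
      · rw [Finset.sum_apply, LinearMap.sum_apply]
        refine Eq.trans ?_ e0
        refine Finset.sum_congr rfl fun a _ => ?_
        rw [hl]
        rfl
      · rintro ⟨u1, hu1⟩ _ hne
        refine Finset.sum_eq_zero fun a _ => ?_
        have hne' : u1 ≠ u0 := fun h => hne (Subtype.ext h)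
        have := hH u1 u0 hne' _ (hg.comp (sinc_hom Q ⟨⟨u1, hu1⟩, a⟩))
        exact LinearMap.congr_fun (congrFun this v) _
      · intro h
        exact absurd (Finset.mem_univ _) h
  have huniq' : ∀ g : C0 (sumRep Q) (sumRep Q), IsHom r _ _ g → comp0 g f = 0 → g = 0 := by
    intro g hg hgf
    refine C0.ext fun v y => ?_
    funext i
    have := huniq _ (comp0 (sproj Q i) g) ((sproj_hom Q i).comp hg) (by
      refine C0.ext fun v x => ?_
      have : g v (f v x) = 0 := LinearMap.congr_fun (congrFun hgf v) x
      simp only [comp0_apply]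
      rw [this]
      simp)
    exact LinearMap.congr_fun (congrFun this v) y
  -- existence
  have hext : ∀ u (g : C0 N (P u)), IsHom r _ _ g → ∃ g' : C0 (sumRep Q) (P u), IsHom r _ _ g' ∧
      comp0 g' f = g := by
    intro u g hg
    by_cases hu : u ∈ S
    · obtain ⟨l, hl⟩ := hsp u g hg
      refine ⟨∑ a, l a • (sproj Q ⟨⟨u, hu⟩, a⟩), ?_, ?_⟩
      · rw [← mem_ker_del]
        refine Submodule.sum_mem _ fun a _ => Submodule.smul_mem _ _ ?_
        rw [mem_ker_del]
        exact sproj_hom Q ⟨⟨u, hu⟩, a⟩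
      · rw [hl]
        refine C0.ext fun v x => ?_
        simp only [comp0_apply]
        rw [sum_C0_apply (X := N)]
        exact sum_C0_apply (X := sumRep Q) (Y := P u) Finset.univ
          (fun a => l a • sproj Q ⟨⟨u, hu⟩, a⟩) v (f v x)
    · refine ⟨0, ?_, ?_⟩
      · intro v w hr x
        simp
      · have : Hom0 r N (P u) := by
          by_contra h
          exact hu (hS u h)
        rw [this g hg]
        rfl
  have hdR : dm (sumRep Q) = D := by
    rw [hD, dm_sumRep, Fintype.sum_sigma, ← Finset.sum_coe_sort S]
    refine Finset.sum_congr rfl fun u _ => ?_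
    simp [Q]
  have hRY : ∀ Y, (∀ u, Ext0 r (P u) Y) → Ext0 r (sumRep Q) Y := fun Y h =>
    ext0_sum_left Q fun i => h _
  have hRN := hRY N h1
  have hdich : (D ≤ dm N → ∀ v, Function.Surjective (f v)) ∧
      (¬ D ≤ dm N → ∀ v, Function.Injective (f v)) := by
    rw [← hdR]
    by_cases hi : ∀ v, Function.Injective (f v)
    · exact ⟨fun h => surj_of_inj hi h, fun _ => hi⟩
    · obtain ⟨e, he, he1, he2⟩ := hr_core hN hRN hf hi
      have hz := huniq' _ (he.sub (isHom_id _)) (by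
        refine C0.ext fun v x => ?_
        simp [he1])
      have hs : ∀ v, Function.Surjective (f v) := by
        intro v y
        obtain ⟨x, hx⟩ := he2 v y
        refine ⟨x, ?_⟩
        rw [← hx]
        have := LinearMap.congr_fun (congrFun hz v) y
        simp only [Pi.sub_apply, LinearMap.sub_apply, LinearMap.id_apply] at this
        exact sub_eq_zero.mp this
      exact ⟨fun _ => hs, fun h => absurd (le_of_surj hs) h⟩
  constructor
  · intro hDN
    obtain ⟨K, i, ses⟩ := exists_ker hf (hdich.1 hDN)
    have hfi : ∀ v x, f v (i v x) = 0 := fun v x => (ses.exact v _).mpr ⟨x, rfl⟩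
    refine ⟨K, ?_, ?_, ?_, ?_, ?_⟩
    · rw [ses.dm_eq, hdR]; abel
    · intro φ hφ
      obtain ⟨g, hg, hgg⟩ := ses.extend_ext hRN (ses.hi.comp hφ)
      obtain ⟨c, hc⟩ := hN g hg
      refine ⟨c, fun v x => ses.inj v ?_⟩
      have := hgg v x
      rw [hc] at this
      rw [map_smul, this]
      rfl
    · intro u φ hφ
      obtain ⟨g, hg, hgg⟩ := ses.extend_ext (hRY _ (fun u' => hE u' u)) hφ
      obtain ⟨g', hg', rfl⟩ := hext u g hg
      refine C0.ext fun v x => ?_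
      rw [← hgg]
      simp [hfi]
    · intro Y hY
      exact hY.of_inj ses.hi ses.inj
    · intro Y hPY hNY φ hφ
      obtain ⟨g, hg, hgg⟩ := ses.extend_ext (hRY _ hPY) hφ
      refine C0.ext fun v x => ?_
      rw [← hgg, hNY g hg]
      rfl
  · intro hDN
    obtain ⟨C, q, ses⟩ := exists_coker hf (hdich.2 hDN)
    have hqf : ∀ v x, q v (f v x) = 0 := fun v x => (ses.exact v _).mpr ⟨x, rfl⟩
    refine ⟨C, ?_, ?_, ?_, ?_, ?_, ?_, ?_⟩
    · rw [← hdR, ses.dm_eq]; abel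
    · intro φ hφ
      obtain ⟨ψ, hψ, hψq⟩ := ses.lift_ext hRN (hφ.comp ses.hq)
      obtain ⟨φ', hφ', hh⟩ := lift ses.hi ses.inj (hψ.comp hf) (by
        intro v y
        apply (ses.exact v _).mp
        rw [comp0_apply, hψq, comp0_apply, hqf, map_zero])
      obtain ⟨c, hc⟩ := hN φ' hφ'
      have hz := huniq' _ (hψ.sub ((isHom_id _).smul c)) (by
        refine C0.ext fun v x => ?_
        have := hh v x
        rw [hc, map_smul] at this
        simp only [comp0_apply] at this
        simp [← this])
      refine ⟨c, fun v y => ?_⟩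
      obtain ⟨x, rfl⟩ := ses.surj v y
      have h3 := hψq v x
      simp only [comp0_apply] at h3
      rw [← h3, ← map_smul]
      congr 1
      have := LinearMap.congr_fun (congrFun hz v) x
      simp only [Pi.sub_apply, LinearMap.sub_apply, LinearMap.id_apply, Pi.smul_apply,
        LinearMap.smul_apply] at this
      exact sub_eq_zero.mp this
    · intro u φ hφ
      have := huniq u _ (hφ.comp ses.hq) (by
        refine C0.ext fun v x => ?_
        simp [hqf])
      refine C0.ext fun v y => ?_
      obtain ⟨x, rfl⟩ := ses.surj v y
      exact LinearMap.congr_fun (congrFun this v) x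
    · intro Y hY
      exact (hom0_sum_left Q fun i => hY _).of_surj ses.hq ses.surj
    · intro Y hYN hY φ hφ
      obtain ⟨g, hg, hgg⟩ := ses.lift_ext hYN hφ
      refine C0.ext fun v y => ?_
      rw [← hgg, hom0_sum_right Q (fun i => hY _) g hg]
      simp
    · intro Y hY hNY
      exact ses.ext0_coker (hRY Y hY) hNY
    · intro Y hY
      exact (hRY Y hY).of_inj ses.hi ses.inj

end Unf

open Module

namespace Unf
variable {V : Type}

/-- Linear combinations with finitely supported coefficients. -/
noncomputable def cmb (d : V → V →₀ ℤ) (c : V → ℤ) : V →₀ ℤ := ∑ᶠ u, c u • d u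

lemma cmb_eq_sum (d : V → V →₀ ℤ) (c : V → ℤ) (S : Finset V) (h : ∀ u, c u ≠ 0 → u ∈ S) :
    cmb d c = ∑ u ∈ S, c u • d u := by
  unfold cmb
  refine finsum_eq_sum_of_support_subset _ fun u hu => ?_
  refine h u fun h0 => hu ?_
  simp [h0]

lemma cmb_zero (d : V → V →₀ ℤ) (c : V → ℤ) (h : ∀ u, c u = 0) : cmb d c = 0 := by
  rw [cmb_eq_sum d c ∅ (fun u hu => absurd (h u) hu)]
  simp

lemma map_cmb {M : Type} [AddCommGroup M] (φ : (V →₀ ℤ) →ₗ[ℤ] M)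
    (d : V → V →₀ ℤ) (c : V → ℤ) (S : Finset V) (h : ∀ u, c u ≠ 0 → u ∈ S) :
    φ (cmb d c) = ∑ u ∈ S, c u • φ (d u) := by
  rw [cmb_eq_sum d c S h, map_sum]
  simp

lemma map_cmb_zero {M : Type} [AddCommGroup M] (φ : (V →₀ ℤ) →ₗ[ℤ] M)
    (d : V → V →₀ ℤ) (c : V → ℤ) (hc : {u | c u ≠ 0}.Finite) (h : ∀ u, c u ≠ 0 → φ (d u) = 0) :
    φ (cmb d c) = 0 := by
  rw [map_cmb φ d c hc.toFinset (by simp)]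
  refine Finset.sum_eq_zero fun u hu => ?_
  rw [h u (by simpa using hu), smul_zero]

lemma map_cmb_single (φ : (V →₀ ℤ) →ₗ[ℤ] ℤ)
    (d : V → V →₀ ℤ) (c : V → ℤ) (hc : {u | c u ≠ 0}.Finite) (u0 : V) (h0 : φ (d u0) = 1)
    (h : ∀ u, c u ≠ 0 → u ≠ u0 → φ (d u) = 0) :
    φ (cmb d c) = c u0 := by
  classical
  rw [map_cmb φ d c (insert u0 hc.toFinset) (by intro u hu; simp [hu])]
  rw [Finset.sum_eq_single u0]
  · simp [h0]
  · intro u hu hne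
    rw [Finset.mem_insert] at hu
    rw [h u (by simpa using hu.resolve_left hne) hne, smul_zero]
  · intro h
    exact absurd (Finset.mem_insert_self _ _) h

lemma cmb_apply_ne (d : V → V →₀ ℤ) (c : V → ℤ) (hc : {u | c u ≠ 0}.Finite) (x : V)
    (h : cmb d c x ≠ 0) : ∃ u, c u ≠ 0 ∧ d u x ≠ 0 := by
  by_contra hcon
  push Not at hcon
  exact h (map_cmb_zero (Finsupp.lapply x) d c hc hcon)

variable {Γ : Type} [Group Γ] [MulAction Γ V]

/-- Translation of dimension vectors. -/
noncomputable def tr (g : Γ) : (V →₀ ℤ) →ₗ[ℤ] (V →₀ ℤ) := Finsupp.lmapDomain ℤ ℤ (fun v => g • v)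

lemma tr_apply (g : Γ) (x : V →₀ ℤ) (v : V) : tr g x (g • v) = x v :=
  Finsupp.mapDomain_apply (MulAction.injective g) x v

lemma tr_apply' (g : Γ) (x : V →₀ ℤ) (v : V) : tr g x v = x (g⁻¹ • v) := by
  conv_lhs => rw [← smul_inv_smul g v]
  rw [tr_apply]

lemma tr_le (g : Γ) (x y : V →₀ ℤ) : tr g x ≤ tr g y ↔ x ≤ y := by
  constructor
  · intro h v
    have := h (g • v)
    rwa [tr_apply, tr_apply] at this
  · intro h v
    rw [tr_apply', tr_apply']
    exact h _

lemma tr_cmb (g : Γ) (d : V → V →₀ ℤ) (c c' : V → ℤ) (hc : {u | c u ≠ 0}.Finite)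
    (hcc : ∀ u, c' (g • u) = c u) (hd : ∀ u, c u ≠ 0 → tr g (d u) = d (g • u)) :
    tr g (cmb d c) = cmb d c' := by
  rw [map_cmb (tr g) d c hc.toFinset (by simp)]
  unfold cmb
  rw [← finsum_comp_equiv (MulAction.toPerm g)]
  rw [finsum_eq_sum_of_support_subset (s := hc.toFinset)]
  · refine Finset.sum_congr rfl fun u hu => ?_
    rw [hd u (by simpa using hu)]
    simp [hcc]
  · intro u hu
    simp only [MulAction.toPerm_apply, hcc] at hu
    simp only [Set.Finite.coe_toFinset, Set.mem_ofPred_eq]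
    intro h0
    exact hu (by simp [h0])

variable {r : V → V → Prop}

open Classical in
lemma E_single (r : V → V → Prop) (v w : V) : E r (Finsupp.single v 1) (Finsupp.single w 1) =
    (if v = w then 1 else 0) - (if r v w then 1 else 0 : ℤ) := by
  simp [E]

open Classical in
lemma E_sum (r : V → V → Prop) (x y : V →₀ ℤ) : E r x y = ∑ v ∈ x.support, ∑ w ∈ y.support,
      (x v * y w * ((if v = w then 1 else 0) - (if r v w then 1 else 0 : ℤ))) := by
  unfold E
  rw [Finsupp.linearCombination_apply, Finsupp.sum]
  rw [LinearMap.sum_apply]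
  refine Finset.sum_congr rfl fun v _ => ?_
  rw [LinearMap.smul_apply, Finsupp.linearCombination_apply, Finsupp.sum, Finset.smul_sum]
  refine Finset.sum_congr rfl fun w _ => ?_
  simp only [smul_eq_mul]
  ring

lemma E_ne (r : V → V → Prop) (x y : V →₀ ℤ) (h : E r x y ≠ 0) :
    ∃ a b, x a ≠ 0 ∧ y b ≠ 0 ∧ (a = b ∨ r a b) := by
  classical
  rw [E_sum] at h
  obtain ⟨a, ha, h⟩ := Finset.exists_ne_zero_of_sum_ne_zero h
  obtain ⟨b, hb, h⟩ := Finset.exists_ne_zero_of_sum_ne_zero h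
  refine ⟨a, b, by simpa using ha, by simpa using hb, ?_⟩
  by_contra hcon
  push Not at hcon
  simp [hcon.1, hcon.2] at h

/-- Standing assumptions on the quiver, the group and the labelling. -/
structure Ctx {n : ℕ} (Γ : Type) [Group Γ] [MulAction Γ V] (r : V → V → Prop) (p : V → Fin n) :
    Prop where
  rinv : ∀ (g : Γ) v w, r (g • v) (g • w) ↔ r v w
  fib : ∀ v w, p v = p w ↔ ∃ g : Γ, g • v = w
  fout : ∀ v, {w | r v w}.Finite
  fin : ∀ w, {v | r v w}.Finite

lemma E_tr (hr : ∀ (g : Γ) v w, r (g • v) (g • w) ↔ r v w) (g : Γ) (x y : V →₀ ℤ) :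
    E r (tr g x) (tr g y) = E r x y := by
  classical
  have : (E r).compl₁₂ (tr g) (tr g) = E r := by
    refine Finsupp.lhom_ext' fun v => LinearMap.ext_ring ?_
    refine Finsupp.lhom_ext' fun w => LinearMap.ext_ring ?_
    simp [LinearMap.compl₁₂_apply, tr, Finsupp.lmapDomain_apply, Finsupp.mapDomain_single,
      E_single, hr]
  have h2 := LinearMap.congr_fun (LinearMap.congr_fun this x) y
  exact h2

section ctx
variable {n : ℕ} {p : V → Fin n}

lemma Ctx.p_smul (c : Ctx Γ r p) (g : Γ) (v : V) : p (g • v) = p v :=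
  ((c.fib v (g • v)).mpr ⟨g, rfl⟩).symm

lemma Ctx.fin_left (c : Ctx Γ r p) (d : V → V →₀ ℤ) (Q : V → Prop)
    (lf : ∀ x, {v | Q v ∧ d v x ≠ 0}.Finite) (y : V →₀ ℤ) :
    {v | Q v ∧ E r (d v) y ≠ 0}.Finite := by
  refine (Set.Finite.biUnion (y.support.finite_toSet) (t := fun b =>
    ⋃ a ∈ ({b} ∪ {a | r a b} : Set V), {v | Q v ∧ d v a ≠ 0}) ?_).subset ?_
  · intro b _
    refine Set.Finite.biUnion ((Set.finite_singleton b).union (c.fin b)) fun a _ => lf a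
  · rintro v ⟨hQ, hv⟩
    obtain ⟨a, b, ha, hb, hab⟩ := E_ne r _ _ hv
    simp only [Set.mem_iUnion]
    refine ⟨b, by simpa using hb, a, ?_, hQ, ha⟩
    rcases hab with h | h
    · exact Or.inl h
    · exact Or.inr h

lemma Ctx.fin_right (c : Ctx Γ r p) (d : V → V →₀ ℤ) (Q : V → Prop)
    (lf : ∀ x, {v | Q v ∧ d v x ≠ 0}.Finite) (y : V →₀ ℤ) :
    {v | Q v ∧ E r y (d v) ≠ 0}.Finite := by
  refine (Set.Finite.biUnion (y.support.finite_toSet) (t := fun b =>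
    ⋃ a ∈ ({b} ∪ {a | r b a} : Set V), {v | Q v ∧ d v a ≠ 0}) ?_).subset ?_
  · intro b _
    refine Set.Finite.biUnion ((Set.finite_singleton b).union (c.fout b)) fun a _ => lf a
  · rintro v ⟨hQ, hv⟩
    obtain ⟨b, a, hb, ha, hab⟩ := E_ne r _ _ hv
    simp only [Set.mem_iUnion]
    refine ⟨b, by simpa using hb, a, ?_, hQ, ha⟩
    rcases hab with h | h
    · exact Or.inl h.symm
    · exact Or.inr h

/-- Local finiteness is preserved by adding combinations. -/
lemma lf_cmb (d : V → V →₀ ℤ) (c : V → V → ℤ) (Q : V → Prop)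
    (hc : ∀ v, Q v → {u | c v u ≠ 0}.Finite) (hc' : ∀ u, {v | Q v ∧ c v u ≠ 0}.Finite)
    (lfd : ∀ x, {u | (∃ v, Q v ∧ c v u ≠ 0) ∧ d u x ≠ 0}.Finite) (x : V) :
    {v | Q v ∧ cmb d (c v) x ≠ 0}.Finite := by
  refine (Set.Finite.biUnion (lfd x) (t := fun u => {v | Q v ∧ c v u ≠ 0}) fun u _ => hc' u).subset ?_
  rintro v ⟨hQ, hv⟩
  obtain ⟨u, hu, hux⟩ := cmb_apply_ne _ _ (hc v hQ) x hv
  simp only [Set.mem_iUnion]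
  exact ⟨u, ⟨⟨v, hQ, hu⟩, hux⟩, hQ, hu⟩

/-- Happel--Ringel for equivariant families. -/
lemma hr_fam (c : Ctx Γ r p) (M P : V → QRep V) (j k : Fin n)
    (hM : ∀ v, p v = j → Brick r (M v)) (hP : ∀ u, p u = k → Brick r (P u))
    (hMM : ∀ v v', p v = j → p v' = j → Ext0 r (M v) (M v'))
    (hPP : ∀ u u', p u = k → p u' = k → Ext0 r (P u) (P u'))
    (hPM : ∀ u v, p u = k → p v = j → Ext0 r (P u) (M v))
    (eM : ∀ (g : Γ) v, p v = j → tr g (dm (M v)) = dm (M (g • v)))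
    (eP : ∀ (g : Γ) u, p u = k → tr g (dm (P u)) = dm (P (g • u)))
    (v0 u0 : V) (hv0 : p v0 = j) (hu0 : p u0 = k) (hne : ¬ Hom0 r (M v0) (P u0)) :
    ∀ v u, p v = j → p u = k → Ext0 r (M v) (P u) := by
  have key1 : ∀ v u, p v = j → p u = k → ¬ Hom0 r (M v) (P u) → dm (P u) ≤ dm (M v) →
      ∀ v', p v' = j → Ext0 r (M v') (P u) := by
    intro v u hv hu hn hle v' hv'
    unfold Hom0 at hn
    push Not at hn
    obtain ⟨f, hf, hf0⟩ := hn
    have := (hr_single (hM v hv) (hP u hu) (hPM u v hu hv) hf hf0).1 hle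
    exact (hMM v' v hv' hv).of_surj hf this
  have key2 : ∀ v u, p v = j → p u = k → ¬ Hom0 r (M v) (P u) → ¬ dm (P u) ≤ dm (M v) →
      ∀ u', p u' = k → Ext0 r (M v) (P u') := by
    intro v u hv hu hn hle u' hu'
    unfold Hom0 at hn
    push Not at hn
    obtain ⟨f, hf, hf0⟩ := hn
    have := (hr_single (hM v hv) (hP u hu) (hPM u v hu hv) hf hf0).2 hle
    exact (hPP u u' hu hu').of_inj hf this
  have h0 : Ext0 r (M v0) (P u0) := by
    by_cases hle : dm (P u0) ≤ dm (M v0)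
    · exact key1 v0 u0 hv0 hu0 hne hle v0 hv0
    · exact key2 v0 u0 hv0 hu0 hne hle u0 hu0
  have hpos := E_pos_of hne h0
  have hg : ∀ g : Γ, ¬ Hom0 r (M (g • v0)) (P (g • u0)) := by
    intro g hh
    have := E_nonpos_of hh
    rw [← eM g v0 hv0, ← eP g u0 hu0, E_tr c.rinv] at this
    omega
  have hle : ∀ g : Γ, dm (P (g • u0)) ≤ dm (M (g • v0)) ↔ dm (P u0) ≤ dm (M v0) := by
    intro g
    rw [← eM g v0 hv0, ← eP g u0 hu0, tr_le]
  intro v u hv hu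
  by_cases h : dm (P u0) ≤ dm (M v0)
  · obtain ⟨g, rfl⟩ := (c.fib u0 u).mp (hu0.trans hu.symm)
    exact key1 _ _ ((c.p_smul g v0).trans hv0) hu (hg g) ((hle g).mpr h) v hv
  · obtain ⟨g, rfl⟩ := (c.fib v0 v).mp (hv0.trans hv.symm)
    exact key2 _ _ hv ((c.p_smul g u0).trans hu0) (hg g) (fun h' => h ((hle g).mp h')) u hu
end ctx

open Classical in
lemma univ_extV (P : V → QRep V) (K : V → Prop) (hB : ∀ u, K u → Brick r (P u))
    (hH : ∀ u u', K u → K u' → u ≠ u' → Hom0 r (P u) (P u'))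
    (X : QRep V) (hX : Brick r X) (h1 : ∀ u, K u → Hom0 r X (P u)) (h2 : ∀ u, K u → Hom0 r (P u) X)
    (hfin : {u | K u ∧ E r (dm X) (dm (P u)) ≠ 0}.Finite) :
    ∃ X' : QRep V, dm X' = dm X + cmb (fun u => dm (P u))
        (fun u => if K u then - E r (dm X) (dm (P u)) else 0) ∧
      Brick r X' ∧ (∀ u, K u → Hom0 r X' (P u)) ∧
      (∀ Y, Hom0 r X Y → (∀ u, K u → Hom0 r (P u) Y) → Hom0 r X' Y) ∧
      (∀ Y, Hom0 r Y X → (∀ u, K u → Hom0 r Y (P u)) → Hom0 r Y X') ∧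
      (∀ Y, Hom0 r X' Y → Hom0 r X Y) ∧
      (∀ u, K u → E r (dm X) (dm (P u)) ≠ 0 → ∀ Y, Ext0 r X' Y → Ext0 r (P u) Y) := by
  obtain ⟨X', hd, hb, a1, a2, a3, a4, a5⟩ := univ_ext (r := r) (I := {u // K u}) (fun u => P u.1)
    (fun u => hB u.1 u.2)
    (fun u u' h => hH u.1 u'.1 u.2 u'.2 (fun h' => h (Subtype.ext h'))) X hX
    (fun u => h1 u.1 u.2) (fun u => h2 u.1 u.2) (hfin.toFinset.subtype K) (by
      intro u hu
      simp only [Finset.mem_subtype, Set.Finite.mem_toFinset, Set.mem_ofPred_eq]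
      exact ⟨u.2, hu⟩)
  refine ⟨X', ?_, hb, fun u hu => a1 ⟨u, hu⟩, fun Y hY h => a2 Y hY fun u => h u.1 u.2,
    fun Y hY h => a3 Y hY fun u => h u.1 u.2, a4, fun u hu => a5 ⟨u, hu⟩⟩
  rw [hd, sub_eq_add_neg, ← Finset.sum_neg_distrib]
  congr 1
  rw [cmb_eq_sum _ _ (hfin.toFinset.filter K)]
  · rw [Finset.sum_subtype_eq_sum_filter (s := hfin.toFinset)
      (f := fun u => - (E r (dm X) (dm (P u)) • dm (P u)))]
    refine Finset.sum_congr rfl fun u hu => ?_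
    rw [if_pos (Finset.mem_filter.mp hu).2, neg_smul]
  · intro u hu
    have hK : K u := by
      by_contra h
      simp [h] at hu
    simp only [if_pos hK] at hu
    simp only [Finset.mem_filter, Set.Finite.mem_toFinset, Set.mem_ofPred_eq]
    exact ⟨⟨hK, by simpa using hu⟩, hK⟩

open Classical in
lemma univ_mapV (P : V → QRep V) (K : V → Prop) (hB : ∀ u, K u → Brick r (P u))
    (hH : ∀ u u', K u → K u' → u ≠ u' → Hom0 r (P u) (P u'))
    (hE : ∀ u u', K u → K u' → Ext0 r (P u) (P u'))
    (N : QRep V) (hN : Brick r N) (h1 : ∀ u, K u → Ext0 r (P u) N)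
    (hfin : {u | K u ∧ E r (dm N) (dm (P u)) ≠ 0}.Finite)
    (hdich : ∀ u, K u → (hdim r N (P u) : ℤ) = max 0 (E r (dm N) (dm (P u))))
    (D : V →₀ ℤ)
    (hD : D = cmb (fun u => dm (P u)) (fun u => if K u then max 0 (E r (dm N) (dm (P u))) else 0)) :
    (D ≤ dm N → ∃ K' : QRep V, dm K' = dm N - D ∧ Brick r K' ∧ (∀ u, K u → Hom0 r K' (P u)) ∧
      (∀ Y, Hom0 r Y N → Hom0 r Y K') ∧
      (∀ Y, (∀ u, K u → Ext0 r (P u) Y) → Hom0 r N Y → Hom0 r K' Y)) ∧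
    (¬ D ≤ dm N → ∃ C : QRep V, dm C = D - dm N ∧ Brick r C ∧ (∀ u, K u → Hom0 r C (P u)) ∧
      (∀ Y, (∀ u, K u → Hom0 r (P u) Y) → Hom0 r C Y) ∧
      (∀ Y, Ext0 r Y N → (∀ u, K u → Hom0 r Y (P u)) → Hom0 r Y C) ∧
      (∀ Y, (∀ u, K u → Ext0 r (P u) Y) → Hom0 r N Y → Ext0 r C Y) ∧
      (∀ Y, (∀ u, K u → Ext0 r (P u) Y) → Ext0 r N Y)) := by
  obtain ⟨ha, hb⟩ := univ_map (r := r) (I := {u // K u}) (fun u => P u.1)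
    (fun u => hB u.1 u.2)
    (fun u u' h => hH u.1 u'.1 u.2 u'.2 (fun h' => h (Subtype.ext h')))
    (fun u u' => hE u.1 u'.1 u.2 u'.2) N hN (fun u => h1 u.1 u.2) (hfin.toFinset.subtype K) (by
      intro u hu
      simp only [Finset.mem_subtype, Set.Finite.mem_toFinset, Set.mem_ofPred_eq]
      refine ⟨u.2, fun h0 => hu ?_⟩
      rw [← hdim_eq_zero]
      have := hdich u.1 u.2
      rw [h0] at this
      simpa using this) D (by
      rw [hD, cmb_eq_sum _ _ (hfin.toFinset.filter K)]
      · rw [Finset.sum_subtype_eq_sum_filter (s := hfin.toFinset)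
          (f := fun u => ((hdim r N (P u) : ℤ) • dm (P u)))]
        refine Finset.sum_congr rfl fun u hu => ?_
        have hK := (Finset.mem_filter.mp hu).2
        rw [if_pos hK, hdich u hK]
      · intro u hu
        have hK : K u := by
          by_contra h
          simp [h] at hu
        simp only [if_pos hK] at hu
        simp only [Finset.mem_filter, Set.Finite.mem_toFinset, Set.mem_ofPred_eq]
        refine ⟨⟨hK, fun h0 => hu (by simp [h0])⟩, hK⟩)
  constructor
  · intro h
    obtain ⟨K', a1, a2, a3, a4, a5⟩ := ha h
    exact ⟨K', a1, a2, fun u hu => a3 ⟨u, hu⟩, a4, fun Y hY => a5 Y fun u => hY u.1 u.2⟩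
  · intro h
    obtain ⟨C, a1, a2, a3, a4, a5, a6, a7⟩ := hb h
    exact ⟨C, a1, a2, fun u hu => a3 ⟨u, hu⟩, fun Y hY => a4 Y fun u => hY u.1 u.2,
      fun Y hY hY' => a5 Y hY fun u => hY' u.1 u.2,
      fun Y hY => a6 Y fun u => hY u.1 u.2, fun Y hY => a7 Y fun u => hY u.1 u.2⟩

end Unf

open Module

namespace Unf
variable {V : Type} {Γ : Type} [Group Γ] [MulAction Γ V] {r : V → V → Prop}
variable {n : ℕ} {p : V → Fin n}

/-- Categorified c-vector data of a seed. -/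
structure Seed (Γ : Type) [Group Γ] [MulAction Γ V] (r : V → V → Prop) (p : V → Fin n) where
  X : V → QRep V
  s : Fin n → Bool
  pos : Fin n → ℤ
  brick : ∀ v, Brick r (X v)
  hom_same : ∀ v w, v ≠ w → s (p v) = s (p w) → Hom0 r (X v) (X w)
  hom_pn : ∀ v w, s (p v) = true → s (p w) = false → Hom0 r (X v) (X w)
  E_pn : ∀ v w, s (p v) = true → s (p w) = false → E r (dm (X v)) (dm (X w)) = 0
  E_self : ∀ v, E r (dm (X v)) (dm (X v)) = 1
  E_same : ∀ v w, v ≠ w → s (p v) = s (p w) → pos (p v) ≤ pos (p w) →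
    E r (dm (X v)) (dm (X w)) = 0
  eqv : ∀ (g : Γ) v, tr g (dm (X v)) = dm (X (g • v))
  lf : ∀ x, {v | dm (X v) x ≠ 0}.Finite

namespace Seed
variable (S : Seed Γ r p)

noncomputable def d (v : V) : V →₀ ℤ := dm (S.X v)

noncomputable def β (v : V) : V →₀ ℤ := if S.s (p v) = true then S.d v else - S.d v

noncomputable def b (v w : V) : ℤ := E r (S.β w) (S.β v) - E r (S.β v) (S.β w)

lemma ext_label {v w : V} (h : p v = p w) : Ext0 r (S.X v) (S.X w) := by
  by_cases hvw : v = w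
  · subst hvw
    exact ext0_self (S.brick v) (S.E_self v)
  · exact ext0_of (S.hom_same v w hvw (by rw [h])) (S.E_same v w hvw (by rw [h]) (by rw [h]))

lemma ext_pn {v w : V} (h : S.s (p v) = true) (h' : S.s (p w) = false) :
    Ext0 r (S.X v) (S.X w) := ext0_of (S.hom_pn v w h h') (S.E_pn v w h h')

lemma lf' (Q : V → Prop) (x : V) : {v | Q v ∧ S.d v x ≠ 0}.Finite :=
  (S.lf x).subset fun _ h => h.2

lemma E_smul (c : Ctx Γ r p) (g : Γ) (v w : V) :
    E r (S.d (g • v)) (S.d (g • w)) = E r (S.d v) (S.d w) := by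
  unfold d
  rw [← S.eqv, ← S.eqv, E_tr c.rinv]

/-- Sign coherence between a negative label and a positive label. -/
lemma dich (c : Ctx Γ r p) (j k : Fin n) (hj : S.s j = false) (hk : S.s k = true) :
    (∀ v u, p v = j → p u = k → Hom0 r (S.X v) (S.X u)) ∨
    (∀ v u, p v = j → p u = k → Ext0 r (S.X v) (S.X u)) := by
  by_cases h : ∀ v u, p v = j → p u = k → Hom0 r (S.X v) (S.X u)
  · exact Or.inl h
  · right
    push Not at h
    obtain ⟨v0, u0, hv0, hu0, hne⟩ := h
    exact hr_fam c S.X S.X j k (fun v _ => S.brick v) (fun v _ => S.brick v)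
      (fun v v' hv hv' => S.ext_label (hv.trans hv'.symm))
      (fun v v' hv hv' => S.ext_label (hv.trans hv'.symm))
      (fun u v hu hv => S.ext_pn (by rw [hu, hk]) (by rw [hv, hj]))
      (fun g v _ => S.eqv g v) (fun g v _ => S.eqv g v) v0 u0 hv0 hu0 hne

lemma hdim_np (c : Ctx Γ r p) {v u : V} (hv : S.s (p v) = false) (hu : S.s (p u) = true) :
    (hdim r (S.X v) (S.X u) : ℤ) = max 0 (E r (S.d v) (S.d u)) := by
  rcases S.dich c _ _ hv hu with h | h
  · have h1 := h v u rfl rfl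
    have h2 := E_nonpos_of h1
    rw [(hdim_eq_zero r).mpr h1]
    unfold d
    simp [h2]
  · have h1 := h v u rfl rfl
    rw [hdim_of h1]
    exact (max_eq_right (E_nonneg_of h1)).symm

/-- Chains of negative labels. -/
def step (a b : Fin n) : Prop := S.s a = false ∧ S.s b = false ∧ ∃ v w, p v = a ∧ p w = b ∧ v ≠ w ∧
  E r (S.d v) (S.d w) ≠ 0

def isJ (k j : Fin n) : Prop := S.s j = false ∧ ∃ v u, p v = j ∧ p u = k ∧ 0 < E r (S.d v) (S.d u)

structure Chain (k j b : Fin n) (M : V → QRep V) : Prop where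
  brick : ∀ v, p v = j → Brick r (M v)
  hom : ∀ v v', p v = j → p v' = j → v ≠ v' → Hom0 r (M v) (M v')
  E_self : ∀ v, p v = j → E r (dm (M v)) (dm (M v)) = 1
  E_ne : ∀ v v', p v = j → p v' = j → v ≠ v' → E r (dm (M v)) (dm (M v')) = 0
  eqv : ∀ (g : Γ) v, p v = j → tr g (dm (M v)) = dm (M (g • v))
  lf : ∀ x, {v | p v = j ∧ dm (M v) x ≠ 0}.Finite
  hom_P : ∀ u v, p u = k → p v = j → Hom0 r (S.X u) (M v)
  E_P : ∀ u v, p u = k → p v = j → E r (S.d u) (dm (M v)) = 0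
  nz : ∀ v, p v = j → ∃ u, p u = k ∧ ¬ Hom0 r (M v) (S.X u)
  top : ∀ v, p v = j → ∃ w, p w = b ∧ ∀ Y, Ext0 r (M v) Y → Ext0 r (S.X w) Y
  low : ∀ w v, p v = j → S.s (p w) = false → S.pos (p w) < S.pos b →
    Hom0 r (S.X w) (M v) ∧ Hom0 r (M v) (S.X w) ∧ E r (S.d w) (dm (M v)) = 0

variable {S}
lemma chain_base (c : Ctx Γ r p) {k j : Fin n} (hk : S.s k = true) (hj : S.isJ k j) :
    S.Chain k j j S.X := by
  obtain ⟨hs, v0, u0, hv0, hu0, hpos⟩ := hj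
  refine ⟨fun v _ => S.brick v, fun v v' h h' hne => S.hom_same v v' hne (by rw [h, h']),
    fun v _ => S.E_self v,
    fun v v' h h' hne => S.E_same v v' hne (by rw [h, h']) (by rw [h, h']),
    fun g v _ => S.eqv g v, fun x => S.lf' _ x,
    fun u v hu hv => S.hom_pn u v (by rw [hu, hk]) (by rw [hv, hs]),
    fun u v hu hv => S.E_pn u v (by rw [hu, hk]) (by rw [hv, hs]), ?_,
    fun v hv => ⟨v, hv, fun Y h => h⟩, ?_⟩
  · intro v hv
    obtain ⟨g, rfl⟩ := (c.fib v0 v).mp (hv0.trans hv.symm)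
    refine ⟨g • u0, (c.p_smul g u0).trans hu0, fun h => ?_⟩
    have h1 := E_nonpos_of h
    have h2 := S.E_smul c g v0 u0
    unfold d at h2 hpos
    omega
  · intro w v hv hw hlt
    have hne : w ≠ v := by
      rintro rfl
      rw [hv] at hlt
      exact lt_irrefl _ hlt
    refine ⟨S.hom_same w v hne (by rw [hw, hv, hs]), S.hom_same v w hne.symm (by rw [hw, hv, hs]),
      S.E_same w v hne (by rw [hw, hv, hs]) (by rw [hv]; exact hlt.le)⟩

lemma chain_step (c : Ctx Γ r p) {k j b e : Fin n} (hk : S.s k = true) {M : V → QRep V}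
    (h : S.Chain k j b M) (hbe : S.step b e) (hpos : S.pos e < S.pos b) :
    ∃ M', S.Chain k j e M' := by
  classical
  obtain ⟨hb, he, x0, y0, hx0, hy0, hxy, hE0⟩ := hbe
  have hfin : ∀ v, {u | p u = e ∧ E r (dm (M v)) (S.d u) ≠ 0}.Finite := fun v =>
    c.fin_right S.d (fun u => p u = e) (fun x => S.lf' _ x) _
  have hQl : ∀ w v, p v = j → p w = e → Hom0 r (S.X w) (M v) ∧ Hom0 r (M v) (S.X w) ∧
      E r (S.d w) (dm (M v)) = 0 := fun w v hv hw => h.low w v hv (by rw [hw, he]) (by rw [hw]; exact hpos)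
  have hQH : ∀ u u', p u = e → p u' = e → u ≠ u' → Hom0 r (S.X u) (S.X u') := fun u u' hu hu' hne =>
    S.hom_same u u' hne (by rw [hu, hu'])
  have hQE : ∀ u u', p u = e → p u' = e → u ≠ u' → E r (S.d u) (S.d u') = 0 := fun u u' hu hu' hne =>
    S.E_same u u' hne (by rw [hu, hu']) (by rw [hu, hu'])
  have hex : ∀ v, ∃ X' : QRep V, p v = j → _ := fun v =>
    if hv : p v = j then
      let ⟨X', hX'⟩ := univ_extV (r := r) S.X (fun u => p u = e) (fun u _ => S.brick u)
        hQH (M v) (h.brick v hv)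
        (fun u hu => (hQl u v hv hu).2.1) (fun u hu => (hQl u v hv hu).1) (hfin v)
      ⟨X', fun _ => hX'⟩
    else ⟨M v, fun h => absurd h hv⟩
  choose M' hM' using hex
  let cc : V → V → ℤ := fun v u => if p u = e then - E r (dm (M v)) (S.d u) else 0
  have hcc : ∀ v u, cc v u ≠ 0 → p u = e ∧ E r (dm (M v)) (S.d u) ≠ 0 := by
    intro v u hu
    by_cases hp : p u = e
    · simp only [cc, if_pos hp] at hu
      exact ⟨hp, by simpa using hu⟩
    · simp [cc, if_neg hp] at hu
  have hccf : ∀ v, {u | cc v u ≠ 0}.Finite := fun v => (hfin v).subset fun u hu => hcc v u hu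
  have hd : ∀ v, p v = j → dm (M' v) = dm (M v) + cmb S.d (cc v) := fun v hv => by
    rw [(hM' v hv).1]
    congr 2
    funext u
    by_cases hp : p u = e <;> simp [cc, hp, d]
  have hEQ : ∀ v u, p v = j → p u = e → E r (dm (M' v)) (S.d u) = 0 := by
    intro v u hv hu
    rw [hd v hv, map_add, LinearMap.add_apply]
    have := map_cmb_single ((E r).flip (S.d u)) S.d (cc v) (hccf v) u (S.E_self u)
      (fun u' hu' hne => hQE u' u (hcc v u' hu').1 hu hne)
    rw [LinearMap.flip_apply] at this
    rw [this]
    simp [cc, hu]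
  have hEM : ∀ y : V →₀ ℤ, (∀ u, p u = e → E r y (S.d u) = 0) → ∀ v, p v = j →
      E r y (dm (M' v)) = E r y (dm (M v)) := by
    intro y hy v hv
    rw [hd v hv, map_add, map_cmb_zero (E r y) S.d (cc v) (hccf v)
      (fun u hu => hy u (hcc v u hu).1), add_zero]
  have hEM' : ∀ y : V →₀ ℤ, (∀ u, p u = e → E r (S.d u) y = 0) → ∀ v, p v = j →
      E r (dm (M' v)) y = E r (dm (M v)) y := by
    intro y hy v hv
    have := map_cmb_zero ((E r).flip y) S.d (cc v) (hccf v)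
      (fun u hu => hy u (hcc v u hu).1)
    rw [LinearMap.flip_apply] at this
    rw [hd v hv, map_add, LinearMap.add_apply, this, add_zero]
  have hEE : ∀ v v', p v = j → p v' = j → E r (dm (M' v)) (dm (M' v')) =
      E r (dm (M v)) (dm (M v')) := by
    intro v v' hv hv'
    rw [hEM _ (fun u hu => hEQ v u hv hu) v' hv', hEM' _ (fun u hu => (hQl u v' hv' hu).2.2) v hv]
  refine ⟨M', fun v hv => (hM' v hv).2.1, ?_, ?_, ?_, ?_, ?_, ?_, ?_, ?_, ?_, ?_⟩
  · intro v v' hv hv' hne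
    obtain ⟨-, -, a3, a4, a5, a6, a7⟩ := hM' v hv
    obtain ⟨-, -, b3, b4, b5, b6, b7⟩ := hM' v' hv'
    exact b5 _ (a4 _ (h.hom v v' hv hv' hne) fun u hu => (hQl u v' hv' hu).1) a3
  · intro v hv
    rw [hEE v v hv hv, h.E_self v hv]
  · intro v v' hv hv' hne
    rw [hEE v v' hv hv', h.E_ne v v' hv hv' hne]
  · intro g v hv
    have hgv := (c.p_smul g v).trans hv
    rw [hd v hv, hd _ hgv, map_add, h.eqv g v hv]
    congr 1
    refine tr_cmb g S.d (cc v) (cc (g • v)) (hccf v) ?_ (fun u _ => S.eqv g u)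
    intro u
    simp only [cc, c.p_smul]
    rw [← h.eqv g v hv]
    unfold d
    rw [← S.eqv, E_tr c.rinv]
  · intro x
    refine ((h.lf x).union (lf_cmb S.d cc (fun v => p v = j) (fun v _ => hccf v) ?_
      (fun x => S.lf' _ x) x)).subset ?_
    · intro u
      refine (c.fin_left (fun v => dm (M v)) (fun v => p v = j) h.lf (S.d u)).subset ?_
      rintro v ⟨hv, hu⟩
      exact ⟨hv, (hcc v u hu).2⟩
    · rintro v ⟨hv, hx⟩
      rw [hd v hv, Finsupp.add_apply] at hx
      by_cases h0 : dm (M v) x = 0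
      · right
        refine ⟨hv, fun h1 => hx ?_⟩
        rw [h0, h1, add_zero]
      · exact Or.inl ⟨hv, h0⟩
  · intro u v hu hv
    obtain ⟨-, -, a3, a4, a5, a6, a7⟩ := hM' v hv
    exact a5 _ (h.hom_P u v hu hv) fun w hw => S.hom_pn u w (by rw [hu, hk]) (by rw [hw, he])
  · intro u v hu hv
    rw [hEM (S.d u) (fun w hw => S.E_pn u w (by rw [hu, hk]) (by rw [hw, he])) v hv, h.E_P u v hu hv]
  · intro v hv
    obtain ⟨-, -, a3, a4, a5, a6, a7⟩ := hM' v hv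
    obtain ⟨u, hu, hn⟩ := h.nz v hv
    exact ⟨u, hu, fun h' => hn (a6 _ h')⟩
  · intro v hv
    obtain ⟨-, -, a3, a4, a5, a6, a7⟩ := hM' v hv
    obtain ⟨x, hx, hxY⟩ := h.top v hv
    obtain ⟨g, rfl⟩ := (c.fib x0 x).mp (hx0.trans hx.symm)
    have hy : p (g • y0) = e := (c.p_smul g y0).trans hy0
    refine ⟨g • y0, hy, a7 _ hy ?_⟩
    intro h0
    have h1 := hxY _ (ext0_of (hQl _ v hv hy).2.1 h0)
    have h2 : Hom0 r (S.X (g • x0)) (S.X (g • y0)) := S.hom_same _ _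
      (fun hh => hxy (MulAction.injective g hh)) (by rw [hx, hy, hb, he])
    have h3 := E_zero_of h2 h1
    have h4 := S.E_smul c g x0 y0
    unfold d at h4 hE0
    omega
  · intro w v hv hw hlt
    obtain ⟨-, -, a3, a4, a5, a6, a7⟩ := hM' v hv
    obtain ⟨l1, l2, l3⟩ := h.low w v hv hw (hlt.trans hpos)
    have hne : ∀ u, p u = e → w ≠ u := by
      rintro u hu rfl
      rw [hu] at hlt
      exact lt_irrefl _ hlt
    refine ⟨a5 _ l1 fun u hu => S.hom_same _ _ (hne u hu) (by rw [hw, hu, he]),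
      a4 _ l2 fun u hu => S.hom_same _ _ (hne u hu).symm (by rw [hw, hu, he]), ?_⟩
    rw [hEM (S.d w) (fun u hu => S.E_same w u (hne u hu) (by rw [hw, hu, he]) (by rw [hu]; exact hlt.le))
      v hv, l3]

/-- Labels reachable from `J`. -/
def isD (S : Seed Γ r p) (k b : Fin n) : Prop :=
  ∃ a, S.isJ k a ∧ Relation.ReflTransGen S.step a b

lemma step_pos {a b : Fin n} (h : S.step a b) : S.pos b < S.pos a := by
  obtain ⟨ha, hb, v, w, rfl, rfl, hne, hE⟩ := h
  by_contra hle
  push Not at hle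
  exact hE (S.E_same v w hne (by rw [ha, hb]) hle)

lemma isD_chain (c : Ctx Γ r p) {k b : Fin n} (hk : S.s k = true) (h : S.isD k b) :
    ∃ j M, S.isJ k j ∧ S.Chain k j b M := by
  obtain ⟨a, ha, hab⟩ := h
  induction hab with
  | refl => exact ⟨a, S.X, ha, chain_base c hk ha⟩
  | tail _ hbc ih =>
    obtain ⟨j, M, hj, hM⟩ := ih
    obtain ⟨M', hM'⟩ := chain_step c hk hM hbc (step_pos hbc)
    exact ⟨j, M', hj, hM'⟩

lemma isD_neg {k b : Fin n} (h : S.isD k b) : S.s b = false := by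
  obtain ⟨a, ha, hab⟩ := h
  induction hab with
  | refl => exact ha.1
  | tail _ hbc ih => exact hbc.2.1

/-- The key claim. -/
lemma isD_nonneg (c : Ctx Γ r p) {k : Fin n} (hk : S.s k = true) {w u : V} (hu : p u = k)
    (h : S.isD k (p w)) : 0 ≤ E r (S.d w) (S.d u) := by
  obtain ⟨j, M, ⟨_, v0, _, hv0, _⟩, hM⟩ := isD_chain c hk h
  obtain ⟨u0, hu0, hn⟩ := hM.nz v0 hv0
  have key := hr_fam c M S.X j k hM.brick (fun u _ => S.brick u) (by
      intro v v' hv hv'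
      by_cases hvv : v = v'
      · subst hvv
        exact ext0_self (hM.brick v hv) (hM.E_self v hv)
      · exact ext0_of (hM.hom v v' hv hv' hvv) (hM.E_ne v v' hv hv' hvv))
    (fun u u' hu hu' => S.ext_label (hu.trans hu'.symm))
    (fun u v hu hv => ext0_of (hM.hom_P u v hu hv) (hM.E_P u v hu hv))
    hM.eqv (fun g u _ => S.eqv g u) v0 u0 hv0 hu0 hn
  obtain ⟨w', hw', hY⟩ := hM.top v0 hv0
  obtain ⟨g, hg⟩ := (c.fib w w').mp hw'.symm
  have hgu : p (g • u) = k := (c.p_smul g u).trans hu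
  have := E_nonneg_of (hY _ (key v0 (g • u) hv0 hgu))
  rw [← S.E_smul c g w u, hg]
  exact this

end Seed
end Unf

open Module

namespace Unf
variable {V : Type} {Γ : Type} [Group Γ] [MulAction Γ V] {r : V → V → Prop}
variable {n : ℕ} {p : V → Fin n}

namespace Seed
variable (S : Seed Γ r p)

/-- Mutation coefficients. -/
noncomputable def cf (k : Fin n) (v u : V) : ℤ :=
  if p u = k then (if S.s (p v) = true then - E r (S.d v) (S.d u) else max 0 (E r (S.d v) (S.d u)))
  else 0

noncomputable def D (k : Fin n) (v : V) : V →₀ ℤ := cmb S.d (S.cf k v)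

variable {S}

lemma cf_k {k : Fin n} {v u : V} (h : S.cf k v u ≠ 0) : p u = k := by
  by_contra hp
  exact h (if_neg hp)

lemma cf_E {k : Fin n} {v u : V} (h : S.cf k v u ≠ 0) : E r (S.d v) (S.d u) ≠ 0 := by
  intro h0
  apply h
  unfold cf
  simp [h0]

lemma cf_fin (c : Ctx Γ r p) (k : Fin n) (v : V) : {u | S.cf k v u ≠ 0}.Finite :=
  (c.fin_right S.d (fun u => p u = k) (fun x => S.lf' _ x) (S.d v)).subset
    fun _ hu => ⟨cf_k hu, cf_E hu⟩

lemma cf_smul (c : Ctx Γ r p) (k : Fin n) (g : Γ) (v u : V) :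
    S.cf k (g • v) (g • u) = S.cf k v u := by
  unfold cf
  rw [c.p_smul, c.p_smul, S.E_smul c]

lemma tr_D (c : Ctx Γ r p) (k : Fin n) (g : Γ) (v : V) : tr g (S.D k v) = S.D k (g • v) :=
  tr_cmb g S.d _ _ (cf_fin c k v) (cf_smul c k g v) (fun u _ => S.eqv g u)

lemma D_le_smul (c : Ctx Γ r p) (k : Fin n) (g : Γ) (v : V) :
    S.D k (g • v) ≤ S.d (g • v) ↔ S.D k v ≤ S.d v := by
  rw [← tr_D c]
  unfold d
  rw [← S.eqv, tr_le]

lemma D_le_label (c : Ctx Γ r p) (k : Fin n) {v w : V} (h : p v = p w) :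
    S.D k v ≤ S.d v ↔ S.D k w ≤ S.d w := by
  obtain ⟨g, rfl⟩ := (c.fib v w).mp h
  exact (D_le_smul c k g v).symm

lemma E_kk {u u' : V} (h : p u = p u') (hne : u ≠ u') : E r (S.d u) (S.d u') = 0 :=
  S.E_same u u' hne (by rw [h]) (by rw [h])

lemma E_D_left (c : Ctx Γ r p) {k : Fin n} (v : V) {u : V} (hu : p u = k) :
    E r (S.D k v) (S.d u) = S.cf k v u :=
  map_cmb_single ((E r).flip (S.d u)) S.d _ (cf_fin c k v) u (S.E_self u)
    fun _ hu' hne => E_kk ((cf_k hu').trans hu.symm) hne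

lemma E_D_right (c : Ctx Γ r p) {k : Fin n} (v : V) {u : V} (hu : p u = k) :
    E r (S.d u) (S.D k v) = S.cf k v u :=
  map_cmb_single (E r (S.d u)) S.d _ (cf_fin c k v) u (S.E_self u)
    fun _ hu' hne => E_kk (hu.trans (cf_k hu').symm) hne.symm

lemma E_D_zero_left (c : Ctx Γ r p) {k : Fin n} (v : V) {y : V →₀ ℤ}
    (h : ∀ u, p u = k → E r (S.d u) y = 0) : E r (S.D k v) y = 0 :=
  map_cmb_zero ((E r).flip y) S.d _ (cf_fin c k v) fun u hu => h u (cf_k hu)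

lemma E_D_zero_right (c : Ctx Γ r p) {k : Fin n} (v : V) {y : V →₀ ℤ}
    (h : ∀ u, p u = k → E r y (S.d u) = 0) : E r y (S.D k v) = 0 :=
  map_cmb_zero (E r y) S.d _ (cf_fin c k v) fun u hu => h u (cf_k hu)

/-- The representations of the mutated seed. -/
structure MD (S : Seed Γ r p) (k : Fin n) (X' : V → QRep V) : Prop where
  hk : ∀ v, p v = k → X' v = S.X v
  hP : ∀ v, p v ≠ k → S.s (p v) = true → dm (X' v) = S.d v + S.D k v ∧ Brick r (X' v) ∧
      (∀ u, p u = k → Hom0 r (X' v) (S.X u)) ∧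
      (∀ Y, Hom0 r (S.X v) Y → (∀ u, p u = k → Hom0 r (S.X u) Y) → Hom0 r (X' v) Y) ∧
      (∀ Y, Hom0 r Y (S.X v) → (∀ u, p u = k → Hom0 r Y (S.X u)) → Hom0 r Y (X' v))
  hK : ∀ v, S.s (p v) = false → S.D k v ≤ S.d v → dm (X' v) = S.d v - S.D k v ∧ Brick r (X' v) ∧
      (∀ u, p u = k → Hom0 r (X' v) (S.X u)) ∧
      (∀ Y, Hom0 r Y (S.X v) → Hom0 r Y (X' v)) ∧
      (∀ Y, (∀ u, p u = k → Ext0 r (S.X u) Y) → Hom0 r (S.X v) Y → Hom0 r (X' v) Y)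
  hC : ∀ v, S.s (p v) = false → ¬ S.D k v ≤ S.d v → dm (X' v) = S.D k v - S.d v ∧ Brick r (X' v) ∧
      (∀ u, p u = k → Hom0 r (X' v) (S.X u)) ∧
      (∀ Y, (∀ u, p u = k → Hom0 r (S.X u) Y) → Hom0 r (X' v) Y) ∧
      (∀ Y, Ext0 r Y (S.X v) → (∀ u, p u = k → Hom0 r Y (S.X u)) → Hom0 r Y (X' v)) ∧
      (∀ Y, (∀ u, p u = k → Ext0 r (S.X u) Y) → Hom0 r (S.X v) Y → Ext0 r (X' v) Y) ∧
      (∀ Y, (∀ u, p u = k → Ext0 r (S.X u) Y) → Ext0 r (S.X v) Y)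

lemma exists_MD (c : Ctx Γ r p) {k : Fin n} (hk : S.s k = true) : ∃ X', S.MD k X' := by
  classical
  have hfin : ∀ v, {u | p u = k ∧ E r (S.d v) (S.d u) ≠ 0}.Finite := fun v =>
    c.fin_right S.d (fun u => p u = k) (fun x => S.lf' _ x) _
  have hQH : ∀ u u', p u = k → p u' = k → u ≠ u' → Hom0 r (S.X u) (S.X u') := fun u u' hu hu' hne =>
    S.hom_same u u' hne (by rw [hu, hu'])
  have h1 : ∀ v, ∃ X' : QRep V, (p v = k → X' = S.X v) ∧
    (p v ≠ k → S.s (p v) = true → dm X' = S.d v + S.D k v ∧ Brick r X' ∧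
      (∀ u, p u = k → Hom0 r X' (S.X u)) ∧
      (∀ Y, Hom0 r (S.X v) Y → (∀ u, p u = k → Hom0 r (S.X u) Y) → Hom0 r X' Y) ∧
      (∀ Y, Hom0 r Y (S.X v) → (∀ u, p u = k → Hom0 r Y (S.X u)) → Hom0 r Y X')) ∧
    (S.s (p v) = false → S.D k v ≤ S.d v → dm X' = S.d v - S.D k v ∧ Brick r X' ∧
      (∀ u, p u = k → Hom0 r X' (S.X u)) ∧
      (∀ Y, Hom0 r Y (S.X v) → Hom0 r Y X') ∧
      (∀ Y, (∀ u, p u = k → Ext0 r (S.X u) Y) → Hom0 r (S.X v) Y → Hom0 r X' Y)) ∧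
    (S.s (p v) = false → ¬ S.D k v ≤ S.d v → dm X' = S.D k v - S.d v ∧ Brick r X' ∧
      (∀ u, p u = k → Hom0 r X' (S.X u)) ∧
      (∀ Y, (∀ u, p u = k → Hom0 r (S.X u) Y) → Hom0 r X' Y) ∧
      (∀ Y, Ext0 r Y (S.X v) → (∀ u, p u = k → Hom0 r Y (S.X u)) → Hom0 r Y X') ∧
      (∀ Y, (∀ u, p u = k → Ext0 r (S.X u) Y) → Hom0 r (S.X v) Y → Ext0 r X' Y) ∧
      (∀ Y, (∀ u, p u = k → Ext0 r (S.X u) Y) → Ext0 r (S.X v) Y)) := by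
    intro v
    by_cases hv : p v = k
    · refine ⟨S.X v, fun _ => rfl, fun h => absurd hv h, fun h => ?_, fun h => ?_⟩ <;>
      · rw [hv, hk] at h
        exact absurd h (by simp)
    · cases hs : S.s (p v)
      · have hD : S.D k v = cmb (fun u => dm (S.X u))
            (fun u => if p u = k then max 0 (E r (dm (S.X v)) (dm (S.X u))) else 0) := by
          unfold D
          congr 1
          funext u
          by_cases hp : p u = k <;> simp [cf, hp, hs, d]
        obtain ⟨a1, a2⟩ := univ_mapV (r := r) S.X (fun u => p u = k) (fun u _ => S.brick u) hQH
          (fun u u' hu hu' => S.ext_label (hu.trans hu'.symm)) (S.X v) (S.brick v)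
          (fun u hu => S.ext_pn (by rw [hu, hk]) hs) (hfin v)
          (fun u hu => S.hdim_np c hs (by rw [hu, hk])) (S.D k v) (by
            rw [hD]
            congr 1
            funext u
            by_cases hp : p u = k <;> simp [hp])
        by_cases hle : S.D k v ≤ S.d v
        · obtain ⟨X', hX'⟩ := a1 hle
          exact ⟨X', fun h => absurd h hv, fun _ h => by simp at h, fun _ _ => hX',
            fun _ h => absurd hle h⟩
        · obtain ⟨X', hX'⟩ := a2 hle
          exact ⟨X', fun h => absurd h hv, fun _ h => by simp at h, fun _ h => absurd h hle,
            fun _ _ => hX'⟩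
      · have hD : S.D k v = cmb (fun u => dm (S.X u))
            (fun u => if p u = k then - (E r (dm (S.X v)) (dm (S.X u))) else 0) := by
          unfold D
          congr 1
          funext u
          by_cases hp : p u = k <;> simp [cf, hp, hs, d]
        have hne : ∀ u, p u = k → v ≠ u := fun u hu hh => hv (hh ▸ hu)
        obtain ⟨X', b1, b2, b3, b4, b5, -, -⟩ := univ_extV (r := r) S.X (fun u => p u = k)
          (fun u _ => S.brick u) hQH (S.X v) (S.brick v)
          (fun u hu => S.hom_same v u (hne u hu) (by rw [hu, hk, hs]))
          (fun u hu => S.hom_same u v (hne u hu).symm (by rw [hu, hk, hs])) (hfin v)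
        refine ⟨X', fun h => absurd h hv, fun _ _ => ⟨?_, b2, b3, b4, b5⟩, fun h => by simp at h,
          fun h => by simp at h⟩
        rw [b1, hD]
        congr 2
        funext u
        by_cases hp : p u = k <;> simp [hp]
  choose X' h1 h2 h3 h4 using h1
  exact ⟨X', h1, h2, h3, h4⟩

/-! Euler form computations. -/

lemma E_x_d (c : Ctx Γ r p) {k : Fin n} {v u : V} (hs : S.s (p v) = true)
    (hu : p u = k) : E r (S.d v + S.D k v) (S.d u) = 0 := by
  rw [map_add, LinearMap.add_apply, E_D_left c v hu]
  simp [cf, hu, hs]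

lemma E_x_n (c : Ctx Γ r p) {k : Fin n} (hk : S.s k = true) {v w : V} (hs : S.s (p v) = true)
    (hw : S.s (p w) = false) : E r (S.d v + S.D k v) (S.d w) = 0 := by
  rw [map_add, LinearMap.add_apply,
    E_D_zero_left c v (k := k) (y := S.d w) (fun u hu => S.E_pn u w (by rw [hu, hk]) hw), add_zero]
  exact S.E_pn v w hs hw

lemma E_x_z (c : Ctx Γ r p) {k : Fin n} (hk : S.s k = true) {v w : V} (hs : S.s (p v) = true)
    (hw : S.s (p w) = false) : E r (S.d v + S.D k v) (S.d w - S.D k w) = 0 := by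
  rw [map_sub, E_x_n c hk hs hw, E_D_zero_right c w (fun u hu => E_x_d c hs hu), sub_zero]

lemma E_D_d (c : Ctx Γ r p) {k : Fin n} (hk : S.s k = true) {v w : V} (hv : p v ≠ k) (hw : p w ≠ k)
    (hs : S.s (p v) = true) (hs' : S.s (p w) = true) (hpos : S.pos (p v) ≤ S.pos (p w)) :
    E r (S.D k v) (S.d w) = 0 := by
  refine map_cmb_zero ((E r).flip (S.d w)) S.d _ (cf_fin c k v) fun u hu => ?_
  have hu' := cf_k hu
  have hE := cf_E hu
  have h1 : S.pos (p u) < S.pos (p v) := by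
    by_contra hle
    push Not at hle
    exact hE (S.E_same v u (fun h => hv (h ▸ hu')) (by rw [hs, hu', hk]) hle)
  exact S.E_same u w (fun h => hw (h ▸ hu')) (by rw [hs', hu', hk]) (h1.le.trans hpos)

lemma E_x_x (c : Ctx Γ r p) {k : Fin n} (hk : S.s k = true) {v w : V} (hv : p v ≠ k) (hw : p w ≠ k)
    (hs : S.s (p v) = true) (hs' : S.s (p w) = true) (hpos : S.pos (p v) ≤ S.pos (p w)) :
    E r (S.d v + S.D k v) (S.d w + S.D k w) = E r (S.d v) (S.d w) := by
  rw [map_add, E_D_zero_right c w (fun u hu => E_x_d c hs hu), add_zero, map_add,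
    LinearMap.add_apply, E_D_d c hk hv hw hs hs' hpos, add_zero]

lemma isJ_of_cf {k : Fin n} {v u : V} (hs : S.s (p v) = false)
    (h : S.cf k v u ≠ 0) : S.isJ k (p v) := by
  refine ⟨hs, v, u, rfl, cf_k h, ?_⟩
  have := cf_k h
  simp only [cf, this, hs] at h
  by_contra hle
  push Not at hle
  apply h
  simp [hle]

lemma isD_of_isJ {k j : Fin n} (h : S.isJ k j) : S.isD k j := ⟨j, h, Relation.ReflTransGen.refl⟩

lemma D_zero {k : Fin n} {v : V} (hs : S.s (p v) = false) (h : ¬ S.isD k (p v)) :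
    S.D k v = 0 := by
  refine cmb_zero _ _ fun u => ?_
  by_contra hu
  exact h (isD_of_isJ (isJ_of_cf hs hu))

lemma isD_of_not_le {k : Fin n} {v : V} (hs : S.s (p v) = false)
    (h : ¬ S.D k v ≤ S.d v) : S.isD k (p v) := by
  by_contra hD
  apply h
  rw [D_zero hs hD]
  intro x
  unfold d
  rw [dm_apply]
  simp

lemma E_z_d (c : Ctx Γ r p) {k : Fin n} (hk : S.s k = true) {v u : V}
    (h : S.isD k (p v)) (hu : p u = k) : E r (S.d v - S.D k v) (S.d u) = 0 := by
  have hs := isD_neg h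
  rw [map_sub, LinearMap.sub_apply, E_D_left c v hu]
  have := isD_nonneg c hk hu h
  simp [cf, hu, hs, this]

lemma E_z_z (c : Ctx Γ r p) {k : Fin n} (hk : S.s k = true) {v w : V}
    (h : S.isD k (p v)) (hw : S.s (p w) = false) :
    E r (S.d v - S.D k v) (S.d w - S.D k w) = E r (S.d v) (S.d w) := by
  rw [map_sub, E_D_zero_right c w (fun u hu => E_z_d c hk h hu), sub_zero, map_sub,
    LinearMap.sub_apply, E_D_zero_left c v (k := k) (y := S.d w) (fun u hu => S.E_pn u w (by rw [hu, hk]) hw), sub_zero]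

lemma E_D_notD {k : Fin n} {v w : V} (h : S.isD k (p v)) (hw : S.s (p w) = false)
    (hw' : ¬ S.isD k (p w)) : E r (S.d v) (S.d w) = 0 := by
  by_contra hE
  apply hw'
  have hs := isD_neg h
  obtain ⟨a, ha, hab⟩ := h
  refine ⟨a, ha, hab.tail ⟨hs, hw, v, w, rfl, rfl, ?_, hE⟩⟩
  rintro rfl
  exact hw' ⟨a, ha, hab⟩

end Seed
end Unf

open Module

namespace Unf
variable {V : Type} {Γ : Type} [Group Γ] [MulAction Γ V] {r : V → V → Prop}
variable {n : ℕ} {p : V → Fin n}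

namespace Seed
variable (S : Seed Γ r p)

open Classical in
/-- New signs. -/
noncomputable def s' (k j : Fin n) : Bool :=
  if j = k then false else if S.s j = true then true else decide (∃ v, p v = j ∧ ¬ S.D k v ≤ S.d v)

open Classical in
/-- New positions. -/
noncomputable def pos' (k : Fin n) (B : ℤ) (j : Fin n) : ℤ :=
  if j = k then B else if S.s j = true then S.pos j else
    if S.s' k j = true then 2 * B + S.pos j else
      if S.isD k j then S.pos j else 2 * B + S.pos j

/-- Classification of vertices. -/
inductive Cls (k : Fin n) (v : V) : Prop
  | k (h : p v = k) (hs : S.s' k (p v) = false)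
  | P (h : p v ≠ k) (h1 : S.s (p v) = true) (hs : S.s' k (p v) = true)
  | K (h : p v ≠ k) (h1 : S.s (p v) = false) (h2 : S.D k v ≤ S.d v) (hs : S.s' k (p v) = false)
  | C (h : p v ≠ k) (h1 : S.s (p v) = false) (h2 : ¬ S.D k v ≤ S.d v) (hs : S.s' k (p v) = true)

variable {S}

lemma cls (c : Ctx Γ r p) {k : Fin n} (hk : S.s k = true) (v : V) : S.Cls k v := by
  classical
  by_cases h : p v = k
  · exact .k h (by simp [s', h])
  · cases h1 : S.s (p v)
    · by_cases h2 : S.D k v ≤ S.d v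
      · refine .K h h1 h2 ?_
        simp only [s', h, h1, if_false, Bool.false_eq_true, decide_eq_false_iff_not]
        rintro ⟨w, hw, hw'⟩
        exact hw' ((D_le_label c k hw).mpr h2)
      · refine .C h h1 h2 ?_
        simp only [s', h, h1, if_false, Bool.false_eq_true, decide_eq_true_eq]
        exact ⟨v, rfl, h2⟩
    · exact .P h h1 (by simp [s', h, h1])

/-- New c-vectors. -/
noncomputable def β' (S : Seed Γ r p) (k : Fin n) (v : V) : V →₀ ℤ :=
  if p v = k then - S.β v else S.β v + S.D k v

lemma dm_new (c : Ctx Γ r p) {k : Fin n} (hk : S.s k = true) {X' : V → QRep V} (h : S.MD k X')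
    (v : V) : dm (X' v) = if S.s' k (p v) = true then S.β' k v else - S.β' k v := by
  rcases cls c hk v with ⟨hv, hs⟩ | ⟨hv, h1, hs⟩ | ⟨hv, h1, h2, hs⟩ | ⟨hv, h1, h2, hs⟩
  · rw [h.hk v hv]
    rw [hs]
    simp [β', β, hv, hk, d]
  · rw [(h.hP v hv h1).1]
    simp [hs, β', β, hv, h1]
  · rw [(h.hK v h1 h2).1]
    simp [hs, β', β, hv, h1]
    abel
  · rw [(h.hC v h1 h2).1]
    simp [hs, β', β, hv, h1]
    abel

lemma tr_β (g : Γ) (c : Ctx Γ r p) (v : V) : tr g (S.β v) = S.β (g • v) := by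
  unfold β d
  rw [c.p_smul]
  split_ifs
  · exact S.eqv g v
  · rw [map_neg, S.eqv]

lemma tr_β' (g : Γ) (c : Ctx Γ r p) (k : Fin n) (v : V) : tr g (S.β' k v) = S.β' k (g • v) := by
  unfold β'
  rw [c.p_smul]
  split_ifs
  · rw [map_neg, tr_β g c]
  · rw [map_add, tr_β g c, tr_D c]

lemma lf_β' (c : Ctx Γ r p) (k : Fin n) (x : V) : {v | S.β' k v x ≠ 0}.Finite := by
  refine ((S.lf x).union (lf_cmb S.d (S.cf k) (fun _ => True) (fun v _ => cf_fin c k v) ?_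
      (fun x => S.lf' _ x) x)).subset ?_
  · intro u
    refine (c.fin_left S.d (fun _ => True) (fun x => S.lf' _ x) (S.d u)).subset ?_
    rintro v ⟨_, hu⟩
    exact ⟨trivial, cf_E hu⟩
  · intro v hx
    by_cases h0 : S.d v x = 0
    · right
      refine ⟨trivial, fun h1 => hx ?_⟩
      have h2 : S.β v x = 0 := by
        unfold β
        split_ifs <;> simp [h0]
      unfold β'
      split_ifs
      · simp [h2]
      · rw [Finsupp.add_apply, h2, zero_add]
        exact h1
    · exact Or.inl h0

lemma exists_bound (S : Seed Γ r p) : ∃ B : ℤ, ∀ i, |S.pos i| < B := by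
  refine ⟨(∑ i, |S.pos i|) + 1, fun i => ?_⟩
  have := Finset.single_le_sum (f := fun i => |S.pos i|) (fun i _ => abs_nonneg _) (Finset.mem_univ i)
  have h2 : |S.pos i| ≤ ∑ i, |S.pos i| := this
  omega

/-- Positive mutation of seeds. -/
lemma mut_pos (c : Ctx Γ r p) {k : Fin n} (hk : S.s k = true) :
    ∃ S' : Seed Γ r p, ∀ v, S'.β v = S.β' k v := by
  obtain ⟨X', h⟩ := exists_MD c hk
  obtain ⟨B, hB⟩ := exists_bound S
  have hB' : ∀ i, - B < S.pos i ∧ S.pos i < B := fun i => abs_lt.mp (hB i)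
  have hbr : ∀ v, Brick r (X' v) := by
    intro v
    rcases cls c hk v with ⟨hv, hs⟩ | ⟨hv, h1, hs⟩ | ⟨hv, h1, h2, hs⟩ | ⟨hv, h1, h2, hs⟩
    · rw [h.hk v hv]
      exact S.brick v
    · exact (h.hP v hv h1).2.1
    · exact (h.hK v h1 h2).2.1
    · exact (h.hC v h1 h2).2.1
  have hkK : ∀ u w, p u = k → S.s (p w) = false → S.D k w ≤ S.d w → Hom0 r (S.X u) (X' w) := by
    intro u w hu hw hle
    obtain ⟨-, -, -, a, -⟩ := h.hK w hw hle
    exact a _ (S.hom_pn u w (by rw [hu, hk]) hw)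
  have ext_kn : ∀ w, S.s (p w) = false → ∀ u, p u = k → Ext0 r (S.X u) (S.X w) := fun w hw u hu =>
    S.ext_pn (by rw [hu, hk]) hw
  have hom_kP : ∀ w, p w ≠ k → S.s (p w) = true → ∀ u, p u = k → Hom0 r (S.X u) (S.X w) :=
    fun w hw hs u hu => S.hom_same u w (fun hh => hw (hh ▸ hu)) (by rw [hu, hk, hs])
  have hsame : ∀ v w, v ≠ w → S.s' k (p v) = S.s' k (p w) → Hom0 r (X' v) (X' w) := by
    intro v w hne hss
    rcases cls c hk v with ⟨hv, hs⟩ | ⟨hv, h1, hs⟩ | ⟨hv, h1, h2, hs⟩ | ⟨hv, h1, h2, hs⟩ <;>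
    rcases cls c hk w with ⟨hv', hs'⟩ | ⟨hv', h1', hs'⟩ | ⟨hv', h1', h2', hs'⟩ | ⟨hv', h1', h2', hs'⟩ <;>
    first | (exfalso; rw [hs, hs'] at hss; simp at hss; done) | skip
    · rw [h.hk v hv, h.hk w hv']
      exact S.hom_same v w hne (by rw [hv, hv'])
    · rw [h.hk v hv]
      exact hkK v w hv h1' h2'
    · obtain ⟨-, -, a3, a4, a5⟩ := h.hP v hv h1
      obtain ⟨-, -, b3, b4, b5⟩ := h.hP w hv' h1'
      exact b5 _ (a4 _ (S.hom_same v w hne (by rw [h1, h1'])) (hom_kP w hv' h1')) a3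
    · obtain ⟨a1, -, a3, a4, a5⟩ := h.hP v hv h1
      obtain ⟨-, -, b3, b4, b5, b6, b7⟩ := h.hC w h1' h2'
      refine b5 _ (ext0_of (a4 _ (S.hom_pn v w h1 h1') fun u hu => S.hom_pn u w (by rw [hu, hk]) h1')
        ?_) a3
      rw [a1]
      exact E_x_n c hk h1 h1'
    · rw [h.hk w hv']
      exact (h.hK v h1 h2).2.2.1 w hv'
    · obtain ⟨a1, -, a3, a4, a5⟩ := h.hK v h1 h2
      obtain ⟨-, -, b3, b4, b5⟩ := h.hK w h1' h2'
      exact b4 _ (a5 _ (ext_kn w h1') (S.hom_same v w hne (by rw [h1, h1'])))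
    · obtain ⟨a1, -, a3, a4, a5, a6, a7⟩ := h.hC v h1 h2
      obtain ⟨-, -, b3, b4, b5⟩ := h.hP w hv' h1'
      exact b5 _ (a4 _ (hom_kP w hv' h1')) a3
    · obtain ⟨a1, -, a3, a4, a5, a6, a7⟩ := h.hC v h1 h2
      obtain ⟨-, -, b3, b4, b5, b6, b7⟩ := h.hC w h1' h2'
      exact b5 _ (a6 _ (ext_kn w h1') (S.hom_same v w hne (by rw [h1, h1']))) a3
  have hpn : ∀ v w, S.s' k (p v) = true → S.s' k (p w) = false → Hom0 r (X' v) (X' w) ∧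
      E r (dm (X' v)) (dm (X' w)) = 0 := by
    intro v w hsv hsw
    rcases cls c hk v with ⟨hv, hs⟩ | ⟨hv, h1, hs⟩ | ⟨hv, h1, h2, hs⟩ | ⟨hv, h1, h2, hs⟩ <;>
    first | (exfalso; rw [hs] at hsv; simp at hsv; done) | skip
    · obtain ⟨a1, -, a3, a4, a5⟩ := h.hP v hv h1
      rcases cls c hk w with ⟨hv', hs'⟩ | ⟨hv', h1', hs'⟩ | ⟨hv', h1', h2', hs'⟩ | ⟨hv', h1', h2', hs'⟩ <;>
      first | (exfalso; rw [hs'] at hsw; simp at hsw; done) | skip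
      · rw [h.hk w hv', a1]
        exact ⟨a3 w hv', E_x_d c h1 hv'⟩
      · obtain ⟨b1, -, b3, b4, b5⟩ := h.hK w h1' h2'
        rw [a1, b1]
        exact ⟨b4 _ (a4 _ (S.hom_pn v w h1 h1') fun u hu => S.hom_pn u w (by rw [hu, hk]) h1'),
          E_x_z c hk h1 h1'⟩
    · obtain ⟨a1, -, a3, a4, a5, a6, a7⟩ := h.hC v h1 h2
      have hD := isD_of_not_le h1 h2
      rcases cls c hk w with ⟨hv', hs'⟩ | ⟨hv', h1', hs'⟩ | ⟨hv', h1', h2', hs'⟩ | ⟨hv', h1', h2', hs'⟩ <;>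
      first | (exfalso; rw [hs'] at hsw; simp at hsw; done) | skip
      · rw [h.hk w hv', a1]
        refine ⟨a3 w hv', ?_⟩
        have := E_z_d c hk hD hv'
        rw [← neg_sub, map_neg, LinearMap.neg_apply]
        unfold d at this ⊢
        rw [this, neg_zero]
      · obtain ⟨b1, -, b3, b4, b5⟩ := h.hK w h1' h2'
        refine ⟨a4 _ fun u hu => hkK u w hu h1' h2', ?_⟩
        rw [a1, b1, ← neg_sub, map_neg, LinearMap.neg_apply, E_z_z c hk hD h1', neg_eq_zero]
        have hne : v ≠ w := by
          rintro rfl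
          exact h2 h2'
        exact E_zero_of (S.hom_same v w hne (by rw [h1, h1'])) (a7 _ (ext_kn w h1'))
  have hself : ∀ v, E r (dm (X' v)) (dm (X' v)) = 1 := by
    intro v
    rcases cls c hk v with ⟨hv, hs⟩ | ⟨hv, h1, hs⟩ | ⟨hv, h1, h2, hs⟩ | ⟨hv, h1, h2, hs⟩
    · rw [h.hk v hv]
      exact S.E_self v
    · rw [(h.hP v hv h1).1, E_x_x c hk hv hv h1 h1 le_rfl]
      exact S.E_self v
    · rw [(h.hK v h1 h2).1]
      by_cases hD : S.isD k (p v)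
      · rw [E_z_z c hk hD h1]
        exact S.E_self v
      · rw [D_zero h1 hD, sub_zero]
        exact S.E_self v
    · rw [(h.hC v h1 h2).1, ← neg_sub, map_neg, map_neg, LinearMap.neg_apply, neg_neg,
        E_z_z c hk (isD_of_not_le h1 h2) h1]
      exact S.E_self v
  have hEs : ∀ v w, v ≠ w → S.s' k (p v) = S.s' k (p w) → S.pos' k B (p v) ≤ S.pos' k B (p w) →
      E r (dm (X' v)) (dm (X' w)) = 0 := by
    intro v w hne hss hpos
    have bv := hB' (p v)
    have bw := hB' (p w)
    rcases cls c hk v with ⟨hv, hs⟩ | ⟨hv, h1, hs⟩ | ⟨hv, h1, h2, hs⟩ | ⟨hv, h1, h2, hs⟩ <;>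
    rcases cls c hk w with ⟨hv', hs'⟩ | ⟨hv', h1', hs'⟩ | ⟨hv', h1', h2', hs'⟩ | ⟨hv', h1', h2', hs'⟩ <;>
    first | (exfalso; rw [hs, hs'] at hss; simp at hss; done) | skip
    · rw [h.hk v hv, h.hk w hv']
      exact E_kk (hv.trans hv'.symm) hne
    · rw [h.hk v hv, (h.hK w h1' h2').1]
      by_cases hD : S.isD k (p w)
      · simp [pos', hv, hv', h1', hs', hD] at hpos
        omega
      · rw [D_zero h1' hD, sub_zero]
        exact S.E_pn v w (by rw [hv, hk]) h1'
    · rw [(h.hP v hv h1).1, (h.hP w hv' h1').1]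
      simp only [pos', hv, hv', h1, h1', if_false, if_true] at hpos
      rw [E_x_x c hk hv hv' h1 h1' hpos]
      exact S.E_same v w hne (by rw [h1, h1']) hpos
    · rw [(h.hP v hv h1).1, (h.hC w h1' h2').1, ← neg_sub, map_neg, E_x_z c hk h1 h1', neg_zero]
    · rw [h.hk w hv', (h.hK v h1 h2).1]
      by_cases hD : S.isD k (p v)
      · exact E_z_d c hk hD hv'
      · simp [pos', hv, hv', h1, hs, hD] at hpos
        omega
    · rw [(h.hK v h1 h2).1, (h.hK w h1' h2').1]
      by_cases hD : S.isD k (p v)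
      · rw [E_z_z c hk hD h1']
        by_cases hD' : S.isD k (p w)
        · simp [pos', hv, hv', h1, hs, hD, h1', hs', hD'] at hpos
          exact S.E_same v w hne (by rw [h1, h1']) hpos
        · exact E_D_notD hD h1' hD'
      · by_cases hD' : S.isD k (p w)
        · simp [pos', hv, hv', h1, hs, hD, h1', hs', hD'] at hpos
          omega
        · simp [pos', hv, hv', h1, hs, hD, h1', hs', hD'] at hpos
          rw [D_zero h1 hD, D_zero h1' hD', sub_zero, sub_zero]
          exact S.E_same v w hne (by rw [h1, h1']) hpos
    · simp [pos', hv, hv', h1, hs, h1'] at hpos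
      omega
    · simp [pos', hv, hv', h1, hs, h1', hs'] at hpos
      rw [(h.hC v h1 h2).1, (h.hC w h1' h2').1, ← neg_sub, ← neg_sub (S.d w), map_neg, map_neg,
        LinearMap.neg_apply, neg_neg, E_z_z c hk (isD_of_not_le h1 h2) h1']
      exact S.E_same v w hne (by rw [h1, h1']) hpos
  refine ⟨⟨X', S.s' k, S.pos' k B, hbr, hsame, fun v w a b => (hpn v w a b).1,
    fun v w a b => (hpn v w a b).2, hself, hEs, ?_, ?_⟩, ?_⟩
  · intro g v
    rw [dm_new c hk h, dm_new c hk h, c.p_smul]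
    split_ifs
    · exact tr_β' g c k v
    · rw [map_neg, tr_β' g c k v]
  · intro x
    refine (lf_β' (S := S) c k x).subset fun v hv hx => hv ?_
    rw [dm_new c hk h]
    split_ifs <;> simp [hx]
  · intro v
    simp only [β, d]
    rw [dm_new c hk h]
    split_ifs <;> simp

end Seed
end Unf

open Module

namespace Unf
variable {V : Type} {Γ : Type} [Group Γ] [MulAction Γ V] {r : V → V → Prop}
variable {n : ℕ} {p : V → Fin n}

lemma Ctx.mem_orbit (c : Ctx Γ r p) (v w : V) : w ∈ MulAction.orbit Γ v ↔ p w = p v := by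
  rw [eq_comm, c.fib, MulAction.mem_orbit_iff]

namespace Seed
variable {S : Seed Γ r p}

/-- Skew form. -/
noncomputable def om (r : V → V → Prop) : (V →₀ ℤ) →ₗ[ℤ] (V →₀ ℤ) →ₗ[ℤ] ℤ := (E r).flip - E r

lemma om_apply (x y : V →₀ ℤ) : om r x y = E r y x - E r x y := rfl

lemma om_skew (x y : V →₀ ℤ) : om r x y = - om r y x := by
  rw [om_apply, om_apply]
  ring

lemma b_om (v w : V) : S.b v w = om r (S.β v) (S.β w) := rfl

lemma b_skew (v w : V) : S.b v w = - S.b w v := om_skew _ _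

lemma b_label {v w : V} (h : p v = p w) : S.b v w = 0 := by
  by_cases hvw : v = w
  · subst hvw
    have := S.b_skew v v
    omega
  · unfold b β
    rw [h]
    split_ifs <;> simp [E_kk h hvw, E_kk h.symm (Ne.symm hvw)]

lemma cf_b {k : Fin n} (hk : S.s k = true) {v u : V} (hv : p v ≠ k) (hu : p u = k) :
    S.cf k v u = max 0 (S.b v u) := by
  have hne : v ≠ u := fun h => hv (h ▸ hu)
  cases hs : S.s (p v)
  · have h1 : E r (S.d u) (S.d v) = 0 := S.E_pn u v (by rw [hu, hk]) hs
    simp [cf, hu, hs, b, β, hk, h1]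
  · have h1 : E r (S.d v) (S.d u) ≤ 0 := E_nonpos_of (S.hom_same v u hne (by rw [hs, hu, hk]))
    have h2 : E r (S.d u) (S.d v) ≤ 0 := E_nonpos_of (S.hom_same u v hne.symm (by rw [hs, hu, hk]))
    simp only [cf, hu, hs, b, β, hk, if_true]
    rcases le_total (S.pos (p v)) (S.pos (p u)) with h | h
    · have h3 : E r (S.d v) (S.d u) = 0 := S.E_same v u hne (by rw [hs, hu, hk]) h
      rw [h3, max_eq_left (by omega)]
      simp
    · have h3 : E r (S.d u) (S.d v) = 0 := S.E_same u v hne.symm (by rw [hs, hu, hk]) h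
      rw [h3, max_eq_right (by omega)]
      ring

lemma half_formula (a e : ℤ) : (|a| * e + a * |e|) / 2 = max 0 (-e) * a + max 0 a * e := by
  have : |a| * e + a * |e| = 2 * (max 0 (-e) * a + max 0 a * e) := by
    rcases le_total 0 a with ha | ha <;> rcases le_total 0 e with he | he
    · rw [abs_of_nonneg ha, abs_of_nonneg he, max_eq_right ha, max_eq_left (by omega)]; ring
    · rw [abs_of_nonneg ha, abs_of_nonpos he, max_eq_right ha, max_eq_right (by omega)]; ring
    · rw [abs_of_nonpos ha, abs_of_nonneg he, max_eq_left ha, max_eq_left (by omega)]; ring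
    · rw [abs_of_nonpos ha, abs_of_nonpos he, max_eq_left ha, max_eq_right (by omega)]; ring
  rw [this]
  omega

lemma β_k {k : Fin n} (hk : S.s k = true) {u : V} (hu : p u = k) : S.β u = S.d u := by
  simp [β, hu, hk]

lemma mut_b (c : Ctx Γ r p) {i : V} (hk : S.s (p i) = true) {S' : Seed Γ r p}
    (h : ∀ v, S'.β v = S.β' (p i) v) : S'.b = orbMut Γ i S.b := by
  classical
  funext v w
  unfold orbMut
  simp only [c.mem_orbit]
  have key : ∀ v w, p v = p i → p w ≠ p i → S'.b v w = - S.b v w := by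
    intro v w hv hw
    rw [b_om, b_om, h, h]
    simp only [β', hv, hw, if_true, if_false]
    rw [map_neg, LinearMap.neg_apply, map_add]
    have : om r (S.β v) (S.D (p i) w) = 0 := by
      refine map_cmb_zero _ _ _ (cf_fin c _ _) fun u hu => ?_
      rw [← β_k hk (cf_k hu), ← b_om]
      exact b_label (hv.trans (cf_k hu).symm)
    rw [this, add_zero]
  by_cases hv : p v = p i
  · rw [if_pos (Or.inl hv)]
    by_cases hw : p w = p i
    · rw [b_label (hv.trans hw.symm), b_label (hv.trans hw.symm), neg_zero]
    · exact key v w hv hw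
  · by_cases hw : p w = p i
    · rw [if_pos (Or.inr hw), b_skew, key w v hw hv, ← b_skew]
    · rw [if_neg (by tauto)]
      let F : Finset V := (cf_fin (S := S) c (p i) v).toFinset ∪ (cf_fin (S := S) c (p i) w).toFinset
      have hF1 : ∀ u, S.cf (p i) v u ≠ 0 → u ∈ F := fun u hu => by simp [F, hu]
      have hF2 : ∀ u, S.cf (p i) w u ≠ 0 → u ∈ F := fun u hu => by simp [F, hu]
      have hF : ∀ u ∈ F, p u = p i := by
        intro u hu
        simp only [F, Finset.mem_union, Set.Finite.mem_toFinset, Set.mem_ofPred_eq] at hu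
        rcases hu with hu | hu <;> exact cf_k hu
      have hterm : ∀ u, p u = p i → (|S.b v u| * S.b u w + S.b v u * |S.b u w|) / 2 =
          S.cf (p i) w u * S.b v u + S.cf (p i) v u * S.b u w := by
        intro u hu
        rw [half_formula, cf_b hk hv hu, cf_b hk hw hu, b_skew w u]
      have hsum : ∑ᶠ u ∈ MulAction.orbit Γ i, (|S.b v u| * S.b u w + S.b v u * |S.b u w|) / 2 =
          ∑ u ∈ F, (S.cf (p i) w u * S.b v u + S.cf (p i) v u * S.b u w) := by
        rw [finsum_mem_eq_sum_of_inter_support_eq (t := F)]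
        · exact Finset.sum_congr rfl fun u hu => hterm u (hF u hu)
        · ext u
          simp only [Set.mem_inter_iff, Function.mem_support, c.mem_orbit, Finset.mem_coe]
          constructor
          · rintro ⟨hu, hne⟩
            refine ⟨?_, hne⟩
            rw [hterm u hu] at hne
            by_contra hcon
            apply hne
            have e1 : S.cf (p i) v u = 0 := by
              by_contra h0
              exact hcon (hF1 u h0)
            have e2 : S.cf (p i) w u = 0 := by
              by_contra h0
              exact hcon (hF2 u h0)
            rw [e1, e2]
            ring
          · rintro ⟨hu, hne⟩
            exact ⟨hF u hu, hne⟩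
      simp only [c.mem_orbit] at hsum
      rw [hsum, Finset.sum_add_distrib, b_om, h, h]
      simp only [β', hv, hw, if_false]
      have e1 : om r (S.β v) (S.D (p i) w) = ∑ u ∈ F, S.cf (p i) w u * S.b v u := by
        unfold D
        rw [map_cmb (om r (S.β v)) S.d _ F hF2]
        refine Finset.sum_congr rfl fun u hu => ?_
        rw [b_om, β_k hk (hF u hu), smul_eq_mul]
      have e2 : om r (S.D (p i) v) (S.β w) = ∑ u ∈ F, S.cf (p i) v u * S.b u w := by
        unfold D
        have := map_cmb ((om r).flip (S.β w)) S.d (S.cf (p i) v) F hF1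
        rw [LinearMap.flip_apply] at this
        rw [this]
        refine Finset.sum_congr rfl fun u hu => ?_
        rw [b_om, β_k hk (hF u hu), smul_eq_mul, LinearMap.flip_apply]
      have e3 : om r (S.D (p i) v) (S.D (p i) w) = 0 := by
        refine map_cmb_zero (om r (S.D (p i) v)) _ _ (cf_fin c _ _) fun u hu => ?_
        refine map_cmb_zero ((om r).flip (S.d u)) _ _ (cf_fin c _ _) fun u' hu' => ?_
        rw [LinearMap.flip_apply, ← β_k hk (cf_k hu), ← β_k hk (cf_k hu'), ← b_om]
        exact b_label ((cf_k hu').trans (cf_k hu).symm)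
      rw [map_add, map_add, LinearMap.add_apply, LinearMap.add_apply, e1, e2, e3, ← b_om]
      ring

lemma exists_mut_pos (c : Ctx Γ r p) {i : V} (hk : S.s (p i) = true) :
    ∃ S' : Seed Γ r p, S'.b = orbMut Γ i S.b := by
  obtain ⟨S', h⟩ := mut_pos c hk
  exact ⟨S', mut_b c hk h⟩

end Seed
end Unf

open Module

namespace Unf
variable {V : Type} {Γ : Type} [Group Γ] [MulAction Γ V] {r : V → V → Prop}
variable {n : ℕ} {p : V → Fin n}

/-- Opposite arrow relation. -/
abbrev rop (r : V → V → Prop) : V → V → Prop := fun v w => r w v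

/-- Dual representation. -/
noncomputable def QRep.dual (X : QRep V) : QRep V where
  M v := Module.Dual ℚ (X.M v)
  supp := by
    refine X.supp.subset fun v hv => ?_
    simpa [Subspace.dual_finrank_eq] using hv
  map v w := (X.map w v).dualMap

lemma dm_dual (X : QRep V) : dm X.dual = dm X := by
  ext v
  simp only [dm_apply]
  exact_mod_cast Subspace.dual_finrank_eq

/-- Evaluation pairing. -/
def dap {X : QRep V} {v : V} (φ : X.dual.M v) (x : X.M v) : ℚ := (show X.M v →ₗ[ℚ] ℚ from φ) x

/-- Transport of a morphism of duals. -/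
noncomputable def undual {X Y : QRep V} (f : C0 Y.dual X.dual) : C0 X Y := fun v =>
  (evalEquiv ℚ (Y.M v)).symm.toLinearMap ∘ₗ (LinearMap.dualMap (f v)) ∘ₗ Dual.eval ℚ (X.M v)

lemma undual_spec {X Y : QRep V} (f : C0 Y.dual X.dual) (v : V) (x : X.M v)
    (φ : Module.Dual ℚ (Y.M v)) : φ (undual f v x) = dap (f v φ) x := by
  have := Module.apply_evalEquiv_symm_apply (R := ℚ) (M := Y.M v) φ
    (LinearMap.dualMap (f v) (Dual.eval ℚ (X.M v) x))
  exact this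

lemma undual_hom {X Y : QRep V} (f : C0 Y.dual X.dual) (hf : IsHom (rop r) Y.dual X.dual f) :
    IsHom r X Y (undual f) := by
  intro v w hr x
  apply (evalEquiv ℚ (Y.M w)).injective
  ext φ
  have h1 := undual_spec f v x (φ ∘ₗ Y.map v w)
  have h2 := undual_spec f w (X.map v w x) φ
  have h3 := LinearMap.congr_fun (hf w v hr φ) x
  have h4 : φ (Y.map v w (undual f v x)) = φ (undual f w (X.map v w x)) := by
    rw [h2]
    refine h1.trans ?_
    exact h3.symm
  exact h4

lemma Hom0.dual {X Y : QRep V} (h : Hom0 r X Y) : Hom0 (rop r) Y.dual X.dual := by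
  intro f hf
  have := h _ (undual_hom f hf)
  funext v
  refine LinearMap.ext fun φ => LinearMap.ext fun x => ?_
  have h1 := undual_spec f v x φ
  rw [this, Pi.zero_apply, LinearMap.zero_apply] at h1
  rw [map_zero (show Module.Dual ℚ (Y.M v) from φ)] at h1
  exact h1.symm

lemma Brick.dual {X : QRep V} (h : Brick r X) : Brick (rop r) X.dual := by
  intro f hf
  obtain ⟨a, ha⟩ := h _ (undual_hom f hf)
  refine ⟨a, fun v φ => ?_⟩
  refine LinearMap.ext fun x => ?_
  have h1 := undual_spec f v x φ
  rw [ha] at h1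
  rw [map_smul (show Module.Dual ℚ (X.M v) from φ)] at h1
  exact h1.symm

lemma E_op (x y : V →₀ ℤ) : E (rop r) x y = E r y x := by
  classical
  rw [E_sum, E_sum, Finset.sum_comm]
  refine Finset.sum_congr rfl fun v _ => Finset.sum_congr rfl fun w _ => ?_
  by_cases h : v = w
  · subst h
    simp only [rop]
    ring
  · have h' : ¬ w = v := fun hh => h hh.symm
    simp only [h, h', if_false, rop]
    ring

lemma Ctx.op (c : Ctx Γ r p) : Ctx Γ (rop r) p :=
  ⟨fun g v w => c.rinv g w v, c.fib, c.fin, c.fout⟩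

namespace Seed

/-- Dual seed. -/
noncomputable def dual (S : Seed Γ r p) : Seed Γ (rop r) p where
  X v := (S.X v).dual
  s j := !(S.s j)
  pos j := - S.pos j
  brick v := (S.brick v).dual
  hom_same v w hne h := (S.hom_same w v hne.symm (by simpa using h.symm)).dual
  hom_pn v w hv hw := (S.hom_pn w v (by simpa using hw) (by simpa using hv)).dual
  E_pn v w hv hw := by
    rw [E_op, dm_dual, dm_dual]
    exact S.E_pn w v (by simpa using hw) (by simpa using hv)
  E_self v := by
    rw [E_op, dm_dual]
    exact S.E_self v
  E_same v w hne h hp := by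
    rw [E_op, dm_dual, dm_dual]
    exact S.E_same w v hne.symm (by simpa using h.symm) (by omega)
  eqv g v := by
    rw [dm_dual, dm_dual]
    exact S.eqv g v
  lf x := by
    simp only [dm_dual]
    exact S.lf x

lemma dual_β (S : Seed Γ r p) (v : V) : S.dual.β v = - S.β v := by
  unfold β d
  simp only [dual, dm_dual]
  cases S.s (p v) <;> simp

lemma dual_b (S : Seed Γ r p) (v w : V) : S.dual.b v w = - S.b v w := by
  unfold b
  rw [dual_β, dual_β, E_op, E_op (r := r)]
  simp

end Seed

lemma orbMut_neg (i : V) (b : V → V → ℤ) :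
    orbMut Γ i (fun v w => - b v w) = fun v w => - orbMut Γ i b v w := by
  funext v w
  unfold orbMut
  split_ifs
  · rfl
  · rw [neg_add, ← finsum_neg_distrib]
    congr 1
    refine finsum_congr fun u => ?_
    rw [← finsum_neg_distrib]
    refine finsum_congr fun _ => ?_
    rw [Seed.half_formula, Seed.half_formula]
    have h1 : ∀ a : ℤ, max 0 (-a) = max 0 a - a := by
      intro a
      omega
    rw [neg_neg, h1, h1]
    ring

namespace Seed

lemma exists_mut (c : Ctx Γ r p) (S : Seed Γ r p) (i : V) :
    ∃ S' : Seed Γ r p, S'.b = orbMut Γ i S.b := by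
  cases h : S.s (p i)
  · obtain ⟨T, hT⟩ := exists_mut_pos (S := S.dual) c.op (i := i) (by simp [dual, h])
    have hb : S.dual.b = fun v w => - S.b v w := by
      funext v w
      exact S.dual_b v w
    rw [hb, orbMut_neg] at hT
    refine ⟨(T.dual : Seed Γ r p), ?_⟩
    funext v w
    have h1 : (T.dual : Seed Γ r p).b v w = - T.b v w := T.dual_b v w
    rw [h1, hT, neg_neg]
  · exact exists_mut_pos c h

lemma exists_muts (c : Ctx Γ r p) (is : List V) : ∀ S : Seed Γ r p, 
    ∃ S' : Seed Γ r p, S'.b = is.foldl (fun c i => orbMut Γ i c) S.b := by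
  induction is with
  | nil => exact fun S => ⟨S, rfl⟩
  | cons i is ih =>
    intro S
    obtain ⟨T, hT⟩ := exists_mut c S i
    obtain ⟨T', hT'⟩ := ih T
    refine ⟨T', ?_⟩
    rw [hT', hT]
    rfl

variable (S : Seed Γ r p)

lemma b_equivariant (c : Ctx Γ r p) : Equivariant Γ S.b := by
  intro g v w
  unfold b
  rw [← tr_β g c, ← tr_β g c, E_tr c.rinv, E_tr c.rinv]

lemma b_locfin (c : Ctx Γ r p) : LocFin S.b := by
  intro v
  have hlf : ∀ x, {w | True ∧ S.β w x ≠ 0}.Finite := by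
    intro x
    refine (S.lf x).subset fun w hw h0 => hw.2 ?_
    unfold β d
    split_ifs <;> simp [h0]
  refine ((c.fin_left S.β (fun _ => True) hlf (S.β v)).union
    (c.fin_right S.β (fun _ => True) hlf (S.β v))).subset fun w hw => ?_
  by_cases h : E r (S.β w) (S.β v) = 0
  · right
    refine ⟨trivial, fun h' => hw ?_⟩
    unfold b
    rw [h, h', sub_zero]
  · exact Or.inl ⟨trivial, h⟩

lemma b_noLoops (c : Ctx Γ r p) : NoGammaLoops Γ S.b := fun v g => b_label (c.p_smul g v).symm

lemma b_coh_np (c : Ctx Γ r p) (i j : Fin n) (hi : S.s i = true) (hj : S.s j = false) :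
    (∀ v w, p v = i → p w = j → 0 ≤ S.b v w) ∨ (∀ v w, p v = i → p w = j → S.b v w ≤ 0) := by
  have hb : ∀ v w, p v = i → p w = j → S.b v w = - E r (S.d w) (S.d v) := by
    intro v w hv hw
    have : E r (S.d v) (S.d w) = 0 := S.E_pn v w (by rw [hv, hi]) (by rw [hw, hj])
    simp [b, β, hv, hw, hi, hj, this]
  rcases S.dich c j i hj hi with h | h
  · left
    intro v w hv hw
    rw [hb v w hv hw]
    have := E_nonpos_of (h w v hw hv)
    unfold d
    omega
  · right
    intro v w hv hw
    rw [hb v w hv hw]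
    have := E_nonneg_of (h w v hw hv)
    unfold d
    omega

lemma b_coh (c : Ctx Γ r p) (i j : Fin n) (hij : i ≠ j) :
    (∀ v w, p v = i → p w = j → 0 ≤ S.b v w) ∨ (∀ v w, p v = i → p w = j → S.b v w ≤ 0) := by
  by_cases hs : S.s i = S.s j
  · have hb : ∀ v w, p v = i → p w = j → S.b v w = E r (S.d w) (S.d v) - E r (S.d v) (S.d w) := by
      intro v w hv hw
      unfold b β
      rw [hv, hw, hs]
      split_ifs <;> simp
    have hne : ∀ v w, p v = i → p w = j → v ≠ w := by
      rintro v w hv hw rfl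
      exact hij (hv.symm.trans hw)
    have hle1 : ∀ v w, p v = i → p w = j → E r (S.d v) (S.d w) ≤ 0 := fun v w hv hw =>
      E_nonpos_of (S.hom_same v w (hne v w hv hw) (by rw [hv, hw, hs]))
    have hle2 : ∀ v w, p v = i → p w = j → E r (S.d w) (S.d v) ≤ 0 := fun v w hv hw =>
      E_nonpos_of (S.hom_same w v (hne v w hv hw).symm (by rw [hv, hw, hs]))
    rcases le_total (S.pos i) (S.pos j) with h | h
    · right
      intro v w hv hw
      have h0 : E r (S.d v) (S.d w) = 0 :=
        S.E_same v w (hne v w hv hw) (by rw [hv, hw, hs]) (by rw [hv, hw]; exact h)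
      rw [hb v w hv hw, h0, sub_zero]
      exact hle2 v w hv hw
    · left
      intro v w hv hw
      have h0 : E r (S.d w) (S.d v) = 0 :=
        S.E_same w v (hne v w hv hw).symm (by rw [hv, hw, hs]) (by rw [hv, hw]; exact h)
      rw [hb v w hv hw, h0, zero_sub]
      have := hle1 v w hv hw
      omega
  · cases hi : S.s i
    · have hj : S.s j = true := by
        cases hj : S.s j
        · rw [hi, hj] at hs
          exact absurd rfl hs
        · rfl
      rcases S.b_coh_np c j i hj hi with h | h
      · right
        intro v w hv hw
        have := h w v hw hv
        rw [b_skew]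
        omega
      · left
        intro v w hv hw
        have := h w v hw hv
        rw [b_skew]
        omega
    · have hj : S.s j = false := by
        cases hj : S.s j
        · rfl
        · rw [hi, hj] at hs
          exact absurd rfl hs
      exact S.b_coh_np c i j hi hj

lemma b_no2Cycles (c : Ctx Γ r p) : NoGamma2Cycles Γ S.b := by
  rintro ⟨v, w, g, hw, h1, h2⟩
  rw [c.mem_orbit] at hw
  rw [b_skew] at h2
  rcases S.b_coh c (p v) (p w) (fun h => hw h.symm) with h | h
  · have := h (g • v) w (c.p_smul g v) rfl
    omega
  · have := h v w rfl rfl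
    omega

end Seed
end Unf

open Module

namespace Unf
variable {V : Type} {Γ : Type} [Group Γ] [MulAction Γ V] {r : V → V → Prop}
variable {n : ℕ} {p : V → Fin n}

lemma simple_rank (v w : V) : finrank ℚ (PLift (w = v) → ℚ) = Finsupp.single v 1 w := by
  classical
  by_cases h : v = w
  · subst h
    have : Fintype (PLift (v = v)) := ⟨{⟨rfl⟩}, fun ⟨_⟩ => by simp⟩
    have : Unique (PLift (v = v)) := ⟨⟨⟨rfl⟩⟩, fun ⟨_⟩ => rfl⟩
    simp
  · have : IsEmpty (PLift (w = v)) := ⟨fun x => h x.down.symm⟩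
    simp [Finsupp.single_apply, h]

lemma plift_finite (q : Prop) : Finite (PLift q) := inferInstance

/-- Simple representation. -/
noncomputable def simple (v : V) : QRep V where
  M w := PLift (w = v) → ℚ
  supp := by
    refine (Set.finite_singleton v).subset fun w hw => ?_
    by_contra h
    apply hw
    rw [simple_rank]
    simp only [Set.mem_singleton_iff] at h
    simp [Finsupp.single_apply, Ne.symm h]
  map _ _ := 0

lemma dm_simple (v : V) : dm (simple v) = Finsupp.single v 1 := by
  classical
  ext w
  rw [dm_apply]
  have := simple_rank v w
  have h2 : finrank ℚ ((simple v).M w) = Finsupp.single v 1 w := this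
  rw [h2]
  simp only [Finsupp.single_apply]
  split_ifs <;> simp

lemma simple_sub {v w : V} (h : w ≠ v) : Subsingleton ((simple v).M w) := by
  have : IsEmpty (PLift (w = v)) := ⟨fun x => h x.down⟩
  exact inferInstanceAs (Subsingleton (PLift (w = v) → ℚ))

lemma simple_brick (v : V) : Brick r (simple v) := by
  intro f _
  let one : PLift (v = v) → ℚ := fun _ => 1
  let y : PLift (v = v) → ℚ := f v one
  refine ⟨y ⟨rfl⟩, fun w x => ?_⟩
  by_cases h : w = v
  · subst h
    let x' : PLift (w = w) → ℚ := x
    have hx : x' = x' ⟨rfl⟩ • one := by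
      funext ⟨_⟩
      simp [one]
    have h1 : f w x' = x' ⟨rfl⟩ • f w one := by
      have := congrArg (f w) hx
      rw [this]
      exact map_smul (f w) _ _
    have h2 : (f w one : PLift (w = w) → ℚ) = y := rfl
    refine h1.trans ?_
    show x' ⟨rfl⟩ • y = y ⟨rfl⟩ • x'
    funext ⟨_⟩
    simp [mul_comm]
  · have := simple_sub h
    exact Subsingleton.elim _ _

lemma simple_hom {v w : V} (h : v ≠ w) : Hom0 r (simple v) (simple w) := by
  intro f _
  funext x
  refine LinearMap.ext fun y => ?_
  by_cases hx : x = v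
  · have := simple_sub (v := w) (w := x) (fun hh => h (hx.symm.trans hh))
    exact Subsingleton.elim _ _
  · have := simple_sub hx
    rw [Subsingleton.elim y 0, map_zero, map_zero]

/-- Initial seed. -/
noncomputable def initSeed (pos : Fin n → ℤ) (hpos : ∀ v w, r v w → pos (p w) < pos (p v)) :
    Seed Γ r p where
  X := simple
  s _ := true
  pos := pos
  brick v := simple_brick v
  hom_same v w h _ := simple_hom h
  hom_pn v w _ h := by simp at h
  E_pn v w _ h := by simp at h
  E_self v := by
    rw [dm_simple, E_single, if_pos rfl, if_neg, sub_zero]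
    intro h
    exact lt_irrefl _ (hpos v v h)
  E_same v w h _ hp := by
    rw [dm_simple, dm_simple, E_single, if_neg h, if_neg, sub_zero]
    intro h
    exact absurd (hpos v w h) (not_lt.mpr hp)
  eqv g v := by
    rw [dm_simple, dm_simple]
    simp [tr, Finsupp.lmapDomain_apply, Finsupp.mapDomain_single]
  lf x := by
    classical
    refine (Set.finite_singleton x).subset fun v hv => ?_
    simp only [dm_simple, Set.mem_ofPred_eq, Finsupp.single_apply] at hv
    by_contra h
    simp only [Set.mem_singleton_iff] at h
    simp [h] at hv

open Classical in
lemma initSeed_b (pos : Fin n → ℤ) (hpos : ∀ v w, r v w → pos (p w) < pos (p v)) (v w : V) :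
    (initSeed pos hpos : Seed Γ r p).b v w =
      (if r v w then 1 else 0) - (if r w v then 1 else 0 : ℤ) := by
  have h : ∀ v, (initSeed pos hpos : Seed Γ r p).β v = Finsupp.single v 1 := by
    intro v
    simp [Seed.β, Seed.d, initSeed, dm_simple]
  unfold Seed.b
  rw [h, h, E_single, E_single]
  by_cases hvw : v = w
  · subst hvw
    simp
  · have : ¬ w = v := fun hh => hvw hh.symm
    simp [hvw, this]
    ring

end Unf


namespace Unf

/-- Tree-like set with a shift map all of whose fibres are indexed by `ZMod m`. -/
abbrev U (m : ℕ) := ℤ × (ℕ → ZMod m)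

def sh {m : ℕ} (u : U m) : U m := (u.1 - 1, fun t => u.2 (t + 1))

def ish {m : ℕ} (a : ZMod m) (u : U m) : U m := (u.1 + 1, fun t => Nat.casesOn t a u.2)

lemma sh_ish {m : ℕ} (a : ZMod m) (u : U m) : sh (ish a u) = u := by
  ext <;> simp [sh, ish]

lemma ish_sh {m : ℕ} (u : U m) : ish (u.2 0) (sh u) = u := by
  refine Prod.ext ?_ ?_
  · simp [sh, ish]
  · funext t
    cases t <;> simp [sh, ish]

lemma ish_inj {m : ℕ} (a a' : ZMod m) (u : U m) (h : ish a u = ish a' u) : a = a' :=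
  congrFun (congrArg Prod.snd h) 0

lemma exists_aut {m : ℕ} (u u' : U m) : ∃ α : Equiv.Perm (U m), (∀ x, sh (α x) = α (sh x)) ∧
    α u = u' := by
  let c : ℤ → ZMod m := fun z => u'.2 (u.1 - z).toNat - u.2 (u.1 - z).toNat
  let dd : ℤ := u'.1 - u.1
  refine ⟨⟨fun x => (x.1 + dd, fun t => x.2 t + c (x.1 - t)),
    fun x => (x.1 - dd, fun t => x.2 t - c (x.1 - dd - t)), ?_, ?_⟩, ?_, ?_⟩
  · intro x
    ext <;> simp
  · intro x
    ext <;> simp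
  · intro x
    refine Prod.ext ?_ ?_
    · simp [sh]
      ring
    · funext t
      simp only [sh, Equiv.coe_fn_mk]
      congr 2
      push_cast
      ring
  · refine Prod.ext ?_ ?_
    · simp [dd]
    · funext t
      simp [c]

section
variable {n : ℕ} (B : Matrix (Fin n) (Fin n) ℤ)

abbrev mm (e : Fin n × Fin n) : ℕ := (B e.1 e.2).natAbs

/-- Vertices of the cover. -/
abbrev VV := Fin n × (∀ e : Fin n × Fin n, U (mm B e))

/-- Adjacency. -/
def adj (v w : VV B) : Prop :=
  w.2 (v.1, w.1) = sh (v.2 (v.1, w.1)) ∧ v.2 (w.1, v.1) = sh (w.2 (w.1, v.1)) ∧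
    ∀ e, e ≠ (v.1, w.1) → e ≠ (w.1, v.1) → v.2 e = w.2 e

lemma adj_symm {v w : VV B} (h : adj B v w) : adj B w v :=
  ⟨h.2.1, h.1, fun e h1 h2 => (h.2.2 e h2 h1).symm⟩

def rr (v w : VV B) : Prop := 0 < B v.1 w.1 ∧ adj B v w

/-- Neighbours of `w` with label `i`. -/
def nb (i : Fin n) (w : VV B) (a : ZMod (mm B (i, w.1))) : VV B :=
  (i, Function.update (Function.update w.2 (i, w.1) (ish a (w.2 (i, w.1)))) (w.1, i)
    (sh (w.2 (w.1, i))))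

variable {B}

lemma nb_adj {i : Fin n} {w : VV B} (hi : i ≠ w.1) (a : ZMod (mm B (i, w.1))) :
    adj B (nb B i w a) w := by
  have h1 : ((i, w.1) : Fin n × Fin n) ≠ (w.1, i) := fun h => hi (congrArg Prod.fst h)
  refine ⟨?_, ?_, ?_⟩
  · simp only [nb]
    rw [Function.update_of_ne h1, Function.update_self, sh_ish]
  · simp only [nb]
    rw [Function.update_self]
  · intro e he he'
    simp only [nb] at he he' ⊢
    rw [Function.update_of_ne he', Function.update_of_ne he]

lemma nb_inj {i : Fin n} {w : VV B} (hi : i ≠ w.1) : Function.Injective (nb B i w) := by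
  intro a a' h
  have h1 : ((i, w.1) : Fin n × Fin n) ≠ (w.1, i) := fun h => hi (congrArg Prod.fst h)
  have h2 := congrFun (congrArg Prod.snd h) (i, w.1)
  simp only [nb] at h2
  rw [Function.update_of_ne h1, Function.update_self, Function.update_of_ne h1,
    Function.update_self] at h2
  exact ish_inj _ _ _ h2

lemma adj_nb {v w : VV B} (hi : v.1 ≠ w.1) (h : adj B v w) :
    ∃ a, nb B v.1 w a = v := by
  have h1 : ((v.1, w.1) : Fin n × Fin n) ≠ (w.1, v.1) := fun h' => hi (Prod.mk.inj h').1
  obtain ⟨a1, a2, a3⟩ := h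
  refine ⟨(v.2 (v.1, w.1)).2 0, Prod.ext rfl ?_⟩
  funext e
  simp only [nb]
  by_cases he : e = (w.1, v.1)
  · subst he
    rw [Function.update_self, a2]
  · rw [Function.update_of_ne he]
    by_cases he' : e = (v.1, w.1)
    · subst he'
      rw [Function.update_self, a1, ish_sh]
    · rw [Function.update_of_ne he', a3 e he' he]

lemma sss_diag (h : SignSkewSymm B) (i : Fin n) : B i i = 0 := by
  rcases h i i with h | h
  · exact h.1
  · exact absurd h (not_lt.mpr (mul_self_nonneg _))

lemma sss_neg (h : SignSkewSymm B) {i j : Fin n} (hp : 0 < B i j) : B j i < 0 := by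
  rcases h i j with h | h
  · omega
  · by_contra hc
    push Not at hc
    exact absurd h (not_lt.mpr (mul_nonneg hp.le hc))

lemma sss_pos (h : SignSkewSymm B) {i j : Fin n} (hp : B i j < 0) : 0 < B j i := by
  rcases h i j with h | h
  · omega
  · by_contra hc
    push Not at hc
    exact absurd h (not_lt.mpr (mul_nonneg_of_nonpos_of_nonpos hp.le hc))

lemma adj_finite (h : SignSkewSymm B) (w : VV B) : {v | B v.1 w.1 ≠ 0 ∧ adj B v w}.Finite := by
  have : ∀ i : Fin n, {v | v.1 = i ∧ B v.1 w.1 ≠ 0 ∧ adj B v w}.Finite := by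
    intro i
    by_cases hB : B i w.1 = 0
    · convert Set.finite_empty
      ext v
      simp only [Set.mem_ofPred_eq, Set.mem_empty_iff_false, iff_false]
      rintro ⟨rfl, h1, -⟩
      exact h1 hB
    · have : NeZero (mm B (i, w.1)) := ⟨by simpa [mm] using hB⟩
      have hf : Finite (ZMod (mm B (i, w.1))) := inferInstance
      refine (Set.finite_range (nb B i w)).subset ?_
      rintro v ⟨rfl, h1, h2⟩
      refine adj_nb (fun hh => h1 ?_) h2
      rw [hh]
      exact sss_diag h _
  refine (Set.finite_iUnion this).subset fun v hv => ?_
  simp only [Set.mem_iUnion]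
  exact ⟨v.1, rfl, hv⟩

/-- The quiver. -/
noncomputable def bb (B : Matrix (Fin n) (Fin n) ℤ) (v w : VV B) : ℤ := by
  classical
  exact (if rr B v w then 1 else 0) - (if rr B w v then 1 else 0 : ℤ)

lemma bb_ne (hs : SignSkewSymm B) {v w : VV B} (h : bb B v w ≠ 0) : adj B v w ∧ B v.1 w.1 ≠ 0 := by
  classical
  by_cases h1 : rr B v w
  · exact ⟨h1.2, h1.1.ne'⟩
  · by_cases h2 : rr B w v
    · exact ⟨adj_symm B h2.2, (sss_neg hs h2.1).ne⟩
    · exact absurd (by simp [bb, h1, h2]) h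

lemma bb_sign (hs : SignSkewSymm B) {v w : VV B} (h : adj B v w) :
    bb B v w = (B v.1 w.1).sign := by
  classical
  rcases lt_trichotomy (B v.1 w.1) 0 with h0 | h0 | h0
  · have h1 := sss_pos hs h0
    have h2 : rr B w v := ⟨h1, adj_symm B h⟩
    have h3 : ¬ rr B v w := fun hh => absurd hh.1 (by omega)
    simp [bb, h2, h3, Int.sign_eq_neg_one_of_neg h0]
  · have h1 : ¬ rr B v w := fun hh => absurd hh.1 (by omega)
    have h2 : ¬ rr B w v := fun hh => by
      have := sss_neg hs hh.1
      omega
    simp [bb, h1, h2, h0]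
  · have h1 := sss_neg hs h0
    have h2 : rr B v w := ⟨h0, h⟩
    have h3 : ¬ rr B w v := fun hh => absurd hh.1 (by omega)
    simp [bb, h2, h3, Int.sign_eq_one_of_pos h0]

lemma bb_covering (hs : SignSkewSymm B) : IsCovering (bb B) Prod.fst B := by
  intro i w
  by_cases hB : B i w.1 = 0
  · rw [hB]
    refine finsum_mem_eq_zero_of_forall_eq_zero ?_
    intro v hv
    by_contra h
    have h1 : v.1 = i := hv
    exact (bb_ne hs h).2 (h1 ▸ hB)
  · have hne : NeZero (mm B (i, w.1)) := ⟨by simpa [mm] using hB⟩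
    have hi : i ≠ w.1 := by
      intro hh
      apply hB
      rw [hh]
      exact sss_diag hs _
    rw [finsum_mem_inter_support_eq' _ _ (Set.range (nb B i w)), finsum_mem_range (nb_inj hi)]
    · have : ∀ a, bb B (nb B i w a) w = (B i w.1).sign := fun a => bb_sign hs (nb_adj hi a)
      simp only [this]
      rw [finsum_eq_sum_of_fintype, Finset.sum_const, Finset.card_univ, ZMod.card]
      simp only [nsmul_eq_mul, mm]
      rw [mul_comm]
      exact Int.sign_mul_natAbs _
    · intro v hv
      constructor
      · intro h1
        have h1 : v.1 = i := h1
        subst h1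
        exact adj_nb hi (bb_ne hs hv).1
      · rintro ⟨a, rfl⟩
        rfl

/-- Automorphism group of the cover. -/
def GG (B : Matrix (Fin n) (Fin n) ℤ) : Subgroup (Equiv.Perm (VV B)) where
  carrier := {g | (∀ v, (g v).1 = v.1) ∧ ∀ v w, rr B (g v) (g w) ↔ rr B v w}
  mul_mem' := by
    rintro a b ⟨a1, a2⟩ ⟨b1, b2⟩
    exact ⟨fun v => (a1 _).trans (b1 v), fun v w => (a2 _ _).trans (b2 v w)⟩
  one_mem' := ⟨fun _ => rfl, fun _ _ => Iff.rfl⟩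
  inv_mem' := by
    rintro a ⟨a1, a2⟩
    refine ⟨fun v => ?_, fun v w => ?_⟩
    · have := a1 (a⁻¹ v)
      rw [show a (a⁻¹ v) = v from a.apply_symm_apply v] at this
      exact this.symm
    · have := a2 (a⁻¹ v) (a⁻¹ w)
      rw [show a (a⁻¹ v) = v from a.apply_symm_apply v,
        show a (a⁻¹ w) = w from a.apply_symm_apply w] at this
      exact this.symm

lemma GG_trans {v w : VV B} (h : v.1 = w.1) : ∃ g : GG B, g • v = w := by
  choose α hα hα' using fun e => exists_aut (v.2 e) (w.2 e)
  let g : Equiv.Perm (VV B) := ⟨fun x => (x.1, fun e => α e (x.2 e)),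
    fun x => (x.1, fun e => (α e).symm (x.2 e)), fun x => by simp, fun x => by simp⟩
  have hg : g ∈ GG B := by
    refine ⟨fun _ => rfl, fun x y => ?_⟩
    simp only [rr, adj, g, Equiv.coe_fn_mk, hα, EmbeddingLike.apply_eq_iff_eq]
  refine ⟨⟨g, hg⟩, ?_⟩
  refine Prod.ext h ?_
  funext e
  exact hα' e

lemma cover_ctx (hs : SignSkewSymm B) : Ctx (GG B) (rr B) (Prod.fst : VV B → Fin n) where
  rinv g v w := g.2.2 v w
  fib v w := by
    constructor
    · exact GG_trans
    · rintro ⟨g, rfl⟩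
      exact (g.2.1 v).symm
  fout v := (adj_finite hs v).subset fun w hw => ⟨(sss_neg hs hw.1).ne, adj_symm B hw.2⟩
  fin w := (adj_finite hs w).subset fun v hv => ⟨hv.1.ne', hv.2⟩

lemma exists_topo (hac : MatAcyclic B) : ∃ pos : Fin n → ℤ, ∀ i j, 0 < B i j → pos j < pos i := by
  classical
  refine ⟨fun i => (Finset.univ.filter fun j => Relation.TransGen (fun i j => 0 < B i j) i j).card,
    fun i j hij => ?_⟩
  simp only [Nat.cast_lt]
  apply Finset.card_lt_card
  rw [Finset.ssubset_iff_of_subset]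
  · exact ⟨j, Finset.mem_filter.2 ⟨Finset.mem_univ _, Relation.TransGen.single hij⟩, by simpa using hac j⟩
  · intro l hl
    simp only [Finset.mem_filter, Finset.mem_univ, true_and] at hl ⊢
    exact Relation.TransGen.head hij hl
end

end Unf

theorem acyclic_sign_skew_symmetric_has_unfolding {n : ℕ} (hn : 0 < n)
    (B : Matrix (Fin n) (Fin n) ℤ) (hsss : SignSkewSymm B) (hac : MatAcyclic B) :
    Nonempty (UnfoldingData n B) := by
  classical
  obtain ⟨pos, hpos⟩ := Unf.exists_topo hac
  have c := Unf.cover_ctx hsss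
  have hpos' : ∀ v w : Unf.VV B, Unf.rr B v w → pos w.1 < pos v.1 := fun v w h => hpos _ _ h.1
  let S : Unf.Seed (Unf.GG B) (Unf.rr B) (Prod.fst : Unf.VV B → Fin n) := Unf.initSeed pos hpos'
  have hb : S.b = Unf.bb B := by
    funext v w
    rw [Unf.initSeed_b]
    rfl
  have hm := fun is => Unf.Seed.exists_muts c is S
  rw [hb] at hm
  refine ⟨{
    V := Unf.VV B
    Γ := Unf.GG B
    b := Unf.bb B
    p := Prod.fst
    surj := fun i => ⟨(i, fun _ => (0, fun _ => 0)), rfl⟩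
    fibers_eq_orbits := fun v w => by rw [c.mem_orbit, eq_comm]
    skew := hb ▸ fun v w => S.b_skew v w
    equivariant := hb ▸ S.b_equivariant c
    locfin := hb ▸ S.b_locfin c
    covering := Unf.bb_covering hsss
    mut_skew := ?_
    mut_equivariant := ?_
    mut_locfin := ?_
    mut_noLoops := ?_
    mut_no2Cycles := ?_ }⟩
  all_goals
    intro is
    obtain ⟨T, hT⟩ := hm is
    rw [← hT]
  · exact fun v w => T.b_skew v w
  · exact T.b_equivariant c
  · exact T.b_locfin c
  · exact T.b_noLoops c
  · exact T.b_no2Cycles c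
end

section
/- Let Γ act on a locally finite quiver b : V → V → ℤ (skew-symmetric and Γ-equivariant) with no Γ-loops and no Γ-2-cycles, and suppose (V, b, Γ) is a covering of the n×n integer matrix B via p : V → Fin n. Fix a vertex i ∈ V and let b' = μ̃_{[i]}(b) be the orbit mutation at the orbit of i. If b' has no Γ-2-cycles, then (V, b', Γ) is a covering of the mutated matrix μ_{p(i)}(B) via p; that is, for every j : Fin n and w : V one has ∑_{v ∈ p⁻¹(j)} b' v w = (μ_{p(i)}(B)) j (p w), the quiver b' has no Γ-loops, and the matrix μ_{p(i)}(B) is sign-skew-symmetric. -/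
/-- Matrix mutation in direction `k`. -/
def matMut {n : ℕ} (k : Fin n) (B : Matrix (Fin n) (Fin n) ℤ) : Matrix (Fin n) (Fin n) ℤ :=
  fun i j =>
    if i = k ∨ j = k then - B i j
    else B i j + (|B i k| * B k j + B i k * |B k j|) / 2

lemma half_formula (a c : ℤ) :
    (|a| * c + a * |c|) / 2 = max a 0 * max c 0 - max (-a) 0 * max (-c) 0 := by
  apply Int.ediv_eq_of_eq_mul_right (by norm_num)
  rcases le_total 0 a with ha | ha <;> rcases le_total 0 c with hc | hc <;>
    simp [abs_of_nonneg, abs_of_nonpos, ha, hc] <;> ring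

lemma sum_pos_part {α : Type} (s : Finset α) (f : α → ℤ)
    (h : (∀ x ∈ s, 0 ≤ f x) ∨ (∀ x ∈ s, f x ≤ 0)) :
    ∑ x ∈ s, max (f x) 0 = max (∑ x ∈ s, f x) 0 := by
  rcases h with h | h
  · rw [max_eq_left (Finset.sum_nonneg h)]
    exact Finset.sum_congr rfl fun x hx => max_eq_left (h x hx)
  · rw [max_eq_right (Finset.sum_nonpos h)]
    exact Finset.sum_eq_zero fun x hx => max_eq_right (h x hx)

lemma sum_neg_part {α : Type} (s : Finset α) (f : α → ℤ)
    (h : (∀ x ∈ s, 0 ≤ f x) ∨ (∀ x ∈ s, f x ≤ 0)) :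
    ∑ x ∈ s, max (-f x) 0 = max (-∑ x ∈ s, f x) 0 := by
  rw [← Finset.sum_neg_distrib]
  apply sum_pos_part s (fun x => - f x)
  rcases h with h | h
  · right; intro x hx; have := h x hx; omega
  · left; intro x hx; have := h x hx; omega

open Classical in
lemma fsum_eq {V : Type} (S : Set V) (f : V → ℤ) (U : Finset V)
    (h : ∀ v, f v ≠ 0 → v ∈ U) :
    ∑ᶠ v ∈ S, f v = ∑ v ∈ U with v ∈ S, f v := by
  apply finsum_mem_eq_sum_of_subset
  · rintro v ⟨h1, h2⟩
    simp [h1, h v h2]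
  · intro v hv
    simp at hv
    exact hv.2

lemma sign_coh {V Γ : Type} [Group Γ] [MulAction Γ V]
    {b : V → V → ℤ} (hskew : SkewSymm b)
    (hnl : NoGammaLoops Γ b) (hn2 : NoGamma2Cycles Γ b) {v v' w : V}
    (hv : v' ∈ MulAction.orbit Γ v) (h : 0 < b v w) : 0 ≤ b v' w := by
  obtain ⟨g, rfl⟩ := hv
  by_contra hc
  simp only [not_le] at hc
  apply hn2
  refine ⟨v, w, g, ?_, h, ?_⟩
  · rintro ⟨g', rfl⟩
    have := hnl v g'
    simp only at h
    omega
  · have := hskew w (g • v)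
    omega

lemma sign_coh' {V Γ : Type} {n : ℕ} [Group Γ] [MulAction Γ V]
    {b : V → V → ℤ} (hskew : SkewSymm b)
    (hnl : NoGammaLoops Γ b) (hn2 : NoGamma2Cycles Γ b) {p : V → Fin n}
    (hfib : ∀ v w : V, p v = p w ↔ w ∈ MulAction.orbit Γ v) (w : V) (j : Fin n) (s : Finset V)
    (hs : ∀ v ∈ s, p v = j) : (∀ v ∈ s, 0 ≤ b v w) ∨ (∀ v ∈ s, b v w ≤ 0) := by
  by_contra! h
  obtain ⟨⟨x, hx, hx'⟩, y, hy, hy'⟩ := h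
  have := sign_coh hskew hnl hn2 ((hfib y x).1 (by rw [hs x hx, hs y hy])) hy'
  omega

open Classical in
lemma signSkew_of_covering {V Γ : Type} {n : ℕ} [Group Γ] [MulAction Γ V]
    {b : V → V → ℤ} (hskew : SkewSymm b) (hloc : LocFin b)
    (hnl : NoGammaLoops Γ b) (hn2 : NoGamma2Cycles Γ b)
    {B : Matrix (Fin n) (Fin n) ℤ} {p : V → Fin n}
    (hsurj : Function.Surjective p)
    (hfib : ∀ v w : V, p v = p w ↔ w ∈ MulAction.orbit Γ v)
    (hcov : IsCovering b p B) : SignSkewSymm B := by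
  have hsum : ∀ i w, B i (p w) = ∑ v ∈ (hloc w).toFinset with v ∈ p ⁻¹' {i}, b v w := by
    intro i w
    rw [← hcov i w]
    apply fsum_eq
    intro v hv
    have := hskew v w
    simp
    omega
  have hco := fun i w => sign_coh' hskew hnl hn2 hfib w i
    {v ∈ (hloc w).toFinset | v ∈ p ⁻¹' {i}} (by intro v hv; simp at hv; exact hv.2)
  -- an entry of a given sign has the sign of the matrix entry
  have hpos : ∀ v w, 0 < b v w → 0 < B (p v) (p w) := by
    intro v w h
    have hm : v ∈ {v' ∈ (hloc w).toFinset | v' ∈ p ⁻¹' {p v}} := by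
      have := hskew v w
      simp
      omega
    rw [hsum]
    rcases hco (p v) w with h1 | h1
    · exact Finset.sum_pos' h1 ⟨v, hm, h⟩
    · have := h1 v hm
      omega
  have hneg : ∀ v w, b v w < 0 → B (p v) (p w) < 0 := by
    intro v w h
    have hm : v ∈ {v' ∈ (hloc w).toFinset | v' ∈ p ⁻¹' {p v}} := by
      have := hskew v w
      simp
      omega
    rw [hsum]
    rcases hco (p v) w with h1 | h1
    · have := h1 v hm
      omega
    · exact Finset.sum_neg' h1 ⟨v, hm, h⟩
  have key : ∀ i j, B i j ≠ 0 → B i j * B j i < 0 := by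
    intro i j h
    obtain ⟨w, rfl⟩ := hsurj j
    rw [hsum] at h
    obtain ⟨v, hv, hne⟩ := Finset.exists_ne_zero_of_sum_ne_zero h
    simp at hv
    obtain ⟨_, rfl⟩ := hv
    have h0 := hskew v w
    rcases lt_or_gt_of_ne hne with h | h
    · exact mul_neg_of_neg_of_pos (hneg v w h) (hpos w v (by omega))
    · exact mul_neg_of_pos_of_neg (hpos v w h) (hneg w v (by omega))
  intro i j
  by_cases h1 : B i j = 0
  · by_cases h2 : B j i = 0
    · exact Or.inl ⟨h1, h2⟩
    · have := key j i h2
      simp [h1] at this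
  · exact Or.inr (key i j h1)

/-- If `(V, b, Γ)` is a covering of `B` via `p` and the orbit mutation of `b` at the orbit of
`i` has no `Γ`-2-cycles, then the mutated quiver together with `Γ` is a covering of the
mutated matrix `μ_{p i}(B)` via `p`, it has no `Γ`-loops, and `μ_{p i}(B)` is
sign-skew-symmetric. -/
theorem covering_preserved_by_orbit_mutation {n : ℕ} {V Γ : Type} [Group Γ] [MulAction Γ V]
    (b : V → V → ℤ) (hskew : SkewSymm b) (hequiv : Equivariant Γ b) (hloc : LocFin b)
    (hnl : NoGammaLoops Γ b) (hn2 : NoGamma2Cycles Γ b)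
    (B : Matrix (Fin n) (Fin n) ℤ) (p : V → Fin n)
    (hsurj : Function.Surjective p)
    (hfib : ∀ v w : V, p v = p w ↔ w ∈ MulAction.orbit Γ v)
    (hcov : IsCovering b p B)
    (i : V) (hn2' : NoGamma2Cycles Γ (orbMut Γ i b)) :
    IsCovering (orbMut Γ i b) p (matMut (p i) B) ∧
      NoGammaLoops Γ (orbMut Γ i b) ∧
      SignSkewSymm (matMut (p i) B) := by
  classical
  have horb : ∀ v, v ∈ MulAction.orbit Γ i ↔ p v = p i := by
    intro v
    rw [← hfib i v, eq_comm]
  have hskew' : SkewSymm (orbMut Γ i b) := by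
    intro v w
    unfold orbMut
    by_cases h : v ∈ MulAction.orbit Γ i ∨ w ∈ MulAction.orbit Γ i
    · rw [if_pos h, if_pos h.symm, hskew v w]
    · rw [if_neg h, if_neg (fun h' => h h'.symm), hskew v w, neg_add]
      simp only [← finsum_neg_distrib]
      congr 1
      apply finsum_mem_congr rfl
      intro x _
      rw [half_formula, half_formula, hskew v x, hskew x w]
      simp only [neg_neg]
      ring
  -- finite sets of neighbours
  let T : V → Finset V := fun w => (hloc w).toFinset
  have hT : ∀ v w, b v w ≠ 0 → v ∈ T w := by
    intro v w h
    have := hskew v w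
    simp [T]
    omega
  have hmut : ∀ v w, ¬ (p v = p i ∨ p w = p i) → orbMut Γ i b v w =
      b v w + ∑ x ∈ T w with x ∈ MulAction.orbit Γ i,
        (max (b v x) 0 * max (b x w) 0 - max (-b v x) 0 * max (-b x w) 0) := by
    intro v w h
    unfold orbMut
    rw [horb, horb, if_neg h]
    simp only [half_formula]
    rw [fsum_eq _ _ (T w)]
    intro x hx
    apply hT
    intro h0
    simp [h0] at hx
  let U : V → Finset V := fun w => T w ∪ (T w).biUnion T
  have hU : ∀ v w, orbMut Γ i b v w ≠ 0 → v ∈ U w := by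
    intro v w h
    by_contra hv
    simp only [U, Finset.mem_union, Finset.mem_biUnion, not_or, not_exists, not_and] at hv
    have h0 : b v w = 0 := by
      by_contra hc
      exact hv.1 (hT _ _ hc)
    apply h
    by_cases hc : p v = p i ∨ p w = p i
    · unfold orbMut
      rw [horb, horb, if_pos hc, h0, neg_zero]
    · rw [hmut v w hc, h0, zero_add]
      apply Finset.sum_eq_zero
      intro x hx
      have hx0 : b v x = 0 := by
        by_contra hcc
        exact hv.2 x (Finset.mem_filter.1 hx).1 (hT _ _ hcc)
      simp [hx0]
  have hloc' : LocFin (orbMut Γ i b) := by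
    intro w
    apply (U w).finite_toSet.subset
    intro v hv
    apply hU
    have := hskew' v w
    simp only [Set.mem_ofPred_eq] at hv
    omega
  have hnl' : NoGammaLoops Γ (orbMut Γ i b) := by
    intro v g
    have hpg : p (g • v) = p v := ((hfib v (g • v)).2 ⟨g, rfl⟩).symm
    by_cases hc : p v = p i ∨ p (g • v) = p i
    · unfold orbMut
      rw [horb, horb, if_pos hc, hnl, neg_zero]
    · rw [hmut _ _ hc, hnl, zero_add]
      apply Finset.sum_eq_zero
      intro x _
      have h1 := hskew x (g • v)
      have h2 := sign_coh' hskew hnl hn2 hfib x (p v) {v, g • v} (by simp [hpg])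
      simp only [Finset.mem_insert, Finset.mem_singleton, forall_eq_or_imp, forall_eq] at h2
      rw [h1]
      rcases h2 with ⟨h2, h3⟩ | ⟨h2, h3⟩ <;> simp [h2, h3]
  have hcov' : IsCovering (orbMut Γ i b) p (matMut (p i) B) := by
    intro j w
    -- the original covering as finite sums
    have hB : ∀ (W : Finset V) (j : Fin n) (x : V), T x ⊆ W →
        ∑ v ∈ W with v ∈ p ⁻¹' {j}, b v x = B j (p x) := by
      intro W j x hW
      rw [← hcov j x]
      exact (fsum_eq _ _ W fun v hv => hW (hT v x hv)).symm
    have hco := fun (W : Finset V) j x => sign_coh' hskew hnl hn2 hfib x j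
      {v ∈ W | v ∈ p ⁻¹' {j}} (by intro v hv; simp at hv; exact hv.2)
    rw [fsum_eq _ _ (U w) (fun v hv => hU v w hv)]
    have hTU : T w ⊆ U w := Finset.subset_union_left
    unfold matMut
    by_cases hc : j = p i ∨ p w = p i
    · rw [if_pos hc, ← hB (U w) j w hTU, ← Finset.sum_neg_distrib]
      apply Finset.sum_congr rfl
      intro v hv
      have hv' : p v = j := by simpa using (Finset.mem_filter.1 hv).2
      unfold orbMut
      rw [horb, horb, hv', if_pos hc]
    · rw [if_neg hc, half_formula]
      have e1 : ∀ v ∈ {v ∈ U w | v ∈ p ⁻¹' {j}}, orbMut Γ i b v w =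
          b v w + ∑ x ∈ T w with x ∈ MulAction.orbit Γ i,
            (max (b v x) 0 * max (b x w) 0 - max (-b v x) 0 * max (-b x w) 0) := by
        intro v hv
        have hv' : p v = j := by simpa using (Finset.mem_filter.1 hv).2
        exact hmut v w (by rw [hv']; exact hc)
      rw [Finset.sum_congr rfl e1, Finset.sum_add_distrib, hB (U w) j w hTU, Finset.sum_comm]
      congr 1
      have horbset : MulAction.orbit Γ i = p ⁻¹' {p i} := by
        ext v; simp [horb]
      have e2 : ∀ x ∈ {x ∈ T w | x ∈ MulAction.orbit Γ i},
          ∑ v ∈ U w with v ∈ p ⁻¹' {j},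
            (max (b v x) 0 * max (b x w) 0 - max (-b v x) 0 * max (-b x w) 0) =
          max (B j (p i)) 0 * max (b x w) 0 - max (-B j (p i)) 0 * max (-b x w) 0 := by
        intro x hx
        obtain ⟨hx1, hx2⟩ := Finset.mem_filter.1 hx
        have hTx : T x ⊆ U w := fun v hv =>
          Finset.mem_union_right _ (Finset.mem_biUnion.2 ⟨x, hx1, hv⟩)
        rw [Finset.sum_sub_distrib, ← Finset.sum_mul, ← Finset.sum_mul,
          sum_pos_part _ _ (hco (U w) j x), sum_neg_part _ _ (hco (U w) j x),
          hB (U w) j x hTx, (horb x).1 hx2]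
      rw [Finset.sum_congr rfl e2, Finset.sum_sub_distrib, ← Finset.mul_sum, ← Finset.mul_sum,
        horbset, sum_pos_part _ _ (hco (T w) (p i) w), sum_neg_part _ _ (hco (T w) (p i) w),
        hB (T w) (p i) w subset_rfl]
  exact ⟨hcov', hnl', signSkew_of_covering hskew' hloc' hnl' hn2' hsurj hfib hcov'⟩
end

section
/- Let Γ act on a locally finite quiver b : V → V → ℤ (skew-symmetric and Γ-equivariant) with no Γ-loops and no Γ-2-cycles, and fix a vertex i ∈ V. Then the orbit mutation b' = μ̃_{[i]}(b) has no Γ-loops: b' v (g • v) = 0 for all v ∈ V and g ∈ Γ. -/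
/-- If the quiver `b` has no `Γ`-loops and no `Γ`-2-cycles, then the orbit mutation of `b`
at the orbit of any vertex `i` has no `Γ`-loops. -/
theorem orbit_mutation_no_gamma_loops {V Γ : Type} [Group Γ] [MulAction Γ V]
    (b : V → V → ℤ) (hskew : SkewSymm b) (hequiv : Equivariant Γ b) (hloc : LocFin b)
    (hnl : NoGammaLoops Γ b) (hn2 : NoGamma2Cycles Γ b) (i : V) :
    NoGammaLoops Γ (orbMut Γ i b) := by
  intro v g
  unfold orbMut
  split_ifs with h
  · rw [hnl v g, neg_zero]
  · rw [hnl v g, zero_add]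
    have hv : v ∉ MulAction.orbit Γ i := fun hv => h (Or.inl hv)
    apply finsum_mem_eq_zero_of_forall_eq_zero
    intro j hj
    have hvj : v ∉ MulAction.orbit Γ j := by
      rw [MulAction.orbit_eq_iff.mpr hj]
      exact hv
    have hjv : j ∉ MulAction.orbit Γ v := fun hh =>
      hvj (MulAction.mem_orbit_symm.mp hh)
    have h1 : ¬ (0 < b v j ∧ 0 < b j (g • v)) := fun hh =>
      hn2 ⟨v, j, g, hjv, hh.1, hh.2⟩
    have h2 : ¬ (b v j < 0 ∧ b j (g • v) < 0) := by
      rintro ⟨hp, hq⟩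
      refine hn2 ⟨j, v, g⁻¹, hvj, ?_, ?_⟩
      · rw [hskew j v]; linarith
      · have e := hequiv g v (g⁻¹ • j)
        rw [smul_inv_smul] at e
        rw [← e, hskew (g • v) j]; linarith
    have key : |b v j| * b j (g • v) + b v j * |b j (g • v)| = 0 := by
      rcases lt_trichotomy (b v j) 0 with hp | hp | hp
      · have hq : 0 ≤ b j (g • v) := not_lt.mp fun hq => h2 ⟨hp, hq⟩
        rw [abs_of_neg hp, abs_of_nonneg hq]; ring
      · simp [hp]
      · have hq : b j (g • v) ≤ 0 := not_lt.mp fun hq => h1 ⟨hp, hq⟩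
        rw [abs_of_pos hp, abs_of_nonpos hq]; ring
    rw [key]; rfl
end

section
/- Let V be a type, M : V → V → ℤ a function, and S a finite subset of V such that M a b = 0 for all a, b ∈ S. Then for any duplicate-free list k₁, …, k_m enumerating the elements of S, the composite of single-vertex mutations μ_{k_m} ∘ ⋯ ∘ μ_{k_1} applied to M equals the function M' given by M' v w = - M v w if v ∈ S or w ∈ S, and M' v w = M v w + ∑_{k ∈ S} (|M v k| * M k w + M v k * |M k w|) / 2 otherwise; in particular, the composite is independent of the order of the enumeration. -/
open Classical in
/-- Single-vertex mutation of `M : V → V → ℤ` at the vertex `k`. -/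
noncomputable def mutV {V : Type} (k : V) (M : V → V → ℤ) : V → V → ℤ :=
  fun v w =>
    if v = k ∨ w = k then - M v w
    else M v w + (|M v k| * M k w + M v k * |M k w|) / 2

open Classical in
theorem foldl_mutV_list {V : Type} (l : List V) : ∀ (M : V → V → ℤ)
    (_ : ∀ a ∈ l, ∀ b ∈ l, M a b = 0) (_ : l.Nodup) (v w : V),
    l.foldl (fun N k => mutV k N) M v w =
      if v ∈ l ∨ w ∈ l then - M v w
      else M v w + (l.map (fun k => (|M v k| * M k w + M v k * |M k w|) / 2)).sum := by
  induction l with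
  | nil => intro M _ _ v w; simp
  | cons a l ih =>
    intro M hM hnd v w
    obtain ⟨hal, hnd'⟩ := List.nodup_cons.mp hnd
    have haa : M a a = 0 := hM a (by simp) a (by simp)
    have hak : ∀ k ∈ l, M a k = 0 := fun k hk => hM a (by simp) k (by simp [hk])
    have hka : ∀ k ∈ l, M k a = 0 := fun k hk => hM k (by simp [hk]) a (by simp)
    have hne : ∀ k ∈ l, k ≠ a := fun k hk h => hal (h ▸ hk)
    -- entries in the rows and columns of `l`
    have hcol : ∀ x, ∀ k ∈ l, mutV a M x k = M x k := by
      intro x k hk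
      by_cases hx : x = a
      · subst hx; simp [mutV, hak k hk]
      · simp [mutV, hx, hne k hk, hak k hk]
    have hrow : ∀ x, ∀ k ∈ l, mutV a M k x = M k x := by
      intro x k hk
      by_cases hx : x = a
      · subst hx; simp [mutV, hka k hk]
      · simp [mutV, hx, hne k hk, hka k hk]
    rw [List.foldl_cons, ih (mutV a M) (fun x hx y hy => by
      rw [hcol x y hy]; exact hM x (by simp [hx]) y (by simp [hy])) hnd']
    have hsum : (l.map (fun k => (|mutV a M v k| * mutV a M k w
          + mutV a M v k * |mutV a M k w|) / 2))
        = l.map (fun k => (|M v k| * M k w + M v k * |M k w|) / 2) :=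
      List.map_congr_left (fun k hk => by rw [hcol v k hk, hrow w k hk])
    rw [hsum]
    by_cases hv : v ∈ l
    · simp [hv, hrow w v hv]
    by_cases hw : w ∈ l
    · simp [hw, hcol v w hw]
    by_cases hva : v = a ∨ w = a
    · have hz : (l.map (fun k => (|M v k| * M k w + M v k * |M k w|) / 2)).sum = 0 := by
        apply List.sum_eq_zero
        intro x hx
        obtain ⟨k, hk, rfl⟩ := List.mem_map.mp hx
        rcases hva with rfl | rfl
        · simp [hak k hk]
        · simp [hka k hk]
      have hmem : v ∈ a :: l ∨ w ∈ a :: l := by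
        rcases hva with h | h <;> simp [h]
      rw [if_neg (by tauto), if_pos hmem, hz]
      simp [mutV, hva]
    · have h1 : ¬ (v ∈ a :: l ∨ w ∈ a :: l) := by
        simp only [List.mem_cons]; tauto
      rw [if_neg (by tauto), if_neg h1, List.map_cons, List.sum_cons]
      simp only [mutV, if_neg hva]
      ring

open Classical in
/-- If `S` is a finite set of vertices with `M a b = 0` for all `a, b ∈ S`, then the composite
of the single-vertex mutations at the elements of `S`, taken in any order given by a
duplicate-free enumeration of `S`, equals the simultaneous mutation at `S`; in particular it
does not depend on the order of the enumeration. -/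
theorem foldl_mutV_eq_simultaneous {V : Type} (M : V → V → ℤ) (S : Finset V)
    (hS : ∀ a ∈ S, ∀ b ∈ S, M a b = 0)
    (l : List V) (hnd : l.Nodup) (hl : ∀ k, k ∈ l ↔ k ∈ S) :
    l.foldl (fun N k => mutV k N) M = fun v w =>
      if v ∈ S ∨ w ∈ S then - M v w
      else M v w + ∑ k ∈ S, (|M v k| * M k w + M v k * |M k w|) / 2 := by
  have hSl : S = l.toFinset := by ext k; simp [hl]
  funext v w
  rw [foldl_mutV_list l M (fun a ha b hb => hS a ((hl a).1 ha) b ((hl b).1 hb)) hnd v w]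
  simp only [hl]
  rw [hSl, List.sum_toFinset _ hnd]
end

section
/- Let V be a type and arr : V → V → Prop an arrow relation with no loops (arr v v never holds) and no 2-cycles (arr v w and arr w v never hold simultaneously), and let G be the simple graph on V in which distinct v, w are adjacent iff arr v w or arr w v. Assume G is acyclic. Let h : V ≃ V be a quiver automorphism, i.e. arr (h v) (h w) ↔ arr v w for all v, w, and let S be a finite nonempty subset of V with h '' S = S such that the subgraph of G induced on S is connected. Then h has a fixed point in S: there exists v ∈ S with h v = v. -/
/-- In a tree the neighbour of `v` that is closer to `a` is unique. -/
theorem tree_closer_unique {W : Type} {T : SimpleGraph W} (hT : T.IsTree) {v w w' a : W}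
    (h1 : T.Adj v w) (h2 : T.Adj v w') (d1 : T.dist w a + 1 = T.dist v a)
    (d2 : T.dist w' a + 1 = T.dist v a) : w = w' := by
  obtain ⟨p, hp⟩ := hT.connected.exists_walk_length_eq_dist w a
  obtain ⟨q, hq⟩ := hT.connected.exists_walk_length_eq_dist w' a
  have hp' : (SimpleGraph.Walk.cons h1 p).IsPath :=
    SimpleGraph.Walk.isPath_of_length_eq_dist _ (by simp [hp, d1])
  have hq' : (SimpleGraph.Walk.cons h2 q).IsPath :=
    SimpleGraph.Walk.isPath_of_length_eq_dist _ (by simp [hq, d2])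
  have := (hT.existsUnique_path v a).unique hp' hq'
  have h3 := congrArg SimpleGraph.Walk.snd this
  simpa using h3

theorem tree_exists_closer {W : Type} {T : SimpleGraph W} (hT : T.IsTree) {v a : W}
    (hne : v ≠ a) : ∃ w, T.Adj v w ∧ T.dist w a + 1 = T.dist v a := by
  obtain ⟨p, hp⟩ := hT.connected.exists_walk_length_eq_dist v a
  cases p with
  | nil => exact absurd rfl hne
  | @cons _ w _ h q =>
    refine ⟨w, h, ?_⟩
    have h1 := SimpleGraph.dist_le q
    have h2 := hT.connected.dist_triangle (u := v) (v := w) (w := a)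
    have h3 : T.dist v w = 1 := SimpleGraph.dist_eq_one_iff_adj.2 h
    simp at hp
    omega

theorem tree_fixed {W : Type} [Fintype W] {T : SimpleGraph W} (hT : T.IsTree) (f : W → W)
    (hf : ∀ v w, T.Adj v w → T.Adj (f v) (f w))
    (hinv : ∀ v w, T.Adj v w → ¬ (f v = w ∧ f w = v)) : ∃ v, f v = v := by
  classical
  by_contra! hno
  choose n hn hd using fun v => tree_exists_closer hT (hno v).symm
  have hcard := hT.card_edgeFinset
  obtain ⟨v, -, w, -, hvw, he⟩ := Finset.exists_ne_map_eq_of_card_lt_of_maps_to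
    (s := (Finset.univ : Finset W)) (t := T.edgeFinset) (f := fun v => s(v, n v))
    (by rw [Finset.card_univ]; omega) (by intro v _; simpa using hn v)
  have h1 : n v = w ∧ n w = v := by
    simp only [Sym2.eq_iff] at he
    rcases he with ⟨h, _⟩ | ⟨h, h'⟩
    · exact absurd h hvw
    · exact ⟨h', h.symm⟩
  have hadj : T.Adj v w := h1.1 ▸ hn v
  have dv := hd v
  have dw := hd w
  rw [h1.1] at dv
  rw [h1.2] at dw
  have hab := hf v w hadj
  have dab : T.dist (f v) (f w) = 1 := SimpleGraph.dist_eq_one_iff_adj.2 hab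
  have dba : T.dist (f w) (f v) = 1 := SimpleGraph.dist_eq_one_iff_adj.2 hab.symm
  have tri := fun x y z => hT.connected.dist_triangle (u := x) (v := y) (w := z)
  have e1 := hT.dist_ne_of_adj v hab
  have e2 := hT.dist_ne_of_adj w hab
  have t1 := tri v (f v) (f w)
  have t2 := tri v (f w) (f v)
  have t3 := tri w (f v) (f w)
  have t4 := tri w (f w) (f v)
  have hxy : T.dist w (f v) = T.dist v (f w) := by omega
  by_cases hb : v = f w
  · refine hinv v w hadj ⟨?_, hb.symm⟩
    have h0 : T.dist v (f w) = 0 := by rw [← hb]; simp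
    rw [h0] at hxy
    exact (hT.connected.dist_eq_zero_iff.1 hxy).symm
  · obtain ⟨w', hw', dw'⟩ := tree_exists_closer hT hb
    have t5 := tri w' (f w) (f v)
    have t6 := tri v w' (f v)
    have dvw' : T.dist v w' = 1 := SimpleGraph.dist_eq_one_iff_adj.2 hw'
    have := tree_closer_unique hT hadj hw' dv (by omega)
    subst this
    omega


/-- Let `arr` be an arrow relation with no loops and no 2-cycles whose underlying simple
graph is acyclic, and let `h` be a quiver automorphism. If a finite nonempty `h`-invariant
set of vertices `S` induces a connected subgraph, then `h` has a fixed point in `S`. -/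
theorem automorphism_has_fixed_point {V : Type} (arr : V → V → Prop)
    (hloop : ∀ v, ¬ arr v v) (h2cyc : ∀ v w, arr v w → ¬ arr w v)
    (hac : (SimpleGraph.fromRel arr).IsAcyclic)
    (h : V ≃ V) (hhom : ∀ v w, arr (h v) (h w) ↔ arr v w)
    (S : Finset V) (hne : S.Nonempty) (hinv : (h : V → V) '' ↑S = (↑S : Set V))
    (hconn : (SimpleGraph.induce (↑S : Set V) (SimpleGraph.fromRel arr)).Connected) :
    ∃ v ∈ S, h v = v := by
  have hmem : ∀ v : (↑S : Set V), h v.1 ∈ (↑S : Set V) := fun v => by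
    exact hinv.subset ⟨v.1, v.2, rfl⟩
  have hT : (SimpleGraph.induce (↑S : Set V) (SimpleGraph.fromRel arr)).IsTree :=
    ⟨hconn, hac.induce _⟩
  have : Fintype (↑S : Set V) := Fintype.ofFinite _
  obtain ⟨v, hv⟩ := tree_fixed hT (fun v => ⟨h v.1, hmem v⟩)
    (by
      intro v w hvw
      simpa [SimpleGraph.fromRel_adj, hhom] using hvw)
    (by
      rintro v w hvw ⟨h1, h2⟩
      have h1' : h v.1 = w.1 := congrArg Subtype.val h1
      have h2' : h w.1 = v.1 := congrArg Subtype.val h2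
      have key := hhom v.1 w.1
      rw [h1', h2'] at key
      have hadj : v.1 ≠ w.1 ∧ (arr v.1 w.1 ∨ arr w.1 v.1) := by
        simpa [SimpleGraph.fromRel_adj] using hvw
      rcases hadj.2 with h3 | h3
      · exact h2cyc _ _ h3 (key.2 h3)
      · exact h2cyc _ _ h3 (key.1 h3))
  exact ⟨v.1, v.2, congrArg Subtype.val hv⟩
end

section
/- Let V be a type and arr : V → V → Prop an arrow relation with no loops (arr v v never holds) and no 2-cycles (arr v w and arr w v never hold simultaneously), and let G be the simple graph on V in which distinct v, w are adjacent iff arr v w or arr w v. Assume G is acyclic and connected. Let h : V ≃ V be a quiver automorphism, i.e. arr (h v) (h w) ↔ arr v w for all v, w. If h has no fixed points (h v ≠ v for all v ∈ V), then for every nonzero integer n the power hⁿ (computed in the group of permutations of V) has no fixed points. -/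
theorem fpf_aux {V : Type} (G : SimpleGraph V) (hconn : G.Connected)
    (h : G →g G) (hfix : ∀ v, h v ≠ v)
    (hinv : ∀ v, G.Adj v (h v) → h (h v) ≠ v) (v₀ : V) :
    ∃ v, ∃ p : G.Walk v (h v), p.IsPath ∧ 0 < p.length ∧
      ∀ x ∈ p.edges.getLast?, ∀ y ∈ p.edges.head?, x ≠ Sym2.map h y := by
  classical
  have hex : ∃ k, ∃ v, ∃ p : G.Walk v (h v), p.length = k :=
    ⟨_, v₀, (hconn v₀ (h v₀)).some, rfl⟩
  obtain ⟨v, p0, hp0⟩ := Nat.find_spec hex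
  have hmin : ∀ a (q : G.Walk a (h a)), p0.length ≤ q.length := by
    intro a q
    rw [hp0]
    exact Nat.find_min' hex ⟨a, q, rfl⟩
  have hmin : ∀ a (q : G.Walk a (h a)), p0.bypass.length ≤ q.length := fun a q =>
    (p0.length_bypass_le_length).trans (hmin a q)
  have hpath := p0.bypass_isPath
  generalize p0.bypass = p at hmin hpath
  refine ⟨v, p, hpath, ?_, ?_⟩
  · rw [Nat.pos_iff_ne_zero]
    intro h0
    exact hfix v (SimpleGraph.Walk.eq_of_length_eq_zero h0).symm
  · clear hpath
    generalize hw : h v = w at p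
    cases p with
    | nil => exact absurd hw (hfix _)
    | @cons _ a _ hadj p' =>
      intro x hx y hy
      simp only [SimpleGraph.Walk.edges_cons, List.head?_cons, Option.mem_def,
        Option.some.injEq] at hy
      subst hy
      cases p' with
      | nil =>
        subst hw
        simp at hx
        subst hx
        intro he
        have := hinv v hadj
        have := hfix v
        simp only [Sym2.map_mk, Sym2.eq_iff] at he
        grind
      | cons hadj2 p2 =>
        obtain ⟨b, q, hb, hq⟩ := SimpleGraph.Walk.exists_cons_eq_concat hadj2 p2
        have hlen := congrArg SimpleGraph.Walk.length hq
        rw [hq] at hx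
        simp only [SimpleGraph.Walk.length_cons, SimpleGraph.Walk.length_concat] at hlen
        have hx' : x = s(b, w) := by
          rw [SimpleGraph.Walk.edges_cons, SimpleGraph.Walk.edges_concat,
            List.concat_eq_append, ← List.cons_append] at hx
          rw [List.getLast?_append] at hx
          simpa [eq_comm] using hx
        subst hx'
        intro he
        simp only [Sym2.map_mk, Sym2.eq_iff, hw] at he
        have hbw := hb.ne
        have hba : b = h a := by grind
        subst hba
        have := hmin a q
        simp only [SimpleGraph.Walk.length_cons] at this
        omega

theorem fpf_iter {V : Type} (G : SimpleGraph V)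
    (h : G →g G) (hinj : Function.Injective h) (v : V) (p : G.Walk v (h v))
    (hpos : 0 < p.length) (hch : p.edges.IsChain (· ≠ ·))
    (hj : ∀ x ∈ p.edges.getLast?, ∀ y ∈ p.edges.head?, x ≠ Sym2.map h y) (m : ℕ) :
    ∃ q : G.Walk v (h^[m+1] v), q.edges.IsChain (· ≠ ·) ∧ m + 1 ≤ q.length ∧
      q.edges.head? = p.edges.head? := by
  induction m with
  | zero => exact ⟨p, hch, hpos, rfl⟩
  | succ m ih =>
    obtain ⟨q, hq, hl, hh⟩ := ih
    have hp : p.edges ≠ [] := by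
      intro h0
      rw [← SimpleGraph.Walk.length_edges, h0] at hpos
      simp at hpos
    rw [Function.iterate_succ_apply']
    refine ⟨p.append (q.map h), ?_, ?_, ?_⟩
    · rw [SimpleGraph.Walk.edges_append, SimpleGraph.Walk.edges_map, List.isChain_append]
      refine ⟨hch, ?_, ?_⟩
      · rw [List.isChain_map]
        exact hq.imp fun a b hab he => hab (Sym2.map.injective hinj he)
      · intro x hx y hy
        rw [List.head?_map, hh] at hy
        simp only [Option.mem_def, Option.map_eq_some_iff] at hy
        obtain ⟨z, hz, rfl⟩ := hy
        exact hj x hx z hz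
    · rw [SimpleGraph.Walk.length_append, SimpleGraph.Walk.length_map]; omega
    · rw [SimpleGraph.Walk.edges_append, List.head?_append_of_ne_nil _ hp]

/-- Let `arr` be an arrow relation with no loops and no 2-cycles whose underlying simple
graph is acyclic and connected, and let `h` be a quiver automorphism. If `h` has no fixed
points, then `h ^ n` has no fixed points for every nonzero integer `n`. -/
theorem fixed_point_free_powers {V : Type} (arr : V → V → Prop)
    (hloop : ∀ v, ¬ arr v v) (h2cyc : ∀ v w, arr v w → ¬ arr w v)
    (hac : (SimpleGraph.fromRel arr).IsAcyclic)
    (hconn : (SimpleGraph.fromRel arr).Connected)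
    (h : Equiv.Perm V) (hhom : ∀ v w, arr (h v) (h w) ↔ arr v w)
    (hfix : ∀ v, h v ≠ v) :
    ∀ n : ℤ, n ≠ 0 → ∀ v, (h ^ n) v ≠ v := by
  classical
  set G := SimpleGraph.fromRel arr with hG
  let f : G →g G := ⟨h, by
    intro a b hab
    rw [hG, SimpleGraph.fromRel_adj] at hab ⊢
    rw [hhom, hhom]
    exact ⟨fun he => hab.1 (h.injective he), hab.2⟩⟩
  have hf : ∀ x, f x = h x := fun _ => rfl
  have hinj : Function.Injective f := h.injective
  -- natural number powers
  have key : ∀ n : ℕ, n ≠ 0 → ∀ u, (h ^ n) u ≠ u := by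
    intro n hn u hu
    obtain ⟨v, p, hp, hpos, hj⟩ := fpf_aux G hconn f hfix (by
      intro v hv he
      rw [hf, hf] at he
      rw [hf, hG, SimpleGraph.fromRel_adj] at hv
      have h1 := hhom v (h v)
      have h2 := hhom (h v) v
      rw [he] at h1 h2
      rcases hv.2 with h3 | h3
      · exact h2cyc _ _ h3 (h1.2 h3)
      · exact h2cyc _ _ h3 (h2.2 h3)) u
    have hch := (hac.isPath_iff_isChain p).1 hp
    let r : G.Walk v u := (hconn v u).some
    obtain ⟨m, hm⟩ : ∃ m, m + 1 = n * (2 * r.length + 1) :=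
      ⟨n * (2 * r.length + 1) - 1, Nat.sub_add_cancel (Nat.mul_pos (by omega) (by omega))⟩
    obtain ⟨q, hq, hl, -⟩ := fpf_iter G f hinj v p hpos hch hj m
    have hqp := (hac.isPath_iff_isChain q).2 hq
    have hfu : f^[m + 1] u = u := by
      rw [hm, Function.iterate_mul]
      apply Function.iterate_fixed
      change (h : V → V)^[n] u = u
      rw [← Equiv.Perm.coe_pow]
      exact hu
    have hr : ∀ k : ℕ, ∃ r' : G.Walk (f^[k] u) (f^[k] v), r'.length = r.length := by
      intro k
      induction k with
      | zero => exact ⟨r.reverse, by simp⟩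
      | succ k ih =>
        obtain ⟨r', hr'⟩ := ih
        rw [Function.iterate_succ_apply', Function.iterate_succ_apply']
        exact ⟨r'.map f, by simpa using hr'⟩
    obtain ⟨r', hr'⟩ := hr (m + 1)
    have hs : ∃ s : G.Walk v (f^[m + 1] v), s.length = 2 * r.length := by
      refine ⟨r.append (r'.copy hfu rfl), ?_⟩
      rw [SimpleGraph.Walk.length_append, SimpleGraph.Walk.length_copy]
      omega
    obtain ⟨s, hs⟩ := hs
    have := congrArg (fun t : G.Path v (f^[m + 1] v) => t.1.length)
      (hac.path_unique ⟨q, hqp⟩ ⟨s.bypass, s.bypass_isPath⟩)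
    have h3 := s.length_bypass_le_length
    simp only at this
    have : 2 * r.length + 1 ≤ n * (2 * r.length + 1) := Nat.le_mul_of_pos_left _ (by omega)
    omega
  intro n hn v hv
  rcases Int.eq_nat_or_neg n with ⟨k, rfl | rfl⟩
  · exact key k (by simpa using hn) v (by simpa using hv)
  · refine key k (by simpa using hn) v ?_
    rw [zpow_neg, zpow_natCast, Equiv.Perm.inv_eq_iff_eq] at hv
    exact hv.symm
end
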